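/- Every Conway invariant weak Jacobi form of index 3 and weight k < −14 vanishes: J^{w,Co₀}_{k,Λ,3} = {0} for all integers k < −14. -/

import Mathlib

open Complex Matrix UpperHalfPlane
open scoped Manifold MatrixGroups Real Topology BigOperators

noncomputable section

/-- Vectors of the rank-24 lattice (coordinates w.r.t. a fixed basis). -/
abbrev LV := Fin 24 → ℤ

/-- Complexified vectors. -/
abbrev CV := Fin 24 → ℂ

/-- The bilinear form attached to a Gram matrix `B`. -/
def pairZ (B : Matrix (Fin 24) (Fin 24) ℤ) (v u : LV) : ℤ := v ⬝ᵥ B.mulVec u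

/-- The complex bilinear extension of the form. -/
def pairC (B : Matrix (Fin 24) (Fin 24) ℤ) (z w : CV) : ℂ :=
  z ⬝ᵥ ((B.map (Int.cast : ℤ → ℂ)).mulVec w)

/-- Inclusion of lattice vectors into complexified vectors. -/
def liftC (v : LV) : CV := fun i => (v i : ℂ)

/-- `B` is a Gram matrix of the Leech lattice: even, unimodular, positive definite of
rank 24, with no vectors of norm 2 (no roots). -/
def IsLeech (B : Matrix (Fin 24) (Fin 24) ℤ) : Prop :=
  B.IsSymm ∧ B.det = 1 ∧ (∀ v : LV, v ≠ 0 → 0 < pairZ B v v) ∧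
    (∀ v : LV, Even (pairZ B v v)) ∧ (∀ v : LV, pairZ B v v ≠ 2)

/-- The automorphism group `Co₀ = Aut(Λ)` of the lattice, as a set of integral matrices. -/
def ConwayGroup (B : Matrix (Fin 24) (Fin 24) ℤ) : Set (Matrix (Fin 24) (Fin 24) ℤ) :=
  {σ | IsUnit σ.det ∧ σᵀ * B * σ = B}

/-- Action of an integral matrix on complexified vectors. -/
def actC (σ : Matrix (Fin 24) (Fin 24) ℤ) (z : CV) : CV :=
  (σ.map (Int.cast : ℤ → ℂ)).mulVec z

/-- `e(x) = exp(2πix)`. -/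
def eC (x : ℂ) : ℂ := Complex.exp (2 * (Real.pi : ℂ) * Complex.I * x)

/-- The Fourier term `qⁿ ζ^ℓ`. -/
def fterm (B : Matrix (Fin 24) (Fin 24) ℤ) (n : ℕ) (ℓ : LV) (τ : UpperHalfPlane) (z : CV) : ℂ :=
  eC ((n : ℂ) * (τ : ℂ)) * eC (pairC B (liftC ℓ) z)

/-- Lower-left entry of `A ∈ SL(2,ℤ)`, as a complex number. -/
def slc (A : SL(2, ℤ)) : ℂ := ((A : Matrix (Fin 2) (Fin 2) ℤ) 1 0 : ℤ)

/-- Lower-right entry of `A ∈ SL(2,ℤ)`, as a complex number. -/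
def sld (A : SL(2, ℤ)) : ℂ := ((A : Matrix (Fin 2) (Fin 2) ℤ) 1 1 : ℤ)

/-- The automorphy factor `cτ + d`. -/
def jfactor (A : SL(2, ℤ)) (τ : UpperHalfPlane) : ℂ := slc A * (τ : ℂ) + sld A

/-- `φ : ℍ × (Λ⊗ℂ) → ℂ` is a Conway invariant weak Jacobi form of weight `k` and index `t`
with Fourier coefficients `f`. -/
structure IsJacobiFormWith (B : Matrix (Fin 24) (Fin 24) ℤ) (k : ℤ) (t : ℕ)
    (φ : UpperHalfPlane → CV → ℂ) (f : ℕ → LV → ℂ) : Prop where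
  holo_tau : ∀ z : CV, MDifferentiable 𝓘(ℂ) 𝓘(ℂ) fun τ : UpperHalfPlane => φ τ z
  holo_z : ∀ τ : UpperHalfPlane, Differentiable ℂ (φ τ)
  conway_invar : ∀ σ ∈ ConwayGroup B, ∀ (τ : UpperHalfPlane) (z : CV), φ τ (actC σ z) = φ τ z
  quasi_periodic : ∀ (x y : LV) (τ : UpperHalfPlane) (z : CV),
    φ τ (z + (τ : ℂ) • liftC x + liftC y) =
      Complex.exp (-(t : ℂ) * (Real.pi : ℂ) * Complex.I * (pairZ B x x : ℂ) * (τ : ℂ)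
        - 2 * (t : ℂ) * (Real.pi : ℂ) * Complex.I * pairC B (liftC x) z) * φ τ z
  modular : ∀ (A : SL(2, ℤ)) (τ : UpperHalfPlane) (z : CV),
    φ (A • τ) ((jfactor A τ)⁻¹ • z) =
      (jfactor A τ) ^ k *
        Complex.exp ((t : ℂ) * (Real.pi : ℂ) * Complex.I * slc A * pairC B z z / jfactor A τ) *
        φ τ z
  expansion : ∀ (τ : UpperHalfPlane) (z : CV),
    HasSum (fun p : ℕ × LV => f p.1 p.2 * fterm B p.1 p.2 τ z) (φ τ z)

/-- Conway invariant weak Jacobi forms. -/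
def IsWeakJacobiForm (B : Matrix (Fin 24) (Fin 24) ℤ) (k : ℤ) (t : ℕ)
    (φ : UpperHalfPlane → CV → ℂ) : Prop :=
  ∃ f, IsJacobiFormWith B k t φ f

/-- Conway invariant holomorphic Jacobi forms. -/
def IsHolJacobiForm (B : Matrix (Fin 24) (Fin 24) ℤ) (k : ℤ) (t : ℕ)
    (φ : UpperHalfPlane → CV → ℂ) : Prop :=
  ∃ f, IsJacobiFormWith B k t φ f ∧
    ∀ (n : ℕ) (ℓ : LV), 2 * (n : ℤ) * t - pairZ B ℓ ℓ < 0 → f n ℓ = 0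

/-- Modular forms of weight `k` on `SL₂(ℤ)`; the ring of all of them is `ℂ[E₄,E₆]`. -/
abbrev MForm (k : ℤ) := ModularForm (CongruenceSubgroup.Gamma 1) k

/-- The family `φ i` (of weights `w i`) freely generates the module of all forms satisfying
`P` over the ring `M_*(SL₂(ℤ)) = ℂ[E₄,E₆]` of modular forms on `SL₂(ℤ)`. -/
def FreelyGenerates (P : ℤ → (UpperHalfPlane → CV → ℂ) → Prop) {n : ℕ}
    (w : Fin n → ℤ) (φ : Fin n → UpperHalfPlane → CV → ℂ) : Prop :=
  (∀ i, P (w i) (φ i)) ∧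
  ∀ (k : ℤ) (ψ : UpperHalfPlane → CV → ℂ), P k ψ →
    ∃! g : (i : Fin n) → MForm (k - w i),
      ∀ (τ : UpperHalfPlane) (z : CV), ψ τ z = ∑ i, (g i) τ * φ i τ z

/-- The point `(aτ+b)/d` of the upper half-plane (for `a, d > 0`). -/
def heckePt (a d b : ℕ) (τ : UpperHalfPlane) : UpperHalfPlane :=
  if h : 0 < ((((a : ℂ) * (τ : ℂ) + (b : ℂ)) / (d : ℂ)).im) then
    ⟨((a : ℂ) * (τ : ℂ) + (b : ℂ)) / (d : ℂ), h⟩ else τ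

/-- The Hecke operator `T₋(m)` on Jacobi forms of weight `k`. -/
def heckeOp (k : ℤ) (m : ℕ) (φ : UpperHalfPlane → CV → ℂ) : UpperHalfPlane → CV → ℂ :=
  fun τ z => (m : ℂ)⁻¹ * ∑ d ∈ m.divisors, ∑ b ∈ Finset.range d,
    ((m / d : ℕ) : ℂ) ^ k * φ (heckePt (m / d) d b τ) (((m / d : ℕ) : ℂ) • z)

/-- The Jacobi theta function `Θ_Λ = A₁` of the lattice. -/
def thetaLeech (B : Matrix (Fin 24) (Fin 24) ℤ) : UpperHalfPlane → CV → ℂ := fun τ z =>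
  ∑' ℓ : LV, Complex.exp ((Real.pi : ℂ) * Complex.I * (pairZ B ℓ ℓ : ℂ) * (τ : ℂ)
    + 2 * (Real.pi : ℂ) * Complex.I * pairC B (liftC ℓ) z)

/-- `σ_k(n) = Σ_{d ∣ n} d^k`. -/
def sigmaNat (k n : ℕ) : ℕ := ∑ d ∈ n.divisors, d ^ k

/-- `A_t = σ₁₁(t)⁻¹ (A₁ | T₋(t))`, a holomorphic Jacobi form of weight 12 and index `t`. -/
def Aform (B : Matrix (Fin 24) (Fin 24) ℤ) (t : ℕ) : UpperHalfPlane → CV → ℂ := fun τ z =>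
  ((sigmaNat 11 t : ℂ))⁻¹ * heckeOp 12 t (thetaLeech B) τ z

/-- The quasimodular Eisenstein series `E₂`. -/
def E2 : UpperHalfPlane → ℂ := fun τ =>
  1 - 24 * ∑' n : ℕ, (sigmaNat 1 (n + 1) : ℂ) * eC (((n : ℂ) + 1) * (τ : ℂ))

/-- The discriminant cusp form `Δ(τ) = q ∏ (1-qⁿ)^24`. -/
def DeltaForm : UpperHalfPlane → ℂ := fun τ =>
  eC (τ : ℂ) * ∏' n : ℕ, (1 - eC (((n : ℂ) + 1) * (τ : ℂ))) ^ 24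

/-- `aτ`. -/
def scaleH (a : ℕ) (τ : UpperHalfPlane) : UpperHalfPlane := heckePt a 1 0 τ

/-- `(τ+j)/t`. -/
def sliceH (t j : ℕ) (τ : UpperHalfPlane) : UpperHalfPlane := heckePt 1 t j τ

/-- `f₂(τ) = (tE₂(tτ) - E₂(τ))/(t-1)`, a modular form of weight 2 on `Γ₀(t)`. -/
def f2w (t : ℕ) (τ : UpperHalfPlane) : ℂ := ((t : ℂ) * E2 (scaleH t τ) - E2 τ) / ((t : ℂ) - 1)

/-- `B_t`, a holomorphic Jacobi form of weight 14 and index `t` (for `t` prime). -/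
def Bform (B : Matrix (Fin 24) (Fin 24) ℤ) (t : ℕ) : UpperHalfPlane → CV → ℂ := fun τ z =>
  ((t : ℂ) ^ 12 / ((t : ℂ) ^ 12 - 1)) *
    (f2w t τ * thetaLeech B (scaleH t τ) ((t : ℂ) • z)
      - (t : ℂ) ^ (-13 : ℤ) *
        ∑ j ∈ Finset.range t, f2w t (sliceH t j τ) * thetaLeech B (sliceH t j τ) z)

/-- Fourier coefficients of `E₂`. -/
def e2coeff : ℕ → ℂ := fun m => if m = 0 then 1 else -24 * (sigmaNat 1 m : ℂ)

/-- Fourier coefficients of the image `H_k(φ)` of the modified heat operator applied to a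
Jacobi form of weight `k` and index `t` with Fourier coefficients `f`:
`H_k(φ) = 𝓗(φ) + ((12-k)/12)E₂φ` where `𝓗` multiplies `f(n,ℓ)` by `n - (ℓ,ℓ)/(2t)`. -/
def heatCoeff (B : Matrix (Fin 24) (Fin 24) ℤ) (k : ℤ) (t : ℕ) (f : ℕ → LV → ℂ) :
    ℕ → LV → ℂ := fun n ℓ =>
  ((n : ℂ) - (pairZ B ℓ ℓ : ℂ) / (2 * (t : ℂ))) * f n ℓ +
    ((12 - k : ℤ) : ℂ) / 12 * ∑ m ∈ Finset.range (n + 1), e2coeff m * f (n - m) ℓ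

/-- The function with Fourier coefficients `f`. -/
def fourierSeries (B : Matrix (Fin 24) (Fin 24) ℤ) (f : ℕ → LV → ℂ) :
    UpperHalfPlane → CV → ℂ := fun τ z =>
  ∑' p : ℕ × LV, f p.1 p.2 * fterm B p.1 p.2 τ z

/-- The family `Φ m = Φ_{12,m}` of Fourier–Jacobi coefficients of the Borcherds form `Φ₁₂`
at the Leech cusp:
`Δ(τ)·exp(−Σ_{m≥1}((Δ⁻¹A₁)|T₋(m))(τ,𝔷)e^{2πimω}) = Σ_{m≥0} Φ_{12,m}(τ,𝔷)e^{2πimω}`. -/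
def IsFJExpansionOfPhi12 (B : Matrix (Fin 24) (Fin 24) ℤ)
    (Φ : ℕ → UpperHalfPlane → CV → ℂ) : Prop :=
  ∀ (τ ω : UpperHalfPlane) (z : CV),
    HasSum (fun m : ℕ => Φ m τ z * eC ((m : ℂ) * (ω : ℂ)))
      (DeltaForm τ * Complex.exp
        (- ∑' m : ℕ, heckeOp 0 (m + 1) (fun σ w => thetaLeech B σ w / DeltaForm σ) τ z *
            eC (((m : ℂ) + 1) * (ω : ℂ))))

/-- `S_t`: the set of lattice vectors of minimal norm in their coset modulo `tΛ`. -/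
def minimalSet (B : Matrix (Fin 24) (Fin 24) ℤ) (t : ℕ) : Set LV :=
  {v | ∀ u : LV, (∃ w : LV, u = v + (t : ℤ) • w) → pairZ B v v ≤ pairZ B u u}

/-- `v` and `u` are conjugate modulo `tΛ` up to the Conway group. -/
def conjModT (B : Matrix (Fin 24) (Fin 24) ℤ) (t : ℕ) (v u : LV) : Prop :=
  ∃ σ ∈ ConwayGroup B, ∃ w : LV, v - σ.mulVec u = (t : ℤ) • w

/-- `s(t) = |(S_t/Co₀)/tΛ|`. -/
def sRank (B : Matrix (Fin 24) (Fin 24) ℤ) (t : ℕ) : ℕ :=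
  Nat.card (Quot (fun v u : minimalSet B t => conjModT B t v.1 u.1))

/-- `R` is a system of representatives for `(S_t/Co₀)/tΛ` (of minimal length). -/
def IsRepSystem (B : Matrix (Fin 24) (Fin 24) ℤ) (t : ℕ) (R : Finset LV) : Prop :=
  (↑R ⊆ minimalSet B t) ∧ ∀ v ∈ minimalSet B t, ∃! r, r ∈ R ∧ conjModT B t v r

/-- The Conway orbit of a lattice vector. -/
def orbitOf (B : Matrix (Fin 24) (Fin 24) ℤ) (v : LV) : Set LV :=
  {u | ∃ σ ∈ ConwayGroup B, u = σ.mulVec v}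

/-- `O` is a Conway orbit of Leech vectors of type `x` (i.e. norm `2x`) with `c` elements. -/
def OrbitData (B : Matrix (Fin 24) (Fin 24) ℤ) (O : Set LV) (x c : ℕ) : Prop :=
  (∃ v : LV, O = orbitOf B v) ∧ (∀ v ∈ O, pairZ B v v = 2 * (x : ℤ)) ∧ Nat.card O = c

/-- `W` is a `d`-dimensional subspace of the space of functions `ℍ × (Λ⊗ℂ) → ℂ`. -/
def SpanDimIs (W : (UpperHalfPlane → CV → ℂ) → Prop) (d : ℕ) : Prop :=
  ∃ φ : Fin d → UpperHalfPlane → CV → ℂ, (∀ i, W (φ i)) ∧ LinearIndependent ℂ φ ∧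
    ∀ ψ, W ψ → ∃ c : Fin d → ℂ, ψ = ∑ i, c i • φ i


local notation "FT" => Fin 24
local notation "SF" => Finset (Fin 24)
local notation "MZ" => Matrix (Fin 24) (Fin 24) ℤ
local notation "MC" => Matrix (Fin 24) (Fin 24) ℂ
local notation "BL" L:arg => L →ₗ[ℤ] L →ₗ[ℤ] ℤ
local notation "EL" L:arg => L →ₗ[ℤ] L
theorem scg {ι M : Type*} [AddCommMonoid M] {s : Finset ι} {f g : ι → M} (h : ∀ x ∈ s, f x = g x) : s.sum f = s.sum g :=
  Finset.sum_congr rfl h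
structure LL {L : Type} [AddCommGroup L] (b : BL L) : Prop where
  symm : ∀ x y, b x y = b y x
  pos : ∀ x, x ≠ 0 → 0 < b x x
  even : ∀ x, b x x % 2 = 0
  no2 : ∀ x, b x x ≠ 2
  unim : ∀ f : L →ₗ[ℤ] ℤ, ∃ x, ∀ y, b x y = f y
  rank : ∀ a : FT → L, (∀ i j, b (a i) (a j) = if i = j then 8 else 0) →
    ∀ x, (8:ℤ) • x = ∑ i, b x (a i) • a i
  rep : ∀ x, ∃ t y, x = t + (2:ℤ) • y ∧ (b t t = 0 ∨ b t t = 4 ∨ b t t = 6 ∨ b t t = 8)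
  frame : ∀ t, b t t = 8 → ∃ a : FT → L, (∀ i j, b (a i) (a j) = if i = j then 8 else 0) ∧
    a 0 = t ∧ ∀ i, ∃ y, a i = t + (2:ℤ) • y
  ex8 : ∃ t, b t t = 8
section latt
variable {L : Type} [AddCommGroup L] {b : BL L}
def Isom (b : BL L) (σ : EL L) : Prop := ∀ x y, b (σ x) (σ y) = b x y
theorem Isom.comp {σ τ : EL L} (h : Isom b σ) (ai : Isom b τ) : Isom b (σ ∘ₗ τ) :=
  fun x y => by simp [h _ _, ai _ _]
structure Fr (b : BL L) (a : FT → L) : Prop where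
  orth : ∀ i j, b (a i) (a j) = if i = j then 8 else 0
  cong : ∀ i j, ∃ y, a i = a j + (2:ℤ) • y
theorem Fr.self {a : FT → L} (F : Fr b a) (i) : b (a i) (a i) = 8 := by simp [F.orth]
theorem Fr.ne {a : FT → L} (F : Fr b a) {i j} (h : i ≠ j) : b (a i) (a j) = 0 := by
  simp [F.orth, h]
namespace LL
variable (H : LL b)
include H
theorem add2 (x y : L) : b (x + y) (x + y) = b x x + 2 * b x y + b y y := by
  simp only [map_add, LinearMap.add_apply, H.symm y x]; ring
theorem sub2 (x y : L) : b (x - y) (x - y) = b x x - 2 * b x y + b y y := by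
  simp only [map_sub, LinearMap.sub_apply, H.symm y x]; ring
omit H in
theorem smul2 (c : ℤ) (x : L) : b (c • x) (c • x) = c ^ 2 * b x x := by
  simp only [map_smul, LinearMap.smul_apply, smul_eq_mul]; ring
omit H in
theorem neg2 (x : L) : b (-x) (-x) = b x x := by simp
theorem eq_zero {x : L} (h : b x x ≤ 0) : x = 0 := by
  by_contra ai; exact absurd (H.pos x ai) (by omega)
theorem eq_of {x y : L} (h : b (x - y) (x - y) ≤ 0) : x = y := sub_eq_zero.1 (H.eq_zero h)
theorem nonneg (x : L) : 0 ≤ b x x := by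
  by_cases h : x = 0
  · simp [h]
  · exact (H.pos x h).le
theorem smul_inj {c : ℤ} (hc : c ≠ 0) {x y : L} (h : c • x = c • y) : x = y := by
  apply H.eq_of
  have ab : c • (x - y) = 0 := by rw [smul_sub, h, sub_self]
  have := smul2 (b := b) c (x - y)
  rw [ab, map_zero] at this
  rcases mul_eq_zero.1 this.symm with h | h
  · exact absurd h (pow_ne_zero 2 hc)
  · exact h.le
theorem ge4 {x : L} (h : x ≠ 0) : 4 ≤ b x x := by
  have := H.pos x h; have := H.even x; have := H.no2 x; omega
variable {a : FT → L} 
theorem mk_frame {t : L} (ht : b t t = 8) : ∃ a, Fr b a ∧ a 0 = t := by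
  obtain ⟨a, aa, ab, ae⟩ := H.frame t ht
  refine ⟨a, ⟨aa, fun i j => ?_⟩, ab⟩
  obtain ⟨y, hy⟩ := ae i
  obtain ⟨z, hz⟩ := ae j
  exact ⟨y - z, by rw [hy, hz]; module⟩
theorem sum8 (F : Fr b a) (x y : L) : 8 * b x y = ∑ i, b x (a i) * b y (a i) := by
  have := congrArg (fun z => b z y) (H.rank a F.orth x)
  simp only [map_smul, LinearMap.smul_apply, smul_eq_mul, map_sum, LinearMap.sum_apply] at this
  rw [this]; exact scg fun i _ => by rw [H.symm (a i) y]
theorem ext (F : Fr b a) {x y : L} (h : ∀ i, b x (a i) = b y (a i)) : x = y := by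
  apply H.eq_of
  have := H.sum8 F (x - y) (x - y)
  rw [Finset.sum_eq_zero fun i _ => by
    rw [map_sub, LinearMap.sub_apply, h i, sub_self, zero_mul]] at this
  omega
omit H in
theorem par (F : Fr b a) (x : L) (i j) : b x (a i) % 2 = b x (a j) % 2 := by
  obtain ⟨y, hy⟩ := F.cong i j
  rw [hy]; simp only [map_add, map_smul, smul_eq_mul]; omega
theorem ci (F : Fr b a) (c : FT → ℤ) (h : ∀ y, (8:ℤ) ∣ ∑ i, c i * b y (a i)) :
    ∃ x, ∀ i, b x (a i) = c i := by
  choose f hf using h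
  have hlin : ∀ y, f y = (∑ i, c i * b y (a i)) / 8 := fun y => by rw [hf]; simp
  obtain ⟨x, hx⟩ := H.unim
    { toFun := f
      map_add' := fun y z => by
        have aa := hf (y + z); have ab := hf y; have ae := hf z
        simp only [map_add, LinearMap.add_apply, mul_add, Finset.sum_add_distrib] at aa
        omega
      map_smul' := fun m y => by
        have aa := hf (m • y); have ab := hf y
        simp only [map_smul, LinearMap.smul_apply, smul_eq_mul, RingHom.id_apply] at aa ⊢
        have : ∑ i, c i * (m * b y (a i)) = m * ∑ i, c i * b y (a i) := by
          rw [Finset.mul_sum]; exact scg fun i _ => by ring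
        rw [this, ab] at aa
        have : (8:ℤ) * f (m • y) = 8 * (m * f y) := by rw [← aa]; ring
        omega }
  refine ⟨x, fun i => ?_⟩
  have aa := hx (a i)
  have ab := hf (a i)
  simp only [LinearMap.coe_mk, AddHom.coe_mk] at aa
  rw [aa]
  simp only [F.orth] at ab
  simp at ab; omega
theorem four (F : Fr b a) (m : FT → ℤ) (h : (∑ i, m i) % 2 = 0) :
    ∃ x, ∀ i, b x (a i) = 4 * m i := by
  refine H.ci F _ fun y => ?_
  have aa : ∀ i, ∃ k, b y (a i) = b y (a 0) + 2 * k := fun i =>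
    ⟨(b y (a i) - b y (a 0)) / 2, by have := par F y i 0; omega⟩
  choose k hk using aa
  have : ∑ i, 4 * m i * b y (a i) = 4 * b y (a 0) * (∑ i, m i) + 8 * ∑ i, m i * k i := by
    rw [Finset.mul_sum, Finset.mul_sum, ← Finset.sum_add_distrib]
    exact scg fun i _ => by rw [hk i]; ring
  rw [this]
  obtain ⟨s, hs⟩ : ∃ s, ∑ i, m i = 2 * s := ⟨(∑ i, m i) / 2, by omega⟩
  rw [hs]
  exact ⟨b y (a 0) * s + ∑ i, m i * k i, by ring⟩
theorem half (F : Fr b a) (i j : FT) (e : ℤ) (he : e = 1 ∨ e = -1) (hij : i ≠ j) :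
    ∃ x, (2:ℤ) • x = a i + e • a j ∧ b x x = 4 ∧ ∀ y, 2 * b y x = b y (a i) + e * b y (a j) := by
  obtain ⟨y, hy⟩ := F.cong i j
  have : ∃ x, (2:ℤ) • x = a i + e • a j := by
    rcases he with rfl | rfl
    · exact ⟨a j + y, by rw [hy]; module⟩
    · exact ⟨y, by rw [hy]; module⟩
  obtain ⟨x, hx⟩ := this
  have ae : ∀ y, 2 * b y x = b y (a i) + e * b y (a j) := fun y => by
    have := congrArg (fun z => b y z) hx
    simpa using this
  refine ⟨x, hx, ?_, ae⟩
  have aa := ae x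
  have ab := ae (a i); have al := ae (a j)
  rw [H.symm x (a i), H.symm x (a j)] at aa
  rw [F.self, F.ne hij] at ab
  rw [F.self, F.ne hij.symm] at al
  rcases he with rfl | rfl <;> simp at aa ab al <;> omega
theorem mod3 (F : Fr b a) {x : L} (h : ∀ i, b x (a i) % 3 = 0) : ∃ y, x = (3:ℤ) • y := by
  have ao := H.rank a F.orth x
  have : ∀ i, ∃ k, b x (a i) = 3 * k := fun i => ⟨b x (a i) / 3, by have := h i; omega⟩
  choose k hk using this
  refine ⟨(3:ℤ) • x - ∑ i, k i • a i, ?_⟩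
  have : (8:ℤ) • x = (3:ℤ) • ∑ i, k i • a i := by
    rw [ao, Finset.smul_sum]
    exact scg fun i _ => by rw [hk, mul_smul]
  rw [smul_sub, ← this]; module
end LL
end latt
section latt2
variable {L : Type} [AddCommGroup L] {b : BL L}
def Cd (b : BL L) (a : FT → L) (s : SF) : Prop :=
  ∃ x, ∀ i, b x (a i) % 4 = if i ∈ s then 2 else 0
namespace LL
variable (H : LL b) {a : FT → L} (F : Fr b a)
include H F
omit H F in
theorem cd_symm {s t : SF} (hs : Cd b a s) (ht : Cd b a t) :
    Cd b a (symmDiff s t) := by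
  obtain ⟨x, hx⟩ := hs
  obtain ⟨y, hy⟩ := ht
  refine ⟨x + y, fun i => ?_⟩
  have aa := hx i; have ab := hy i
  simp only [map_add, LinearMap.add_apply, Finset.mem_symmDiff]
  by_cases his : i ∈ s <;> by_cases hit : i ∈ t <;> simp [his, hit] at aa ab ⊢ <;> omega
theorem odd_ex : ∃ x, b x (a 0) % 2 = 1 := by
  by_contra hc
  push Not at hc
  have ag : ∀ x, ∃ k, b x (a 0) = 2 * k := fun x => ⟨b x (a 0) / 2, by have := hc x; omega⟩
  choose f hf using ag
  obtain ⟨y, hy⟩ := H.unim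
    { toFun := f
      map_add' := fun y z => by
        have aa := hf (y + z); have ab := hf y; have ae := hf z
        simp only [map_add, LinearMap.add_apply] at aa
        omega
      map_smul' := fun m y => by
        have aa := hf (m • y); have ab := hf y
        simp only [map_smul, LinearMap.smul_apply, smul_eq_mul, RingHom.id_apply] at aa ⊢
        rw [ab] at aa
        have : (2:ℤ) * f (m • y) = 2 * (m * f y) := by rw [← aa]; ring
        omega }
  simp only [LinearMap.coe_mk, AddHom.coe_mk] at hy
  have aa := hy y; have ab := hy (a 0); have ae := hf y; have al := hf (a 0)
  rw [F.self] at al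
  have := H.no2 y
  omega
theorem cd_univ : Cd b a Finset.univ := by
  obtain ⟨x, hx⟩ := H.odd_ex F
  refine ⟨(2:ℤ) • x, fun i => ?_⟩
  have := par F x i 0
  simp only [map_smul, LinearMap.smul_apply, smul_eq_mul, Finset.mem_univ, if_true]
  omega
omit H F in
theorem card_mod2 (X : FT → ℤ) (s : SF)
    (h : ∀ i, X i % 2 = if i ∈ s then 1 else 0) : (∑ i, X i) % 2 = (s.card : ℤ) % 2 := by
  rw [Finset.sum_int_mod]
  simp only [h]
  simp
omit H F in
theorem card_mod4 (X : FT → ℤ) (s : SF)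
    (h : ∀ i, X i % 4 = if i ∈ s then 1 else 0) : (∑ i, X i) % 4 = (s.card : ℤ) % 4 := by
  rw [Finset.sum_int_mod]
  simp only [h]
  simp
omit H F in
theorem cd_half {s : SF} {x : L}
    (hx : ∀ i, b x (a i) % 4 = if i ∈ s then 2 else 0) :
    ∃ X : FT → ℤ, ∀ i, b x (a i) = 2 * X i ∧ X i % 2 = if i ∈ s then 1 else 0 := by
  refine ⟨fun i => b x (a i) / 2, fun i => ?_⟩
  have := hx i
  split_ifs at this ⊢ <;> constructor <;> dsimp only <;> omega
theorem cd_inter {s t : SF} (hs : Cd b a s) (ht : Cd b a t) :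
    (s ∩ t).card % 2 = 0 := by
  obtain ⟨x, hx⟩ := hs
  obtain ⟨y, hy⟩ := ht
  obtain ⟨X, hX⟩ := cd_half hx
  obtain ⟨Y, hY⟩ := cd_half hy
  have aa := H.sum8 F x y
  have ab : ∑ i, b x (a i) * b y (a i) = 4 * ∑ i, X i * Y i := by
    rw [Finset.mul_sum]
    exact scg fun i _ => by rw [(hX i).1, (hY i).1]; ring
  have ae := card_mod2 (fun i => X i * Y i) (s ∩ t) fun i => by
    rw [Int.mul_emod, (hX i).2, (hY i).2]; simp only [Finset.mem_inter]
    by_cases his : i ∈ s <;> by_cases hit : i ∈ t <;> simp [his, hit]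
  omega
theorem cd_card {s : SF} (hs : Cd b a s) : s.card % 4 = 0 := by
  obtain ⟨x, hx⟩ := hs
  obtain ⟨X, hX⟩ := cd_half hx
  have aa := H.sum8 F x x
  have ab : ∑ i, b x (a i) * b x (a i) = 4 * ∑ i, X i * X i := by
    rw [Finset.mul_sum]
    exact scg fun i _ => by rw [(hX i).1]; ring
  have ae := card_mod4 (fun i => X i * X i) s fun i => by
    have al := (hX i).2
    have ay : X i % 4 = 0 ∨ X i % 4 = 1 ∨ X i % 4 = 2 ∨ X i % 4 = 3 := by omega
    rw [Int.mul_emod]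
    by_cases his : i ∈ s <;> simp [his] at al ⊢ <;> rcases ay with h | h | h | h <;>
      rw [h] <;> first | rfl | omega
  have := H.even x
  omega
theorem near {s : SF} (hs : Cd b a s) (c : FT → ℤ)
    (hc : ∀ i, c i % 4 = if i ∈ s then 2 else 0) (p : FT) :
    ∃ x, ∃ e : ℤ, (e = 0 ∨ e = 1) ∧ ∀ i, b x (a i) = c i + if i = p then 4 * e else 0 := by
  obtain ⟨x, hx⟩ := hs
  have aa : ∀ i, ∃ m, c i = b x (a i) + 4 * m := fun i =>
    ⟨(c i - b x (a i)) / 4, by have := hx i; have := hc i; split_ifs at * <;> omega⟩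
  choose m hm using aa
  have key : ∀ e : ℤ, (∑ i, m i + e) % 2 = 0 →
      ∃ x, ∀ i, b x (a i) = c i + if i = p then 4 * e else 0 := by
    intro e he
    obtain ⟨y, hy⟩ := H.four F (fun i => m i + if i = p then e else 0) (by
      rw [Finset.sum_add_distrib]; simpa using he)
    refine ⟨x + y, fun i => ?_⟩
    rw [map_add, LinearMap.add_apply, hy i, hm i]
    split_ifs <;> ring
  rcases Int.emod_two_eq_zero_or_one (∑ i, m i) with h | h
  · obtain ⟨x, hx⟩ := key 0 (by simpa using h)
    exact ⟨x, 0, Or.inl rfl, hx⟩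
  · obtain ⟨x, hx⟩ := key 1 (by omega)
    exact ⟨x, 1, Or.inr rfl, hx⟩
theorem cd_dual {s : SF} (h : ∀ d, Cd b a d → (s ∩ d).card % 2 = 0) :
    Cd b a s := by
  obtain ⟨cc, hy0⟩ := H.odd_ex F
  have hev : ∀ (δ : FT → ℤ), (∀ i, δ i % 2 = if i ∈ s then 1 else 0) → ∀ y,
      b y (a 0) % 2 = 0 → (4:ℤ) ∣ ∑ i, δ i * b y (a i) := by
    intro δ hδ y hy
    have hp : ∀ i, b y (a i) % 2 = 0 := fun i => by have := par F y i 0; omega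
    set d : SF := Finset.univ.filter fun i => b y (a i) % 4 = 2 with hd
    have hyd : ∀ i, b y (a i) % 4 = if i ∈ d then 2 else 0 := fun i => by
      have := hp i
      simp only [hd, Finset.mem_filter, Finset.mem_univ, true_and]
      split_ifs <;> omega
    obtain ⟨Y, hY⟩ := cd_half hyd
    have ae := card_mod2 (fun i => δ i * Y i) (s ∩ d) fun i => by
      rw [Int.mul_emod, hδ i, (hY i).2]; simp only [Finset.mem_inter]
      by_cases his : i ∈ s <;> by_cases hit : i ∈ d <;> simp [his, hit]
    have al := h d ⟨y, hyd⟩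
    have ab : ∑ i, δ i * b y (a i) = 2 * ∑ i, δ i * Y i := by
      rw [Finset.mul_sum]
      exact scg fun i _ => by rw [(hY i).1]; ring
    rw [ab]; omega
  have key : ∀ (δ : FT → ℤ), (∀ i, δ i % 2 = if i ∈ s then 1 else 0) →
      (4:ℤ) ∣ ∑ i, δ i * b cc (a i) → Cd b a s := by
    intro δ hδ ag
    obtain ⟨x, hx⟩ := H.ci F (fun i => 2 * δ i) fun y => by
      have hall : (4:ℤ) ∣ ∑ i, δ i * b y (a i) := by
        rcases Int.emod_two_eq_zero_or_one (b y (a 0)) with hy | hy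
        · exact hev δ hδ y hy
        · have := dvd_add (hev δ hδ (y - cc) (by
            rw [map_sub, LinearMap.sub_apply]; omega)) ag
          rw [← Finset.sum_add_distrib] at this
          refine (congrArg (fun z => (4:ℤ) ∣ z) ?_).mpr this
          exact scg fun i _ => by rw [map_sub, LinearMap.sub_apply]; ring
      have : ∑ i, 2 * δ i * b y (a i) = 2 * ∑ i, δ i * b y (a i) := by
        rw [Finset.mul_sum]; exact scg fun i _ => by ring
      rw [this]; omega
    refine ⟨x, fun i => ?_⟩
    have := hδ i
    rw [hx]; split_ifs at * <;> omega
  have hs2 : (∑ i, (if i ∈ s then (1:ℤ) else 0) * b cc (a i)) % 2 = 0 := by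
    have ae := card_mod2 (fun i => (if i ∈ s then (1:ℤ) else 0) * b cc (a i)) s fun i => by
      have := par F cc i 0
      split_ifs <;> simp <;> omega
    have := h _ (H.cd_univ F)
    rw [Finset.inter_univ] at this
    omega
  by_cases al : (4:ℤ) ∣ ∑ i, (if i ∈ s then (1:ℤ) else 0) * b cc (a i)
  · exact key _ (fun i => by split_ifs <;> rfl) al
  · have hne : s.Nonempty := by
      by_contra hs
      rw [Finset.not_nonempty_iff_eq_empty] at hs
      simp [hs] at al
    obtain ⟨p, hp⟩ := hne
    refine key (fun i => (if i ∈ s then (1:ℤ) else 0) + if i = p then 2 else 0) (fun i => ?_) ?_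
    · split_ifs <;> rfl
    · simp only [add_mul, Finset.sum_add_distrib]
      have : ∑ i, (if i = p then (2:ℤ) else 0) * b cc (a i) = 2 * b cc (a p) := by
        simp [ite_mul]
      rw [this]
      have := par F cc p 0
      omega
theorem cd_ge8 {s : SF} (hs : Cd b a s) (hne : s.Nonempty) : 8 ≤ s.card := by
  have al := H.cd_card F hs
  have hpos := hne.card_pos
  by_contra hlt
  have al : s.card = 4 := by omega
  obtain ⟨p, hp⟩ := hne
  obtain ⟨x, e, he, hx⟩ := H.near F hs (fun i => if i ∈ s then -2 else 0)
    (fun i => by split_ifs <;> rfl) p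
  have ao := H.sum8 F x x
  have : ∑ i, b x (a i) * b x (a i) = ∑ i, if i ∈ s then 4 else 0 :=
    scg fun i _ => by
      rw [hx]
      by_cases hip : i = p
      · subst hip; simp only [hp, if_true]; rcases he with rfl | rfl <;> rfl
      · simp only [hip, if_false]; split_ifs <;> rfl
  rw [this] at ao
  simp [al] at ao
  have := H.no2 x
  omega
theorem mk_isom (e : FT → ℤ) (he : ∀ i, e i = 1 ∨ e i = -1)
    (h : ∀ y, ∃ y', ∀ i, b y' (a i) = e i * b y (a i)) :
    ∃ σ : EL L, Isom b σ ∧ (∀ y i, b (σ y) (a i) = e i * b y (a i)) ∧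
      ∀ i, σ (a i) = e i • a i := by
  choose f hf using h
  have hs : ∀ y i, b (f y) (a i) = e i * b y (a i) := hf
  refine ⟨{ toFun := f
            map_add' := fun y z => H.ext F fun i => by
              rw [map_add, LinearMap.add_apply, hf, hf, hf, map_add, LinearMap.add_apply]; ring
            map_smul' := fun m y => H.ext F fun i => by
              rw [RingHom.id_apply, map_smul, LinearMap.smul_apply, hf, hf, map_smul,
                LinearMap.smul_apply, smul_eq_mul, smul_eq_mul]; ring }, fun x y => ?_, hf, ?_⟩
  · have aa := H.sum8 F (f x) (f y)
    have ab := H.sum8 F x y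
    have : ∑ i, b (f x) (a i) * b (f y) (a i) = ∑ i, b x (a i) * b y (a i) :=
      scg fun i _ => by
        rw [hf, hf]; rcases he i with h | h <;> rw [h] <;> ring
    simp only [LinearMap.coe_mk, AddHom.coe_mk]
    omega
  · intro i
    refine H.ext F fun j => ?_
    simp only [LinearMap.coe_mk, AddHom.coe_mk]
    rw [hf, map_smul, LinearMap.smul_apply, smul_eq_mul, F.orth]
    split_ifs with h
    · rw [h]
    · ring
theorem sgn {s : SF} (hs : Cd b a s) :
    ∃ σ : EL L, Isom b σ ∧
      (∀ y i, b (σ y) (a i) = (if i ∈ s then -1 else 1) * b y (a i)) ∧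
      ∀ i, σ (a i) = (if i ∈ s then (-1:ℤ) else 1) • a i := by
  have bv := hs
  obtain ⟨x, hx⟩ := hs
  set I : FT → ℤ := fun i => if i ∈ s then 1 else 0 with hI
  have hev : ∀ y w, b y (a 0) % 2 = 0 → (4:ℤ) ∣ ∑ i, I i * (b y (a i) * b w (a i)) := by
    intro y w hy
    have hp : ∀ i, b y (a i) % 2 = 0 := fun i => by have := par F y i 0; omega
    set d : SF := Finset.univ.filter fun i => b y (a i) % 4 = 2 with hd
    have hyd : ∀ i, b y (a i) % 4 = if i ∈ d then 2 else 0 := fun i => by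
      have := hp i
      simp only [hd, Finset.mem_filter, Finset.mem_univ, true_and]
      split_ifs <;> omega
    obtain ⟨Y, hY⟩ := cd_half hyd
    have ab : ∑ i, I i * (b y (a i) * b w (a i)) = 2 * ∑ i, I i * (Y i * b w (a i)) := by
      rw [Finset.mul_sum]
      exact scg fun i _ => by rw [(hY i).1]; ring
    rw [ab]
    have ay : (∑ i, I i * (Y i * b w (a i))) % 2 = 0 := by
      rcases Int.emod_two_eq_zero_or_one (b w (a 0)) with hw | hw
      · have ae := card_mod2 (fun i => I i * (Y i * b w (a i))) ∅ fun i => by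
          have := par F w i 0
          rw [Int.mul_emod, Int.mul_emod (Y i), this, hw]; simp
        simpa using ae
      · have ae := card_mod2 (fun i => I i * (Y i * b w (a i))) (s ∩ d) fun i => by
          have := par F w i 0
          rw [Int.mul_emod, Int.mul_emod (Y i), this, hw, (hY i).2]; simp only [Finset.mem_inter, hI]
          by_cases his : i ∈ s <;> by_cases hit : i ∈ d <;> simp [his, hit]
        have := H.cd_inter F bv ⟨y, hyd⟩
        omega
    omega
  have hall : ∀ y w, (4:ℤ) ∣ ∑ i, I i * (b y (a i) * b w (a i)) := by
    intro y w
    rcases Int.emod_two_eq_zero_or_one (b y (a 0)) with hy | hy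
    · exact hev y w hy
    rcases Int.emod_two_eq_zero_or_one (b w (a 0)) with hw | hw
    · have := hev w y hw
      refine (congrArg (fun z => (4:ℤ) ∣ z) ?_).mpr this
      exact scg fun i _ => by ring
    · have aa := hev (w - y) y (by rw [map_sub, LinearMap.sub_apply]; omega)
      have ab : (4:ℤ) ∣ ∑ i, I i * (b y (a i) * b y (a i)) := by
        have ae := card_mod4 (fun i => I i * (b y (a i) * b y (a i))) s fun i => by
          have := par F y i 0
          have al : b y (a i) % 4 = 1 ∨ b y (a i) % 4 = 3 := by omega
          rw [Int.mul_emod, Int.mul_emod (b y (a i)), hI]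
          rcases al with h | h <;> rw [h] <;> by_cases his : i ∈ s <;> simp [his]
        have := H.cd_card F bv
        omega
      have := dvd_add aa ab
      rw [← Finset.sum_add_distrib] at this
      refine (congrArg (fun z => (4:ℤ) ∣ z) ?_).mpr this
      exact scg fun i _ => by rw [map_sub, LinearMap.sub_apply]; ring
  refine H.mk_isom F (fun i => if i ∈ s then -1 else 1) (fun i => ?_) fun y => ?_
  · split_ifs <;> simp
  · refine H.ci F _ fun w => ?_
    have aa := hall y w
    have ab := H.sum8 F y w
    have : ∑ i, (if i ∈ s then (-1:ℤ) else 1) * b y (a i) * b w (a i) =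
        ∑ i, b y (a i) * b w (a i) - 2 * ∑ i, I i * (b y (a i) * b w (a i)) := by
      rw [Finset.mul_sum, ← Finset.sum_sub_distrib]
      refine scg fun i _ => ?_
      simp only [hI]; split_ifs <;> ring
    rw [this]; omega
theorem odd_orbit {x y : L} (hx : b x (a 0) % 2 = 1)
    (h : ∀ i, b x (a i) = b y (a i) ∨ b x (a i) = - b y (a i)) :
    ∃ σ : EL L, Isom b σ ∧ σ x = y ∧ ∀ i, b x (a i) = b y (a i) → σ (a i) = a i := by
  set s : SF := Finset.univ.filter fun i => b x (a i) ≠ b y (a i) with hs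
  have hc : Cd b a s := ⟨x - y, fun i => by
    have aa := h i
    have := par F x i 0
    rw [map_sub, LinearMap.sub_apply]
    simp only [hs, Finset.mem_filter, Finset.mem_univ, true_and]
    split_ifs <;> omega⟩
  obtain ⟨σ, aa, ab, ae⟩ := H.sgn F hc
  refine ⟨σ, aa, H.ext F fun i => ?_, fun i hi => ?_⟩
  · rw [ab]
    have := h i
    simp only [hs, Finset.mem_filter, Finset.mem_univ, true_and]
    split_ifs <;> omega
  · rw [ae]; simp [hs, hi]
end LL
end latt2
section latt3
variable {L : Type} [AddCommGroup L] {b : BL L}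
theorem sd_card {α : Type} [DecidableEq α] (s t : Finset α) :
    (symmDiff s t).card + 2 * (s ∩ t).card = s.card + t.card := by
  have aa : symmDiff s t = (s \ t) ∪ (t \ s) := rfl
  have ab : Disjoint (s \ t) (t \ s) := by
    rw [Finset.disjoint_left]; intro x hx hy
    simp only [Finset.mem_sdiff] at hx hy; exact hy.2 hx.1
  have ae := Finset.card_sdiff_add_card_inter s t
  have al := Finset.card_sdiff_add_card_inter t s
  rw [Finset.inter_comm t s] at al
  rw [aa, Finset.card_union_of_disjoint ab]; omega
def vsup (v : FT → ZMod 2) : SF := Finset.univ.filter fun i => v i ≠ 0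
def vind (s : SF) : FT → ZMod 2 := fun i => if i ∈ s then 1 else 0
theorem vsup_vind (s) : vsup (vind s) = s := by ext i; simp [vsup, vind]
theorem zm2 (x : ZMod 2) : x = 0 ∨ x = 1 := by revert x; decide
theorem vind_vsup (v) : vind (vsup v) = v := by
  funext i; rcases zm2 (v i) with h | h <;> simp [vsup, vind, h]
theorem vsup_add (u v) : vsup (u + v) = symmDiff (vsup u) (vsup v) := by
  ext i
  simp only [vsup, Finset.mem_symmDiff, Finset.mem_filter, Finset.mem_univ, true_and, Pi.add_apply]
  rcases zm2 (u i) with h | h <;> rcases zm2 (v i) with ai | ai <;> rw [h, ai] <;> decide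
theorem vdot (u v : FT → ZMod 2) : u ⬝ᵥ v = (((vsup u ∩ vsup v).card : ℕ) : ZMod 2) := by
  rw [Finset.card_eq_sum_ones, Nat.cast_sum, dotProduct, ← Finset.sum_subset (Finset.subset_univ (vsup u ∩ vsup v))]
  · refine scg fun i hi => ?_
    simp only [vsup, Finset.mem_inter, Finset.mem_filter, Finset.mem_univ, true_and] at hi
    rcases zm2 (u i) with h | h <;> rcases zm2 (v i) with ai | ai <;> simp [h, ai] at hi ⊢
  · intro i _ hi
    simp only [vsup, Finset.mem_inter, Finset.mem_filter, Finset.mem_univ, true_and] at hi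
    rcases zm2 (u i) with h | h <;> rcases zm2 (v i) with ai | ai <;> simp [h, ai] at hi ⊢
abbrev dotB : LinearMap.BilinForm (ZMod 2) (FT → ZMod 2) := dotProductBilin (ZMod 2) (ZMod 2)
theorem dotB_nd : dotB.Nondegenerate := by
  constructor
  · intro x hx
    funext i
    have := hx (Pi.single i 1)
    simpa [dotB] using this
  · intro x hx
    funext i
    have := hx (Pi.single i 1)
    simpa [dotB] using this
theorem dotB_refl : dotB.IsRefl := by
  intro x y h
  simp only [dotProductBilin_apply_apply] at h ⊢
  rw [dotProduct_comm]; exact h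
def cdW (b : BL L) (a : FT → L) : Submodule (ZMod 2) (FT → ZMod 2) where
  carrier := {v | Cd b a (vsup v)}
  zero_mem' := ⟨0, fun i => by simp [vsup]⟩
  add_mem' := fun {u v} hu hv => by
    change Cd b a _
    rw [vsup_add]; exact LL.cd_symm hu hv
  smul_mem' := fun c v hv => by
    rcases zm2 c with rfl | rfl
    · exact ⟨0, fun i => by simp [vsup]⟩
    · simpa using hv
theorem odd_count (α : Type) [Fintype α] [DecidableEq α] [Nonempty α] :
    2 * (Finset.univ.filter fun s : Finset α => s.card % 2 = 1).card = 2 ^ Fintype.card α := by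
  have aa := Finset.sum_powerset_neg_one_pow_card (x := (Finset.univ : Finset α))
  rw [if_neg Finset.univ_nonempty.ne_empty] at aa
  have ab : ∀ s : Finset α, (-1:ℤ) ^ s.card = 1 - 2 * if s.card % 2 = 1 then 1 else 0 := by
    intro s
    rcases Nat.even_or_odd s.card with h | h
    · rw [h.neg_one_pow, if_neg]; · rfl
      have := Nat.even_iff.1 h; omega
    · rw [h.neg_one_pow, if_pos (Nat.odd_iff.1 h)]; rfl
  rw [scg fun s _ => ab s, Finset.sum_sub_distrib, ← Finset.mul_sum,
    Finset.powerset_univ, ← Finset.sum_filter, Finset.sum_const, Finset.sum_const,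
    Finset.card_univ, Fintype.card_finset] at aa
  simp only [nsmul_eq_mul, mul_one] at aa
  apply Nat.cast_injective (R := ℤ)
  rw [Nat.cast_mul, Nat.cast_two]
  linarith
namespace LL
variable (H : LL b) {a : FT → L} (F : Fr b a)
include H F
theorem cdW_orth : dotB.orthogonal (cdW b a) = cdW b a := by
  ext v
  rw [LinearMap.BilinForm.mem_orthogonal_iff]
  constructor
  · intro h
    refine H.cd_dual F fun d hd => ?_
    have := h (vind d) (by change Cd b a _; rwa [vsup_vind])
    simp only [dotProductBilin_apply_apply] at this
    rw [vdot, vsup_vind, Finset.inter_comm] at this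
    have := (ZMod.natCast_eq_zero_iff _ 2).1 this
    omega
  · intro h w hw
    simp only [dotProductBilin_apply_apply]
    rw [vdot, ZMod.natCast_eq_zero_iff]
    have := H.cd_inter F hw h
    omega
theorem duality {S χ : SF} (hχ : χ ⊆ S)
    (h : ∀ d, Cd b a d → d ⊆ S → (d ∩ χ).card % 2 = 0) : ∃ c, Cd b a c ∧ c ∩ S = χ := by
  let Off : Submodule (ZMod 2) (FT → ZMod 2) :=
    { carrier := {v | ∀ i ∈ S, v i = 0}
      zero_mem' := fun i _ => rfl
      add_mem' := fun {u v} hu hv i hi => by simp [hu i hi, hv i hi]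
      smul_mem' := fun c v hv i hi => by simp [hv i hi] }
  have hm : vind χ ∈ cdW b a ⊔ Off := by
    rw [← LinearMap.BilinForm.orthogonal_orthogonal dotB_nd dotB_refl (cdW b a ⊔ Off),
      LinearMap.BilinForm.mem_orthogonal_iff]
    intro d hd
    rw [LinearMap.BilinForm.mem_orthogonal_iff] at hd
    have hd1 : d ∈ cdW b a := by
      rw [← H.cdW_orth F, LinearMap.BilinForm.mem_orthogonal_iff]
      exact fun n hn => hd n (Submodule.mem_sup_left hn)
    have hd2 : vsup d ⊆ S := by
      intro i hi
      by_contra hiS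
      have := hd (Pi.single i 1) (Submodule.mem_sup_right fun j hj => by
        rw [Pi.single_apply, if_neg]; rintro rfl; exact hiS hj)
      simp only [dotProductBilin_apply_apply] at this
      simp [vsup] at hi this
      exact hi this
    simp only [dotProductBilin_apply_apply]
    rw [vdot, vsup_vind, ZMod.natCast_eq_zero_iff]
    have := h _ hd1 hd2
    omega
  obtain ⟨w, hw, o, ho, hs⟩ := Submodule.mem_sup.1 hm
  refine ⟨vsup w, hw, ?_⟩
  ext i
  rw [Finset.mem_inter]
  have aa := congrFun hs i
  simp only [Pi.add_apply, vind] at aa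
  constructor
  · rintro ⟨ab, ae⟩
    rw [ho i ae, add_zero] at aa
    by_contra al
    simp [al] at aa
    simp [vsup, aa] at ab
  · intro ab
    refine ⟨?_, hχ ab⟩
    rw [ho i (hχ ab), add_zero, if_pos ab] at aa
    simp [vsup, aa]
theorem cd_count : Nat.card {s // Cd b a s} = 2 ^ 12 := by
  have aa : Nat.card {s // Cd b a s} = Nat.card (cdW b a) := by
    refine Nat.card_congr ⟨fun s => ⟨vind s.1, by change Cd b a _; rw [vsup_vind]; exact s.2⟩,
      fun v => ⟨vsup v.1, v.2⟩, fun s => ?_, fun v => ?_⟩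
    · simp [vsup_vind]
    · simp [vind_vsup]
  have ab := LinearMap.BilinForm.finrank_orthogonal dotB_nd (cdW b a)
  rw [H.cdW_orth F] at ab
  simp only [Module.finrank_fintype_fun_eq_card, Fintype.card_fin] at ab
  have ae := Submodule.finrank_le (cdW b a)
  simp only [Module.finrank_fintype_fun_eq_card, Fintype.card_fin] at ae
  rw [aa, Module.natCard_eq_pow_finrank (K := ZMod 2), Nat.card_eq_fintype_card, ZMod.card,
    show Module.finrank (ZMod 2) (cdW b a) = 12 by omega]
theorem octad {Q : SF} (hQ : Q.card = 5) : ∃ O, Cd b a O ∧ O.card = 8 ∧ Q ⊆ O := by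
  classical
  set CF : Finset (SF) := Finset.univ.filter fun s => Cd b a s with hCF
  have hc : CF.card = 2 ^ 12 := by
    rw [← H.cd_count F]; exact (Nat.subtype_card CF (by simp [hCF])).symm
  set T : Finset (SF) := Finset.powersetCard 1 Finset.univ ∪
    Finset.powersetCard 3 Finset.univ with hT
  have hTm : ∀ t ∈ T, t.card = 1 ∨ t.card = 3 := by
    intro t ht; simpa [hT, Finset.mem_powersetCard] using ht
  have hTc : T.card = 2 ^ 11 := by
    rw [hT, Finset.card_union_of_disjoint, Finset.card_powersetCard, Finset.card_powersetCard]
    · rw [Finset.card_univ, Fintype.card_fin]; rfl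
    · rw [Finset.disjoint_left]; intro t aa ab
      simp [Finset.mem_powersetCard] at aa ab; omega
  have hinj : Set.InjOn (fun p : SF × SF => symmDiff p.1 p.2)
      (CF ×ˢ T : Finset _) := by
    rintro ⟨c, t⟩ h ⟨c', ch⟩ ai heq
    simp only [Finset.coe_product, Set.mem_prod, Finset.mem_coe] at h ai heq
    have ah : symmDiff c c' = symmDiff t ch := by
      have : symmDiff (symmDiff c t) (symmDiff c' ch) = ⊥ := by rw [heq, symmDiff_self]
      rw [symmDiff_symmDiff_symmDiff_comm] at this
      exact symmDiff_eq_bot.1 this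
    have aa := sd_card t ch
    have ab := hTm t h.2
    have ae := hTm ch ai.2
    have aj : symmDiff c c' = ⊥ := by
      by_contra hne
      have := H.cd_ge8 F (cd_symm (by simpa [hCF] using h.1) (by simpa [hCF] using ai.1))
        (Finset.nonempty_iff_ne_empty.2 hne)
      rw [ah] at this
      omega
    have bc := symmDiff_eq_bot.1 aj
    rw [aj] at ah
    have br := symmDiff_eq_bot.1 ah.symm
    rw [bc, br]
  have himg : (CF ×ˢ T).image (fun p => symmDiff p.1 p.2) =
      Finset.univ.filter fun s : SF => s.card % 2 = 1 := by
    apply Finset.eq_of_subset_of_card_le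
    · intro s hs
      obtain ⟨⟨c, t⟩, hp, rfl⟩ := Finset.mem_image.1 hs
      rw [Finset.mem_product] at hp
      simp only [Finset.mem_filter, Finset.mem_univ, true_and]
      have aa := sd_card c t
      have ab := hTm t hp.2
      have ae : Cd b a c := by simpa [hCF] using hp.1
      have al := H.cd_card F ae
      omega
    · rw [Finset.card_image_of_injOn hinj, Finset.card_product, hc, hTc]
      have := odd_count FT
      rw [Fintype.card_fin] at this
      omega
  have hQm : Q ∈ Finset.univ.filter fun s : SF => s.card % 2 = 1 := by
    simp [hQ]
  rw [← himg] at hQm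
  obtain ⟨⟨c, t⟩, hp, hpq⟩ := Finset.mem_image.1 hQm
  rw [Finset.mem_product] at hp
  have ae : Cd b a c := by simpa [hCF] using hp.1
  have ab := hTm t hp.2
  have hcq : c = symmDiff Q t := by rw [← hpq]; simp
  have al := sd_card Q t
  rw [← hcq] at al
  have hne : c.Nonempty := by
    rw [Finset.nonempty_iff_ne_empty]; rintro rfl
    have : Q = t := by rw [← hpq]; exact bot_symmDiff t
    rw [this] at hQ; omega
  have ao := H.cd_ge8 F ae hne
  refine ⟨c, ae, by omega, fun i hi => ?_⟩
  have ag : (Q ∩ t).card = 0 := by omega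
  rw [hcq, Finset.mem_symmDiff]
  refine Or.inl ⟨hi, fun hit => ?_⟩
  rw [Finset.card_eq_zero] at ag
  have : i ∈ Q ∩ t := Finset.mem_inter.2 ⟨hi, hit⟩
  rw [ag] at this; simp at this
theorem octad_unique {O O' : SF} (h : Cd b a O) (ai : Cd b a O') (hc : O.card = 8)
    (hc' : O'.card = 8) (ay : 5 ≤ (O ∩ O').card) : O = O' := by
  by_contra hne
  have aa := sd_card O O'
  have := H.cd_ge8 F (cd_symm h ai) (Finset.nonempty_iff_ne_empty.2 fun e =>
    hne (symmDiff_eq_bot.1 e))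
  omega
end LL
end latt3
section latt4
variable {L : Type} [AddCommGroup L] {b : BL L}
namespace LL
variable (H : LL b) {a : FT → L} (F : Fr b a)
include H F
theorem mem_frame {z : L} (hz : b z z = 8) (hc : ∃ i w, z = a i + (2:ℤ) • w) :
    ∃ k, z = a k ∨ z = - a k := by
  obtain ⟨i, w, hw⟩ := hc
  have aa : ∀ k, b z (a k) = 0 ∨ b z (a k) = 8 ∨ b z (a k) = -8 := by
    intro k
    obtain ⟨v, hv⟩ := F.cong i k
    have ah : z - a k = (2:ℤ) • (w + v) := by rw [hw, hv]; module
    have aj : z + a k = (2:ℤ) • (w + v + a k) := by rw [hw, hv]; module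
    have n1 := H.sub2 z (a k)
    have n2 := H.add2 z (a k)
    rw [ah, smul2, hz, F.self] at n1
    rw [aj, smul2, hz, F.self] at n2
    by_cases bn : w + v = 0
    · rw [bn] at n1; simp at n1; omega
    by_cases co : w + v + a k = 0
    · rw [co] at n2; simp at n2; omega
    have := H.ge4 bn; have := H.ge4 co
    omega
  by_contra hne
  push Not at hne
  have ab : ∀ k, b z (a k) = 0 := by
    intro k
    rcases aa k with h | h | h
    · exact h
    · refine absurd (H.eq_of ?_) (hne k).1
      rw [H.sub2, hz, F.self, h]; norm_num
    · refine absurd (eq_neg_of_add_eq_zero_left (H.eq_zero ?_)) (hne k).2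
      rw [H.add2, hz, F.self, h]; norm_num
  have := H.sum8 F z z
  rw [hz, Finset.sum_eq_zero fun i _ => by rw [ab, zero_mul]] at this
  omega
theorem sc {y : L} (hy : b y (a 0) % 2 = 0) : ∃ σ : EL L, Isom b σ ∧
    ∀ z, b z z = 8 → (∃ w, z = a 0 + (2:ℤ) • w) →
      (b y z % 4 = 0 → σ z = z) ∧ (b y z % 4 = 2 → σ z = - z) := by
  set s : SF := Finset.univ.filter fun i => b y (a i) % 4 = 2 with hs
  have hc : Cd b a s := ⟨y, fun i => by
    have := par F y i 0
    simp only [hs, Finset.mem_filter, Finset.mem_univ, true_and]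
    split_ifs <;> omega⟩
  obtain ⟨σ, aa, -, ae⟩ := H.sgn F hc
  refine ⟨σ, aa, fun z hz hw => ?_⟩
  obtain ⟨k, hk⟩ := H.mem_frame F hz ⟨0, hw⟩
  have al := ae k
  simp only [hs, Finset.mem_filter, Finset.mem_univ, true_and] at al
  rcases hk with rfl | rfl
  · constructor <;> intro h
    · rw [if_neg (by omega)] at al; rw [al, one_smul]
    · rw [if_pos h] at al; rw [al, neg_one_zsmul]
  · rw [map_neg]
    constructor <;> intro h
    · rw [if_neg (by omega)] at al; rw [map_neg, al, one_smul]
    · rw [if_pos (by omega)] at al; rw [map_neg, al, neg_one_zsmul]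
theorem fixT {b1 y : L} {σ : EL L} {T bi : SF}
    (hb1 : ∀ i, b b1 (a i) = if i ∈ T then 4 else 0) (hy : ∀ i ∈ bi, b y (a i) = 0)
    (hσ : ∀ z, b z z = 8 → (∃ w, z = b1 + (2:ℤ) • w) → b y z = 0 → σ z = z)
    (hcd : Cd b a (T ∪ bi)) (hdis : Disjoint T bi) (hcard : bi.card = 4) :
    ∀ q ∈ bi, σ (a q) = a q := by
  intro q hq
  obtain ⟨s, hs, t, ht, hst⟩ : ∃ s ∈ bi.erase q, ∃ t ∈ bi.erase q, s ≠ t :=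
    Finset.one_lt_card.1 (by rw [Finset.card_erase_of_mem hq]; omega)
  rw [Finset.mem_erase] at hs ht
  have hd : ∀ i ∈ bi, i ∉ T := fun i aa ab => Finset.disjoint_left.1 hdis ab aa
  obtain ⟨x, e, he, hx⟩ := H.near F hcd
    (fun i => if i ∈ T then 2 else if i ∈ bi then -2 else 0)
    (fun i => by
      simp only [Finset.mem_union]
      by_cases aa : i ∈ T <;> by_cases ab : i ∈ bi <;> simp [aa, ab]) q
  set d : L := (2:ℤ) • x - b1 with hdd
  have hdc : ∀ i, b d (a i) = if i ∈ bi then (if i = q then -4 + 8 * e else -4) else 0 := by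
    intro i
    rw [hdd, map_sub, LinearMap.sub_apply, map_smul, LinearMap.smul_apply, smul_eq_mul, hx, hb1]
    by_cases ab : i ∈ bi
    · have aa := hd i ab
      simp only [aa, ab, if_true, if_false]
      split_ifs <;> ring
    · have : i ≠ q := by rintro rfl; exact ab hq
      by_cases aa : i ∈ T <;> simp [aa, ab, this]
  have hdn : b d d = 8 := by
    have ao := H.sum8 F d d
    have : ∑ i, b d (a i) * b d (a i) = ∑ i, if i ∈ bi then 16 else 0 :=
      scg fun i _ => by
        rw [hdc]; rcases he with rfl | rfl <;> split_ifs <;> rfl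
    rw [this] at ao
    simp [hcard] at ao
    omega
  have hyd : b y d = 0 := by
    have ao := H.sum8 F y d
    rw [Finset.sum_eq_zero fun i _ => by
      by_cases h : i ∈ bi
      · rw [hy i h, zero_mul]
      · rw [hdc, if_neg h, mul_zero]] at ao
    omega
  have hdb : d = b1 + (2:ℤ) • (x - b1) := by rw [hdd]; module
  have hfd := hσ d hdn ⟨_, hdb⟩ hyd
  have pair : ∀ u v w : L, b u u = 8 → b v v = 8 → b u v = 0 → b d u = 4 → b d v = 4 →
      b y u = 0 → b y v = 0 → u + v = (2:ℤ) • w → σ (u + v) = u + v := by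
    intro u v w aa ab ae al ay bt h7 ao
    have := hσ (d - (u + v)) (by
      rw [H.sub2, H.add2, map_add, hdn, aa, ab, ae, al, ay]; norm_num)
      ⟨x - b1 - w, by rw [ao, hdb]; module⟩ (by rw [map_sub, map_add, hyd, bt, h7]; norm_num)
    rw [map_sub, hfd] at this
    exact sub_right_injective this
  set ε : ℤ := -1 + 2 * e with hε
  have hε2 : ε = 1 ∨ ε = -1 := by rcases he with rfl | rfl <;> simp [hε]
  have hεε : ε * ε = 1 := by rcases hε2 with h | h <;> rw [h] <;> rfl
  have P : ∀ s, s ≠ q ∧ s ∈ bi → σ (ε • a q + -a s) = ε • a q + -a s := by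
    intro s hs
    obtain ⟨h, hh, -, -⟩ := H.half F q s (-ε) (by omega) hs.1.symm
    refine pair _ _ (ε • h) ?_ ?_ ?_ ?_ ?_ ?_ ?_ ?_
    · rw [smul2, F.self]; rcases hε2 with h | h <;> rw [h] <;> rfl
    · rw [neg2, F.self]
    · rw [map_neg, map_smul, LinearMap.smul_apply, F.ne hs.1.symm]; simp
    · rw [map_smul, smul_eq_mul, hdc, if_pos hq, if_pos rfl]
      have : -4 + 8 * e = 4 * ε := by rw [hε]; ring
      rw [this]; linear_combination 4 * hεε
    · rw [map_neg, hdc, if_pos hs.2, if_neg hs.1]; norm_num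
    · rw [map_smul, hy q hq, smul_zero]
    · rw [map_neg, hy s hs.2, neg_zero]
    · rw [smul_comm, hh, smul_add, smul_smul, mul_neg, hεε]; module
  have aa := P s hs
  have ab := P t ht
  have ae : σ (-a s + -a t) = -a s + -a t := by
    obtain ⟨h, hh, -, -⟩ := H.half F s t 1 (Or.inl rfl) hst
    refine pair _ _ (-h) ?_ ?_ ?_ ?_ ?_ ?_ ?_ ?_
    · rw [neg2, F.self]
    · rw [neg2, F.self]
    · rw [map_neg, map_neg, LinearMap.neg_apply, F.ne hst]; simp
    · rw [map_neg, hdc, if_pos hs.2, if_neg hs.1]; norm_num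
    · rw [map_neg, hdc, if_pos ht.2, if_neg ht.1]; norm_num
    · rw [map_neg, hy s hs.2, neg_zero]
    · rw [map_neg, hy t ht.2, neg_zero]
    · rw [smul_neg, hh]; module
  have al : σ ((2 * ε) • a q) = (2 * ε) • a q := by
    have ah : (2 * ε) • a q = (ε • a q + -a s) + (ε • a q + -a t) - (-a s + -a t) := by module
    rw [ah, map_sub, map_add, aa, ab, ae]
  rw [map_smul] at al
  exact H.smul_inj (by omega) al
theorem step {O : SF} (hO : Cd b a O) (bo : O.card = 8) {r aq : FT}
    (hr : r ∉ O) (bp : aq ∉ O) (hne : r ≠ aq) :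
    ∃ σ : EL L, Isom b σ ∧ (∀ o ∈ O, σ (a o) = a o) ∧
      (σ (a r) = a aq ∨ σ (a r) = - a aq) := by
  classical
  obtain ⟨U, hUO, hU3⟩ := Finset.exists_subset_card_eq (show 3 ≤ O.card by omega)
  have hU5 : (insert r (insert aq U)).card = 5 := by
    rw [Finset.card_insert_of_notMem, Finset.card_insert_of_notMem, hU3]
    · exact fun h => bp (hUO h)
    · rw [Finset.mem_insert]; rintro (h | h)
      · exact hne h
      · exact hr (hUO h)
  obtain ⟨bj, cp, hO18, hsub⟩ := H.octad F hU5
  have hrO1 : r ∈ bj := hsub (by simp)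
  have hrO1' : aq ∈ bj := hsub (by simp)
  have hUO1 : U ⊆ bj := fun i hi => hsub (by simp [hi])
  have h34 : (bj ∩ O).card = 4 := by
    have aa := H.cd_inter F cp hO
    have ab : 3 ≤ (bj ∩ O).card := by
      rw [← hU3]; exact Finset.card_le_card (Finset.subset_inter hUO1 hUO)
    by_contra al
    have := H.octad_unique F cp hO hO18 bo (by omega)
    rw [this] at hrO1; exact hr hrO1
  set T := bj \ O with hT
  have hT4 : T.card = 4 := by
    have := Finset.card_sdiff_add_card_inter bj O
    rw [hT]; omega
  have hT2c : (O \ bj).card = 4 := by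
    have := Finset.card_sdiff_add_card_inter O bj
    rw [Finset.inter_comm] at this; omega
  have hrT : r ∈ T := by simp [hT, hrO1, hr]
  have hrT' : aq ∈ T := by simp [hT, hrO1', bp]
  obtain ⟨i, j, hij, hTij⟩ : ∃ i j, i ≠ j ∧ (T.erase r).erase aq = {i, j} := by
    rw [← Finset.card_eq_two, Finset.card_erase_of_mem (by simp [hrT', hne.symm]),
      Finset.card_erase_of_mem hrT]; omega
  have memT : ∀ k, k ∈ T ↔ k = r ∨ k = aq ∨ k = i ∨ k = j := by
    intro k
    have h : k ∈ (T.erase r).erase aq ↔ k = i ∨ k = j := by rw [hTij]; simp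
    simp only [Finset.mem_erase] at h
    constructor
    · intro hk
      by_cases aa : k = r
      · exact Or.inl aa
      by_cases ab : k = aq
      · exact Or.inr (Or.inl ab)
      exact Or.inr (Or.inr (h.1 ⟨ab, aa, hk⟩))
    · rintro (aa | aa | aa)
      · rwa [aa]
      · rwa [aa]
      · exact (h.2 aa).2.2
  have hiT : i ∈ T ∧ i ≠ r ∧ i ≠ aq := by
    have : i ∈ (T.erase r).erase aq := by rw [hTij]; simp
    simp only [Finset.mem_erase] at this; tauto
  have hjT : j ∈ T ∧ j ≠ r ∧ j ≠ aq := by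
    have : j ∈ (T.erase r).erase aq := by rw [hTij]; simp
    simp only [Finset.mem_erase] at this; tauto
  obtain ⟨c, hc, hcS⟩ := H.duality F (S := O ∪ T) (χ := {r, aq}) (by
      intro k hk; simp only [Finset.mem_insert, Finset.mem_singleton] at hk
      rcases hk with rfl | rfl
      · exact Finset.mem_union_right _ hrT
      · exact Finset.mem_union_right _ hrT') (by
    intro d hd hdS
    by_contra hodd
    have aa := H.cd_inter F hd hO
    have ab := H.cd_card F hd
    have ae : d.card = (d ∩ O).card + (d ∩ T).card := by
      rw [← Finset.card_union_of_disjoint, ← Finset.inter_union_distrib_left,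
        Finset.inter_eq_left.2 hdS]
      rw [Finset.disjoint_left]; intro k aa ab
      simp only [Finset.mem_inter, hT, Finset.mem_sdiff] at aa ab
      exact ab.2.2 aa.2
    have al : (d ∩ T).card < 4 := by
      rw [← hT4]; apply Finset.card_lt_card
      refine ⟨Finset.inter_subset_right, fun hTd => hodd ?_⟩
      rw [Finset.inter_eq_right.2, Finset.card_pair hne]
      intro k hk; simp only [Finset.mem_insert, Finset.mem_singleton] at hk
      rcases hk with rfl | rfl
      · exact (Finset.mem_inter.1 (hTd hrT)).1
      · exact (Finset.mem_inter.1 (hTd hrT')).1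
    have ay : 0 < (d ∩ {r, aq}).card := by omega
    have bt : (d ∩ {r, aq}).card ≤ (d ∩ T).card := Finset.card_le_card (by
      intro k hk
      simp only [Finset.mem_inter, Finset.mem_insert, Finset.mem_singleton] at hk ⊢
      rcases hk with ⟨h, rfl | rfl⟩
      · exact ⟨h, hrT⟩
      · exact ⟨h, hrT'⟩)
    have h7 := H.cd_ge8 F hd (Finset.card_pos.1 (by omega))
    have ao : (d ∩ O).card ≤ 8 := by rw [← bo]; exact Finset.card_le_card Finset.inter_subset_right
    have := H.octad_unique F hd hO (by omega) bo (by omega)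
    rw [this] at ay
    obtain ⟨k, hk⟩ := Finset.card_pos.1 ay
    simp only [Finset.mem_inter, Finset.mem_insert, Finset.mem_singleton] at hk
    rcases hk with ⟨h, rfl | rfl⟩
    · exact hr h
    · exact bp h)
  have memc : ∀ k ∈ O ∪ T, (k ∈ c ↔ k = r ∨ k = aq) := by
    intro k hk
    have : k ∈ c ∩ (O ∪ T) ↔ k ∈ ({r, aq} : SF) := by rw [hcS]
    simpa [hk] using this
  obtain ⟨y, e, he, hy⟩ := H.near F hc (fun i => if i ∈ c then -2 else 0)
    (fun i => by split_ifs <;> rfl) r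
  have hrc : r ∈ c := (memc r (Finset.mem_union_right _ hrT)).2 (Or.inl rfl)
  have hrc' : aq ∈ c := (memc aq (Finset.mem_union_right _ hrT')).2 (Or.inr rfl)
  have hic : i ∉ c := fun h => by
    have := (memc i (Finset.mem_union_right _ hiT.1)).1 h; tauto
  have hjc : j ∉ c := fun h => by
    have := (memc j (Finset.mem_union_right _ hjT.1)).1 h; tauto
  have hyr : b y (a r) = -2 + 4 * e := by rw [hy]; simp [hrc]
  have hyr' : b y (a aq) = -2 := by rw [hy]; simp [hrc', hne.symm]
  have hyi : b y (a i) = 0 := by rw [hy]; simp [hic, hiT.2.1]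
  have hyj : b y (a j) = 0 := by rw [hy]; simp [hjc, hjT.2.1]
  have hyO : ∀ o ∈ O, b y (a o) = 0 := by
    intro o ho
    have aa : o ∉ c := fun h => by
      rcases (memc o (Finset.mem_union_left _ ho)).1 h with rfl | rfl
      · exact hr ho
      · exact bp ho
    have ab : o ≠ r := by rintro rfl; exact hr ho
    rw [hy]; simp [aa, ab]
  obtain ⟨aw, hp1, hp1n, hp1y⟩ := H.half F r aq 1 (Or.inl rfl) hne
  obtain ⟨ba, hp2, hp2n, hp2y⟩ := H.half F i j 1 (Or.inl rfl) hij
  obtain ⟨bd, hp3, hp3n, hp3y⟩ := H.half F r aq (-1) (Or.inr rfl) hne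
  obtain ⟨bg, hp4, hp4n, hp4y⟩ := H.half F i j (-1) (Or.inr rfl) hij
  obtain ⟨m, hm⟩ := F.cong aq j
  have e13 : aw = bd + a aq := H.smul_inj two_ne_zero (by rw [smul_add, hp1, hp3]; module)
  have e24 : ba = bg + a j := H.smul_inj two_ne_zero (by rw [smul_add, hp2, hp4]; module)
  have orth12 : ∀ {u v : L} {ah aj : ℤ}, (2:ℤ) • u = a r + ah • a aq → (2:ℤ) • v = a i + aj • a j →
      b u v = 0 := by
    intro u v ah aj hu hv
    have : b ((2:ℤ) • u) ((2:ℤ) • v) = 0 := by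
      rw [hu, hv]
      simp only [map_add, map_smul, LinearMap.add_apply, LinearMap.smul_apply,
        F.ne hiT.2.1.symm, F.ne hiT.2.2.symm, F.ne hjT.2.1.symm, F.ne hjT.2.2.symm]
      simp
    simp only [map_smul, LinearMap.smul_apply, smul_eq_mul] at this
    omega
  have hn1 : b (aw + ba) (aw + ba) = 8 := by
    rw [H.add2, orth12 hp1 hp2, hp1n, hp2n]; norm_num
  have hn2 : b (aw - ba) (aw - ba) = 8 := by
    rw [H.sub2, orth12 hp1 hp2, hp1n, hp2n]; norm_num
  have hn3 : b (bd + bg) (bd + bg) = 8 := by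
    rw [H.add2, orth12 hp3 hp4, hp3n, hp4n]; norm_num
  have hn4 : b (bd - bg) (bd - bg) = 8 := by
    rw [H.sub2, orth12 hp3 hp4, hp3n, hp4n]; norm_num
  have hb1 : ∀ k, b (aw + ba) (a k) = if k ∈ T then 4 else 0 := by
    intro k
    have : (2:ℤ) * b (aw + ba) (a k) = b ((2:ℤ) • aw + (2:ℤ) • ba) (a k) := by
      simp only [map_add, map_smul, LinearMap.add_apply, LinearMap.smul_apply, smul_eq_mul]; ring
    rw [hp1, hp2] at this
    generalize b (aw + ba) (a k) = X at this ⊢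
    simp only [map_add, map_smul, LinearMap.add_apply, LinearMap.smul_apply, smul_eq_mul,
      F.orth, one_mul] at this
    by_cases hk : k ∈ T
    · rw [if_pos hk]
      rcases (memT k).1 hk with rfl | rfl | rfl | rfl
      · simp [hne.symm, hiT.2.1, hjT.2.1] at this; omega
      · simp [hne, hiT.2.2, hjT.2.2] at this; omega
      · simp [hiT.2.1.symm, hiT.2.2.symm, hij.symm] at this; omega
      · simp [hjT.2.1.symm, hjT.2.2.symm, hij] at this; omega
    · rw [if_neg hk]
      rw [memT] at hk; push Not at hk
      simp [hk.1.symm, hk.2.1.symm, hk.2.2.1.symm, hk.2.2.2.symm] at this; omega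
  obtain ⟨ad, am, ha'⟩ := H.mk_frame hn1
  have y1 := hp1y y; have y2 := hp2y y; have y3 := hp3y y; have y4 := hp4y y
  rw [hyr, hyr'] at y1 y3
  rw [hyi, hyj] at y2 y4
  obtain ⟨σ, hσ, hσz⟩ := H.sc am (y := y) (by rw [ha', map_add]; omega)
  rw [ha'] at hσz
  have fx : ∀ z, b z z = 8 → (∃ w, z = (aw + ba) + (2:ℤ) • w) → b y z = 0 → σ z = z :=
    fun z aa ab ae => (hσz z aa ab).1 (by omega)
  refine ⟨σ, hσ, ?_, ?_⟩
  · intro o ho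
    by_cases ho1 : o ∈ bj
    · refine H.fixT F hb1 (bi := bj ∩ O) (fun i hi => hyO i (Finset.mem_inter.1 hi).2) fx ?_ ?_ h34
        o (Finset.mem_inter.2 ⟨ho1, ho⟩)
      · rw [hT, Finset.sdiff_union_inter]; exact cp
      · rw [hT]; exact Finset.disjoint_sdiff_inter bj O
    · refine H.fixT F hb1 (bi := O \ bj) (fun i hi => hyO i (Finset.mem_sdiff.1 hi).1) fx ?_ ?_ hT2c
        o (Finset.mem_sdiff.2 ⟨ho, ho1⟩)
      · exact cd_symm cp hO
      · rw [hT, Finset.disjoint_left]; intro k aa ab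
        exact (Finset.mem_sdiff.1 ab).2 (Finset.mem_sdiff.1 aa).1
  · have z1 := hσz (aw + ba) hn1 ⟨0, by simp⟩
    have z2 := hσz (aw - ba) hn2 ⟨-ba, by module⟩
    have z3 := hσz (bd + bg) hn3 ⟨-a j - m, by rw [e13, e24, hm]; module⟩
    have z4 := hσz (bd - bg) hn4 ⟨-bg - a j - m, by rw [e13, e24, hm]; module⟩
    have ah : (2:ℤ) • a r = (aw + ba) + (aw - ba) + (bd + bg) + (bd - bg) := by
      have : (aw + ba) + (aw - ba) + (bd + bg) + (bd - bg) = (2:ℤ) • aw + (2:ℤ) • bd := by module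
      rw [this, hp1, hp3]; module
    have aj : (2:ℤ) • a aq = (2:ℤ) • aw - (2:ℤ) • bd := by rw [hp1, hp3]; module
    have hs : (2:ℤ) • σ (a r) = σ (aw + ba) + σ (aw - ba) + σ (bd + bg) + σ (bd - bg) := by
      rw [← map_smul, ah]; simp only [map_add]
    have yy1 : b y (aw + ba) = b y aw + b y ba := map_add _ _ _
    have yy2 : b y (aw - ba) = b y aw - b y ba := map_sub _ _ _
    have yy3 : b y (bd + bg) = b y bd + b y bg := map_add _ _ _
    have yy4 : b y (bd - bg) = b y bd - b y bg := map_sub _ _ _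
    rcases he with rfl | rfl
    · right
      rw [z1.2 (by omega), z2.2 (by omega), z3.1 (by omega), z4.1 (by omega)] at hs
      refine H.smul_inj two_ne_zero (hs.trans ?_)
      rw [smul_neg, aj]; module
    · left
      rw [z1.1 (by omega), z2.1 (by omega), z3.2 (by omega), z4.2 (by omega)] at hs
      refine H.smul_inj two_ne_zero (hs.trans ?_)
      rw [aj]; module
end LL
end latt4
section latt5
variable {L : Type} [AddCommGroup L] {b : BL L}
theorem Fr.reindex {a : FT → L} (F : Fr b a) (p : Equiv.Perm FT) :
    Fr b (fun i => a (p i)) :=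
  ⟨fun i j => by rw [F.orth]; simp, fun i j => F.cong _ _⟩
theorem Fr.resign {a : FT → L} (F : Fr b a) (e : FT → ℤ) (he : ∀ i, e i = 1 ∨ e i = -1) :
    Fr b (fun i => e i • a i) :=
  ⟨fun i j => by
    rw [map_smul, map_smul, LinearMap.smul_apply, F.orth]
    split_ifs with h
    · subst h; rcases he i with h | h <;> rw [h] <;> rfl
    · simp, fun i j => by
    obtain ⟨y, hy⟩ := F.cong i j
    rcases he i with h | h <;> rcases he j with ai | ai
    · exact ⟨y, by rw [h, ai, hy]; module⟩
    · exact ⟨y + a j, by rw [h, ai, hy]; module⟩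
    · exact ⟨-y - a j, by rw [h, ai, hy]; module⟩
    · exact ⟨-y, by rw [h, ai, hy]; module⟩⟩
def Orb (b : BL L) (x y : L) : Prop := ∃ σ : EL L, Isom b σ ∧ σ x = y
theorem isom_id : Isom b (LinearMap.id) := fun _ _ => rfl
theorem Orb.trans {x y z : L} (h : Orb b x y) (ai : Orb b y z) : Orb b x z := by
  obtain ⟨σ, aa, rfl⟩ := h
  obtain ⟨τ, ab, rfl⟩ := ai
  exact ⟨τ ∘ₗ σ, ab.comp aa, rfl⟩
namespace LL
variable (H : LL b) {a ad : FT → L} (F : Fr b a) (am : Fr b ad)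
include H
theorem swap {u af v : L} (hu : b u u = 4) (bb : b af af = 4) (huu : b u af = 0)
    (hv : b v v ≤ 4) (hvu : b v u = 0) (hvu' : b v af = 0) :
    ∃ σ : EL L, Isom b σ ∧ σ u = af ∧ σ v = v := by
  have ht : b (u + af) (u + af) = 8 := by rw [H.add2, hu, bb, huu]; norm_num
  obtain ⟨a, F, ha⟩ := H.mk_frame ht
  have cr : b (u - af) (u - af) = 8 := by rw [H.sub2, hu, bb, huu]; norm_num
  obtain ⟨k, hk⟩ := H.mem_frame F cr ⟨0, -af, by rw [ha]; module⟩
  have hk0 : k ≠ 0 := by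
    rintro rfl
    have aa : b (u - af) (u + af) = 0 := by
      simp only [map_sub, map_add, LinearMap.sub_apply]
      rw [hu, bb, H.symm af u, huu]; norm_num
    rw [← ha] at aa
    rcases hk with h | h
    · rw [h, F.self] at aa; omega
    · rw [h, map_neg, LinearMap.neg_apply, F.self] at aa; omega
  have hv0 : b v (a 0) = 0 := by rw [ha, map_add, hvu, hvu']; rfl
  have hvk : b v (a k) = 0 := by
    have : b v (u - af) = 0 := by rw [map_sub, hvu, hvu']; rfl
    rcases hk with h | h
    · rwa [h] at this
    · rw [h, map_neg] at this; omega
  have hev : ∀ i, b v (a i) % 2 = 0 := fun i => by have := par F v i 0; omega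
  set sv : SF := Finset.univ.filter fun i => b v (a i) % 4 = 2 with hsv
  set pv : SF := Finset.univ.filter fun i => b v (a i) ≠ 0 with hpv
  have hsvC : Cd b a sv := ⟨v, fun i => by
    have := hev i
    simp only [hsv, Finset.mem_filter, Finset.mem_univ, true_and]
    split_ifs <;> omega⟩
  have hsp : sv ⊆ pv := by
    intro i hi
    simp only [hsv, hpv, Finset.mem_filter, Finset.mem_univ, true_and] at hi ⊢
    omega
  have hsum : 4 * (sv.card : ℤ) + 16 * ((pv \ sv).card : ℤ) ≤ 32 := by
    have ao := H.sum8 F v v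
    have aa : ∑ i, ((if i ∈ sv then (4:ℤ) else 0) + (if i ∈ pv \ sv then 16 else 0)) ≤
        ∑ i, b v (a i) * b v (a i) := by
      apply Finset.sum_le_sum
      intro i _
      have ab := hev i
      simp only [hsv, hpv, Finset.mem_filter, Finset.mem_univ, true_and, Finset.mem_sdiff]
      obtain ⟨X, hX⟩ : ∃ X, b v (a i) = 2 * X := ⟨b v (a i) / 2, by omega⟩
      rw [hX]
      by_cases c0 : X = 0
      · subst c0; simp
      · by_cases bn : (2 * X) % 4 = 2
        · simp only [bn, if_true, not_true, and_false, if_false]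
          have : X ≤ -1 ∨ 1 ≤ X := by omega
          rcases this with h | h <;> nlinarith
        · have : X ≤ -2 ∨ 2 ≤ X := by omega
          simp only [bn, if_false, not_false_eq_true, and_true]
          split_ifs <;> rcases this with h | h <;> nlinarith
    rw [Finset.sum_add_distrib] at aa
    simp only [Finset.sum_ite_mem, Finset.univ_inter, Finset.sum_const, nsmul_eq_mul] at aa
    omega
  have hpc : (pv \ sv).card + sv.card = pv.card := Finset.card_sdiff_add_card_eq_card hsp
  have hkpv : k ∉ pv := by simp [hpv, hvk]
  obtain ⟨c, hc, hcS⟩ := H.duality F (S := {0, k} ∪ pv) (χ := {k}) (by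
    intro i hi; simp at hi; simp [hi]) (by
    intro d hd hdS
    by_contra hodd
    have hkd : k ∈ d := by
      by_contra h
      rw [Finset.inter_singleton_of_notMem h] at hodd; simp at hodd
    have ao := H.cd_ge8 F hd ⟨k, hkd⟩
    have hds : d.card ≤ 2 + (d ∩ pv).card := by
      have : d ⊆ {0, k} ∪ (d ∩ pv) := by
        intro i hi
        have := hdS hi
        simp only [Finset.mem_union, Finset.mem_inter] at this ⊢
        tauto
      exact (Finset.card_le_card this).trans ((Finset.card_union_le _ _).trans (by
        have := Finset.card_le_two (a := (0 : FT)) (b := k); omega))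
    have hle : (d ∩ pv).card ≤ pv.card := Finset.card_le_card Finset.inter_subset_right
    have hse : sv = pv := by
      rcases sv.eq_empty_or_nonempty with h | h
      · rw [h] at hpc hsum; simp at hpc hsum; omega
      · have := H.cd_ge8 F hsvC h
        exact Finset.eq_of_subset_of_card_le hsp (by omega)
    rw [← hse] at hle hds hkpv
    have al := H.cd_card F hd
    have h4' := H.cd_card F hsvC
    have := H.octad_unique F hd hsvC (by omega) (by omega) (by omega)
    exact hkpv (this ▸ hkd))
  have hkc : k ∈ c := by
    have : k ∈ c ∩ ({0, k} ∪ pv) := by rw [hcS]; simp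
    exact (Finset.mem_inter.1 this).1
  have h0c : (0 : FT) ∉ c := by
    intro h
    have : (0 : FT) ∈ c ∩ ({0, k} ∪ pv) := by simp [h]
    rw [hcS] at this; simp at this; exact hk0 this.symm
  obtain ⟨σ, aa, ab, ae⟩ := H.sgn F hc
  refine ⟨σ, aa, ?_, H.ext F fun i => ?_⟩
  · have bl := ae 0
    have ek := ae k
    rw [if_neg h0c, one_smul, ha] at bl
    rw [if_pos hkc, neg_one_zsmul] at ek
    have ah : σ (u - af) = - (u - af) := by
      rcases hk with h | h
      · rw [h, ek]
      · rw [h, map_neg, ek]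
    refine H.smul_inj two_ne_zero ?_
    have : (2:ℤ) • u = (u + af) + (u - af) := by module
    rw [← map_smul, this, map_add, bl, ah]; module
  · rw [ab]
    by_cases hi : i ∈ pv
    · have : i ∉ c := by
        intro h
        have : i ∈ c ∩ ({0, k} ∪ pv) := by simp [h, hi]
        rw [hcS] at this; simp at this; rw [this] at hi; exact hkpv hi
      rw [if_neg this, one_mul]
    · have : b v (a i) = 0 := by simpa [hpv] using hi
      rw [this, mul_zero]
include F
theorem coord_le {x : L} {n : ℤ} (hn : 0 ≤ n) (hx : 8 * b x x < (n + 1) ^ 2) (i : FT) :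
    -n ≤ b x (a i) ∧ b x (a i) ≤ n := by
  have ao := H.sum8 F x x
  have : b x (a i) * b x (a i) ≤ ∑ i, b x (a i) * b x (a i) :=
    Finset.single_le_sum (f := fun i => b x (a i) * b x (a i)) (fun i _ => mul_self_nonneg _)
      (Finset.mem_univ i)
  constructor <;> nlinarith
def pigT (p q : ℤ) : Finset (ℤ × ℤ) :=
  (Finset.Icc (-5) 5 ×ˢ Finset.Icc (-5) 5).filter fun z =>
    z.1 % 2 = p ∧ z.2 % 2 = q ∧ (0 < z.1 ∨ z.1 = 0 ∧ 0 ≤ z.2)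
theorem pig {x y : L} (hx : b x x ≤ 4) (hy : b y y ≤ 4) (S : SF) (hS : 19 ≤ S.card) :
    ∃ i ∈ S, ∃ j ∈ S, i ≠ j ∧ ∃ w, b w w = 4 ∧ b x w = 0 ∧ b y w = 0 ∧
      (∀ k, k ≠ i → k ≠ j → b (a k) w = 0) := by
  have hc : ∀ p q : ℤ, (p = 0 ∨ p = 1) → (q = 0 ∨ q = 1) → (pigT p q).card < 19 := by
    rintro p q (rfl | rfl) (rfl | rfl) <;> decide
  have hlt : (pigT (b x (a 0) % 2) (b y (a 0) % 2)).card < S.card :=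
    (hc _ _ (Int.emod_two_eq_zero_or_one _) (Int.emod_two_eq_zero_or_one _)).trans_le hS
  set f : FT → ℤ × ℤ := fun i =>
    if (0 < b x (a i) ∨ b x (a i) = 0 ∧ 0 ≤ b y (a i)) then (b x (a i), b y (a i))
    else (-b x (a i), -b y (a i)) with hf
  obtain ⟨i, hi, j, hj, hij, hfij⟩ := Finset.exists_ne_map_eq_of_card_lt_of_maps_to hlt (f := f) (by
    intro i _
    have aa := H.coord_le F (x := x) (n := 5) (by norm_num) (by omega) i
    have ab := H.coord_le F (x := y) (n := 5) (by norm_num) (by omega) i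
    have ae := par F x i 0
    have al := par F y i 0
    simp only [hf, pigT]
    split_ifs <;> simp only [Finset.coe_filter, Finset.mem_product, Finset.mem_Icc, Set.mem_ofPred_eq] <;> omega)
  have key : ∃ e : ℤ, (e = 1 ∨ e = -1) ∧ b x (a i) + e * b x (a j) = 0 ∧
      b y (a i) + e * b y (a j) = 0 := by
    simp only [hf] at hfij
    split_ifs at hfij <;> simp only [Prod.mk.injEq] at hfij
    · exact ⟨-1, by omega⟩
    · exact ⟨1, by omega⟩
    · exact ⟨1, by omega⟩
    · exact ⟨-1, by omega⟩
  obtain ⟨e, he, ah, aj⟩ := key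
  obtain ⟨w, -, hw, hwy⟩ := H.half F i j e he hij
  refine ⟨i, hi, j, hj, hij, w, hw, ?_, ?_, ?_⟩
  · have := hwy x; omega
  · have := hwy y; omega
  · intro k aa ab
    have := hwy (a k)
    rw [F.ne aa, F.ne ab] at this
    omega
omit F
theorem isom_inv {σ : EL L} (h : Isom b σ) :
    ∃ τ : EL L, Isom b τ ∧ (∀ x, τ (σ x) = x) ∧ ∀ x, σ (τ x) = x := by
  have inj : Function.Injective σ := by
    intro x y hxy
    apply H.eq_of
    rw [← h, map_sub, hxy]; simp
  have sur : Function.Surjective σ := by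
    intro x
    obtain ⟨z, hz⟩ := H.unim ((b x) ∘ₗ σ)
    refine ⟨z, ?_⟩
    obtain ⟨t, ht⟩ := H.ex8
    obtain ⟨a, F, -⟩ := H.mk_frame ht
    have ah := H.rank (fun i => σ (a i)) (fun i j => by rw [h]; exact F.orth i j) x
    have aj := H.rank a F.orth z
    refine H.smul_inj (c := 8) (by norm_num) ?_
    rw [ah, ← map_smul, aj, map_sum]
    exact scg fun i _ => by rw [map_smul, hz]; rfl
  let e := LinearEquiv.ofBijective σ ⟨inj, sur⟩
  have aj : ∀ x, σ (e.symm x) = x := fun x => e.apply_symm_apply x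
  refine ⟨e.symm.toLinearMap, fun x y => ?_, fun x => e.symm_apply_apply x, aj⟩
  rw [← h]
  exact congrArg₂ (fun p q => b p q) (aj x) (aj y)
theorem orb_symm {x y : L} (h : Orb b x y) : Orb b y x := by
  obtain ⟨σ, aa, rfl⟩ := h
  obtain ⟨τ, ab, ae, -⟩ := H.isom_inv aa
  exact ⟨τ, ab, ae x⟩
theorem ex_frame : ∃ a, Fr b a := by
  obtain ⟨t, ht⟩ := H.ex8
  obtain ⟨a, F, -⟩ := H.mk_frame ht
  exact ⟨a, F⟩
theorem t2 {u af : L} (hu : b u u = 4) (bb : b af af = 4) : Orb b u af := by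
  obtain ⟨a, F⟩ := H.ex_frame
  obtain ⟨i, -, j, -, -, w, hw, aa, ab, -⟩ := H.pig F hu.le bb.le Finset.univ (by simp)
  obtain ⟨σ, ap, ar, -⟩ := H.swap hu hw aa (v := 0) (by simp) (by simp) (by simp)
  obtain ⟨τ, bm, t2, -⟩ := H.swap hw bb (by rw [H.symm, ab]) (v := 0) (by simp) (by simp) (by simp)
  exact ⟨τ ∘ₗ σ, bm.comp ap, by simp [ar, t2]⟩
theorem t22 {v u af : L} (hv : b v v = 4) (hu : b u u = 4) (bb : b af af = 4)
    (hvu : b v u = 0) (hvu' : b v af = 0) :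
    ∃ σ : EL L, Isom b σ ∧ σ u = af ∧ σ v = v := by
  have ht : b (v + u) (v + u) = 8 := by rw [H.add2, hv, hu, hvu]; norm_num
  obtain ⟨a, F, ha⟩ := H.mk_frame ht
  have cr : b (v - u) (v - u) = 8 := by rw [H.sub2, hv, hu, hvu]; norm_num
  obtain ⟨k, hk⟩ := H.mem_frame F cr ⟨0, -u, by rw [ha]; module⟩
  obtain ⟨i, hi, j, hj, -, w, hw, aa, -, ae⟩ := H.pig F bb.le bb.le ((Finset.univ.erase 0).erase k) (by
    have aa := Finset.pred_card_le_card_erase (s := Finset.univ.erase (0 : FT)) (a := k)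
    have ab := Finset.pred_card_le_card_erase (s := Finset.univ) (a := (0 : FT))
    simp only [Finset.card_univ, Fintype.card_fin] at ab
    omega)
  simp only [Finset.mem_erase] at hi hj
  have w0 := ae 0 hi.2.1.symm hj.2.1.symm
  have wk := ae k hi.1.symm hj.1.symm
  have ah : b v w + b u w = 0 := by rw [← LinearMap.add_apply, ← map_add, ← ha, w0]
  have aj : b v w - b u w = 0 := by
    rw [← LinearMap.sub_apply, ← map_sub]
    rcases hk with h | h
    · rw [h, wk]
    · rw [h, map_neg, LinearMap.neg_apply, wk]; rfl
  obtain ⟨σ, ap, ar, be⟩ := H.swap hu hw (by omega) (v := v) (by omega) hvu (by omega)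
  obtain ⟨τ, bm, t2, cd⟩ := H.swap hw bb (by rw [H.symm, aa]) (v := v) (by omega) (by omega) hvu'
  exact ⟨τ ∘ₗ σ, bm.comp ap, by simp [ar, t2], by simp [be, cd]⟩
theorem split4 {t : L} (ht : b t t = 8) : ∃ u v, b u u = 4 ∧ b v v = 4 ∧ b v u = 0 ∧ t = v + u := by
  obtain ⟨a, F, rfl⟩ := H.mk_frame ht
  obtain ⟨u, hu, hun, huy⟩ := H.half F 0 1 1 (Or.inl rfl) (by decide)
  have aa := huy (a 0)
  rw [F.self, F.ne (by decide)] at aa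
  refine ⟨u, a 0 - u, hun, ?_, ?_, by abel⟩
  · rw [H.sub2, hun, F.self]; omega
  · rw [map_sub, LinearMap.sub_apply]; omega
theorem t4 {t ch : L} (ht : b t t = 8) (cr : b ch ch = 8) : Orb b t ch := by
  obtain ⟨u, v, hu, hv, hvu, rfl⟩ := H.split4 ht
  obtain ⟨af, cj, bb, bq, hvu', rfl⟩ := H.split4 cr
  obtain ⟨σ, ap, rfl⟩ := H.t2 hv bq
  obtain ⟨τ, bm, t2, cd⟩ := H.t22 bq (u := σ u) (by rw [ap, hu]) bb (by rw [ap, hvu]) hvu'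
  exact ⟨τ ∘ₗ σ, bm.comp ap, by simp [t2, cd]⟩
include F
theorem five {J : SF} (hJ : J.card ≤ 4) {r aq : FT} (hr : r ∉ J) (bp : aq ∉ J) :
    ∃ σ : EL L, Isom b σ ∧ (∀ o ∈ J, σ (a o) = a o) ∧
      (σ (a r) = a aq ∨ σ (a r) = - a aq) := by
  by_cases hne : r = aq
  · exact ⟨LinearMap.id, isom_id, fun _ _ => rfl, Or.inl (by rw [hne]; rfl)⟩
  have ab : ((Finset.univ.erase r).erase aq).card = 22 := by
    rw [Finset.card_erase_of_mem (by simp [Ne.symm hne]), Finset.card_erase_of_mem (by simp)]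
    simp
  obtain ⟨K, hJK, hK, hK4⟩ := Finset.exists_subsuperset_card_eq
    (s := J) (t := (Finset.univ.erase r).erase aq) (n := 4) (by
      intro i hi; simp only [Finset.mem_erase, Finset.mem_univ, and_true]
      exact ⟨by rintro rfl; exact bp hi, by rintro rfl; exact hr hi⟩) hJ (by omega)
  have hrK : r ∉ K := fun h => by have := hK h; simp at this
  have hrK' : aq ∉ K := fun h => by have := hK h; simp at this
  have ay : ∀ z, z ∉ K → (insert z K).card = 5 := fun z hz => by
    rw [Finset.card_insert_of_notMem hz, hK4]
  obtain ⟨A, hA, hA8, hAK⟩ := H.octad F (ay r hrK)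
  obtain ⟨B, hB, hB8, hBK⟩ := H.octad F (ay aq hrK')
  have hAB : (A ∪ B).card < Finset.univ.card (α := FT) := by
    have := Finset.card_union_le A B
    rw [Finset.card_univ, Fintype.card_fin]; omega
  obtain ⟨q, -, hq⟩ := Finset.exists_mem_notMem_of_card_lt_card hAB
  rw [Finset.mem_union, not_or] at hq
  have hqK : q ∉ K := fun h => hq.1 (hAK (Finset.mem_insert_of_mem h))
  obtain ⟨O, hO, bo, hOK⟩ := H.octad F (ay q hqK)
  have hqO : q ∈ O := hOK (Finset.mem_insert_self _ _)
  have out : ∀ z A, z ∉ K → Cd b a A → A.card = 8 → insert z K ⊆ A → q ∉ A → z ∉ O := by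
    intro z A hz hA hA8 hAK hqA hzO
    have : O = A := H.octad_unique F hO hA bo hA8 (by
      rw [← ay z hz]
      apply Finset.card_le_card
      refine Finset.subset_inter (fun i hi => ?_) hAK
      rcases Finset.mem_insert.1 hi with rfl | h
      · exact hzO
      · exact hOK (Finset.mem_insert_of_mem h))
    exact hqA (this ▸ hqO)
  obtain ⟨σ, ap, ar, be⟩ := H.step F hO bo (out r A hrK hA hA8 hAK hq.1)
    (out aq B hrK' hB hB8 hBK hq.2) hne
  exact ⟨σ, ap, fun o ho => ar o (hOK (Finset.mem_insert_of_mem (hJK ho))), be⟩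
include am
theorem frame_pres {σ : EL L} (hσ : Isom b σ) {i j : FT}
    (h : σ (a i) = ad j ∨ σ (a i) = - ad j) (l : FT) : ∃ k, σ (a l) = ad k ∨ σ (a l) = - ad k := by
  refine H.mem_frame am (by rw [hσ, F.self]) ?_
  obtain ⟨y, hy⟩ := F.cong l i
  rcases h with h | h
  · exact ⟨j, σ y, by rw [hy, map_add, map_smul, h]⟩
  · exact ⟨j, σ y - ad j, by rw [hy, map_add, map_smul, h]; module⟩
theorem main5 : ∃ σ : EL L, Isom b σ ∧ (∀ i : FT, i.1 < 5 → σ (a i) = ad i) ∧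
    ∀ l, ∃ k, σ (a l) = ad k ∨ σ (a l) = - ad k := by
  have key : ∀ n : ℕ, n ≤ 5 → ∃ σ : EL L, Isom b σ ∧
      (∀ i : FT, i.1 < n → σ (a i) = ad i ∨ σ (a i) = - ad i) ∧
      ∀ l, ∃ k, σ (a l) = ad k ∨ σ (a l) = - ad k := by
    intro n
    induction n with
    | zero =>
      intro _
      obtain ⟨σ, ap, ar⟩ := H.t4 (F.self 0) (am.self 0)
      exact ⟨σ, ap, fun i hi => absurd hi (by omega), H.frame_pres F am ap (Or.inl ar)⟩
    | succ n ih =>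
      intro hn
      obtain ⟨σ, ap, ar, be⟩ := ih (by omega)
      set m : FT := ⟨n, by omega⟩ with hm
      obtain ⟨r, hr⟩ := be m
      set J : SF := Finset.univ.filter fun i => i.1 < n with hJ
      have hJc : J.card ≤ 4 := by
        have : J.card ≤ (Finset.range n).card := Finset.card_le_card_of_injOn (fun i => i.1)
          (fun i hi => by simpa [hJ] using hi) (fun i _ j _ h => Fin.ext h)
        rw [Finset.card_range] at this; omega
      have hrJ : r ∉ J := by
        intro h
        have hrn : r.1 < n := by simpa [hJ] using h
        have aa := ar r hrn
        have ab := ap (a r) (a m)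
        have ae : r ≠ m := by intro h; rw [h] at hrn; simp [hm] at hrn
        rw [F.ne ae] at ab
        have al := am.self r
        rcases hr with h | h <;> rcases aa with ai | ai <;> rw [h, ai] at ab <;> (try simp only [map_neg, LinearMap.neg_apply] at ab) <;> omega
      obtain ⟨τ, bm, t2, cd⟩ := H.five am hJc hrJ (aq := m) (by simp [hJ, hm])
      have t4 : ∀ i, i.1 < n → τ (ad i) = ad i := fun i hi => t2 i (by simpa [hJ] using hi)
      refine ⟨τ ∘ₗ σ, bm.comp ap, fun i hi => ?_, fun l => ?_⟩
      · simp only [LinearMap.comp_apply]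
        rcases Nat.lt_succ_iff_lt_or_eq.1 hi with h | h
        · rcases ar i h with ai | ai
          · left; rw [ai, t4 i h]
          · right; rw [ai, map_neg, t4 i h]
        · have : i = m := Fin.ext h
          rw [this]
          rcases hr with h | h <;> rcases cd with ai | ai <;> rw [h] <;> simp [ai]
      · simp only [LinearMap.comp_apply]
        obtain ⟨k, hk⟩ := be l
        obtain ⟨k', hk'⟩ := H.frame_pres am am bm cd k
        refine ⟨k', ?_⟩
        rcases hk with h | h <;> rcases hk' with ai | ai <;> rw [h] <;> simp [ai]
  obtain ⟨σ, ap, ar, be⟩ := key 5 le_rfl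
  set S : SF := Finset.univ.filter fun i => i.1 < 5 with hS
  have hSc : S.card ≤ 5 := by
    have : S.card ≤ (Finset.range 5).card := Finset.card_le_card_of_injOn (fun i => i.1)
      (fun i hi => by simpa [hS] using hi) (fun i _ j _ h => Fin.ext h)
    rw [Finset.card_range] at this; omega
  classical
  obtain ⟨c, hc, hcS⟩ := H.duality am (S := S) (χ := S.filter fun i => σ (a i) ≠ ad i)
    (Finset.filter_subset _ _) (by
      intro d hd hdS
      rcases d.eq_empty_or_nonempty with rfl | h
      · simp
      · have := H.cd_ge8 am hd h
        have := Finset.card_le_card hdS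
        omega)
  obtain ⟨τ, bm, -, cd⟩ := H.sgn am hc
  refine ⟨τ ∘ₗ σ, bm.comp ap, fun i hi => ?_, fun l => ?_⟩
  · simp only [LinearMap.comp_apply]
    have hiS : i ∈ S := by simpa [hS] using hi
    have hm : i ∈ c ↔ σ (a i) ≠ ad i := by
      have : i ∈ c ∩ S ↔ i ∈ S.filter fun i => σ (a i) ≠ ad i := by rw [hcS]
      simpa [hiS] using this
    have ae := cd i
    by_cases h : σ (a i) = ad i
    · rw [if_neg (by rw [hm]; simpa using h), one_smul] at ae; rw [h, ae]
    · rw [if_pos (hm.2 h), neg_one_zsmul] at ae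
      rw [(ar i hi).resolve_left h, map_neg, ae, neg_neg]
  · simp only [LinearMap.comp_apply]
    obtain ⟨k, hk⟩ := be l
    refine ⟨k, ?_⟩
    have ae := cd k
    split_ifs at ae <;> rcases hk with h | h <;> rw [h] <;> simp [ae]
end LL
end latt5
section latt6
variable {L : Type} [AddCommGroup L] {b : BL L}
theorem cnt (S : SF) (f : FT → ℤ) (P : FT → Prop) [DecidablePred P] (c d : ℤ)
    (aa : ∀ i ∈ S, ¬ P i → c ≤ f i) (ab : ∀ i ∈ S, P i → d ≤ f i) :
    c * S.card + (d - c) * (S.filter P).card ≤ ∑ i ∈ S, f i := by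
  have : ∑ i ∈ S, (c + if P i then d - c else 0) ≤ ∑ i ∈ S, f i := by
    apply Finset.sum_le_sum
    intro i hi
    by_cases h : P i
    · simp only [h, if_true]; linarith [ab i hi h]
    · simp only [h, if_false]; linarith [aa i hi h]
  rw [Finset.sum_add_distrib, ← Finset.sum_filter] at this
  simp only [Finset.sum_const, nsmul_eq_mul] at this
  linarith
theorem card_er : ((Finset.univ : SF).erase 0).card = 23 := by
  rw [Finset.card_erase_of_mem (Finset.mem_univ _), Finset.card_univ, Fintype.card_fin]
theorem perm_ext {m : ℕ} (hm : m ≤ 24) (f : Fin m → FT) (hf : Function.Injective f) :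
    ∃ p : Equiv.Perm FT, ∀ i : Fin m, p (Fin.castLE hm i) = f i := by
  classical
  let ah : Fin m ≃ {x // x ∈ Set.range (Fin.castLE hm)} :=
    Equiv.ofInjective _ (Fin.castLE_injective hm)
  let aj : Fin m ≃ {x // x ∈ Set.range f} := Equiv.ofInjective _ hf
  let e := ah.symm.trans aj
  refine ⟨e.extendSubtype, fun i => ?_⟩
  rw [Equiv.extendSubtype_apply_of_mem e _ ⟨i, rfl⟩]
  have : ah.symm ⟨Fin.castLE hm i, ⟨i, rfl⟩⟩ = i := by
    rw [Equiv.symm_apply_eq]; rfl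
  simp only [e, Equiv.trans_apply]
  rw [this]; rfl
theorem perm2 {i j : FT} (h : i ≠ j) : ∃ p : Equiv.Perm FT, p 0 = i ∧ p 1 = j := by
  obtain ⟨p, hp⟩ := perm_ext (m := 2) (by norm_num) ![i, j] (by
    intro x y hxy
    fin_cases x <;> fin_cases y <;> simp_all)
  exact ⟨p, hp 0, hp 1⟩
theorem perm3 {i j k : FT} (h : i ≠ j) (ai : i ≠ k) (h'' : j ≠ k) :
    ∃ p : Equiv.Perm FT, p 0 = i ∧ p 1 = j ∧ p 2 = k := by
  obtain ⟨p, hp⟩ := perm_ext (m := 3) (by norm_num) ![i, j, k] (by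
    intro x y hxy
    fin_cases x <;> fin_cases y <;> simp_all [eq_comm])
  exact ⟨p, hp 0, hp 1, hp 2⟩
theorem perm5 {Z : SF} (hZ : Z.card = 5) {i : FT} (hi : i ∉ Z) :
    ∃ p : Equiv.Perm FT, p 0 = i ∧ ∀ k, p k ∈ Z ↔ k ≠ 0 ∧ k.1 < 6 := by
  have hin : Function.Injective (Fin.cons i (Z.orderEmbOfFin hZ) : Fin 6 → FT) := by
    rw [Fin.cons_injective_iff]
    refine ⟨?_, (Z.orderEmbOfFin hZ).injective⟩
    rw [Finset.range_orderEmbOfFin]; simpa using hi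
  obtain ⟨p, hp⟩ := perm_ext (m := 6) (by norm_num) _ hin
  refine ⟨p, hp 0, fun k => ⟨fun hk => ?_, fun ⟨ag, bt⟩ => ?_⟩⟩
  · have : p k ∈ Set.range (Z.orderEmbOfFin hZ) := by rw [Finset.range_orderEmbOfFin]; exact hk
    obtain ⟨j, hj⟩ := this
    have aa := hp j.succ
    rw [Fin.cons_succ, hj] at aa
    have ab := p.injective aa
    rw [← ab]
    constructor
    · intro h
      have := congrArg Fin.val h
      simp at this
    · have := j.2
      simp only [Fin.val_castLE, Fin.val_succ]; omega
  · obtain ⟨j, hj⟩ : ∃ j : Fin 5, Fin.castLE (by norm_num) j.succ = k := by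
      have : k.1 ≠ 0 := fun h => ag (Fin.ext h)
      exact ⟨⟨k.1 - 1, by omega⟩, Fin.ext (by simp; omega)⟩
    rw [← hj, hp, Fin.cons_succ]
    exact Finset.orderEmbOfFin_mem Z hZ j
theorem perm50 {Z : SF} (hZ : 5 ≤ Z.card) :
    ∃ p : Equiv.Perm FT, ∀ k : FT, k.1 < 5 → p k ∈ Z := by
  obtain ⟨Y, hY, hY5⟩ := Finset.exists_subset_card_eq hZ
  obtain ⟨p, hp⟩ := perm_ext (m := 5) (by norm_num) _ (Y.orderEmbOfFin hY5).injective
  refine ⟨p, fun k hk => hY ?_⟩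
  have := hp ⟨k.1, hk⟩
  have e : Fin.castLE (by norm_num) (⟨k.1, hk⟩ : Fin 5) = k := Fin.ext rfl
  rw [e] at this
  rw [this]; exact Finset.orderEmbOfFin_mem Y hY5 _
namespace LL
variable (H : LL b) {a ad : FT → L} (F : Fr b a) (am : Fr b ad)
include H
theorem norm_le {x : L} {n : ℤ} (h : b x x ≤ n) (i : FT) (F : Fr b a) :
    b x (a i) ^ 2 ≤ 8 * n := by
  have ao := H.sum8 F x x
  have : b x (a i) * b x (a i) ≤ ∑ i, b x (a i) * b x (a i) :=
    Finset.single_le_sum (f := fun i => b x (a i) * b x (a i)) (fun i _ => mul_self_nonneg _)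
      (Finset.mem_univ i)
  rw [pow_two]; omega
include F
theorem mod4n {x : L} (h : ∀ i, b x (a i) % 4 = 0) : b x x % 4 = 0 := by
  obtain ⟨o, ho⟩ := H.odd_ex F
  have : ∀ i, ∃ m, b x (a i) = 4 * m := fun i => ⟨b x (a i) / 4, by have := h i; omega⟩
  choose m hm using this
  have aa := H.sum8 F x o
  have ab := H.sum8 F x x
  have ae : ∀ i, ∃ k, b o (a i) = m i + 2 * k + 1 - m i := fun i => ⟨b o (a i) / 2, by
    have := par F o i 0; omega⟩
  choose k hk using ae
  have ah : ∑ i, b x (a i) * b o (a i) = 8 * ∑ i, m i * k i + 4 * ∑ i, m i := by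
    rw [Finset.mul_sum, Finset.mul_sum, ← Finset.sum_add_distrib]
    exact scg fun i _ => by rw [hm, hk]; ring
  have aj : ∑ i, b x (a i) * b x (a i) = 16 * ∑ i, m i * m i := by
    rw [Finset.mul_sum]
    exact scg fun i _ => by rw [hm]; ring
  have bc : (2:ℤ) ∣ ∑ i, m i * m i - ∑ i, m i := by
    rw [← Finset.sum_sub_distrib]
    refine Finset.dvd_sum fun i _ => ?_
    rcases Int.emod_two_eq_zero_or_one (m i) with h | h
    · obtain ⟨z, hz⟩ : ∃ z, m i = 2 * z := ⟨m i / 2, by omega⟩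
      exact ⟨2 * z * z - z, by rw [hz]; ring⟩
    · obtain ⟨z, hz⟩ : ∃ z, m i = 2 * z + 1 := ⟨m i / 2, by omega⟩
      exact ⟨2 * z * z + z, by rw [hz]; ring⟩
  rw [ah] at aa; rw [aj] at ab
  generalize ∑ i, m i * m i = A at *
  generalize ∑ i, m i = B at *
  omega
theorem sum0 (x y : L) : ∑ i ∈ (Finset.univ : SF).erase 0, b x (a i) * b y (a i) =
    8 * b x y - b x (a 0) * b y (a 0) := by
  rw [H.sum8 F x y, ← Finset.add_sum_erase _ _ (Finset.mem_univ (0 : FT))]; ring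
include am
theorem main5' : ∃ σ : EL L, ∃ τ : Equiv.Perm FT, Isom b σ ∧
    (∀ i : FT, i.1 < 5 → σ (a i) = ad i ∧ τ i = i) ∧
    ∀ l, σ (a l) = ad (τ l) ∨ σ (a l) = - ad (τ l) := by
  obtain ⟨σ, aa, ab, ae⟩ := H.main5 F am
  choose t ht using ae
  have inj : Function.Injective t := by
    intro i j hij
    by_contra hne
    have e := aa (a i) (a j)
    rw [F.ne hne] at e
    have hi := ht i
    have hj := ht j
    rw [hij] at hi
    have := am.self (t j)
    rcases hi with h | h <;> rcases hj with ai | ai <;> rw [h, ai] at e <;>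
      (try simp only [map_neg, LinearMap.neg_apply] at e) <;> omega
  refine ⟨σ, Equiv.ofBijective t ((Fintype.bijective_iff_injective_and_card t).2 ⟨inj, rfl⟩), aa,
    fun i hi => ⟨ab i hi, ?_⟩, ht⟩
  show t i = i
  by_contra hne
  have al := am.ne (Ne.symm hne)
  have ay := am.self i
  have bt := ht i
  rw [ab i hi] at bt
  rcases bt with h | h
  · rw [← h] at al; omega
  · have : ad (t i) = - ad i := by rw [h, neg_neg]
    rw [this, map_neg] at al; omega
theorem patOrb {x y : L} (c : FT → ℤ) (hc : ∀ i j : FT, 5 ≤ i.1 → 5 ≤ j.1 → c i = c j)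
    (hx : b x (a 0) % 2 = 1)
    (h : ∀ i, b x (a i) = c i ∨ b x (a i) = - c i) (ai : ∀ i, b y (ad i) = c i ∨ b y (ad i) = - c i) :
    ∃ σ : EL L, Isom b σ ∧ σ x = y ∧
      ∀ i : FT, i.1 < 5 → b x (a i) = b y (ad i) → σ (a i) = ad i := by
  obtain ⟨σ, t, ap, ar, be⟩ := H.main5' F am
  have key : ∀ k, b (σ x) (ad k) = c k ∨ b (σ x) (ad k) = - c k := by
    intro k
    obtain ⟨l, rfl⟩ := t.surjective k
    have ah : b (σ x) (ad (t l)) = b x (a l) ∨ b (σ x) (ad (t l)) = - b x (a l) := by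
      rw [← ap x (a l)]
      rcases be l with h | h <;> rw [h]
      · exact Or.inl rfl
      · right; rw [map_neg, neg_neg]
    have aj : c (t l) = c l := by
      by_cases hl : l.1 < 5
      · rw [(ar l hl).2]
      · by_cases hl' : (t l).1 < 5
        · have := (ar _ hl').2
          rw [t.injective this]
        · exact hc _ _ (by omega) (by omega)
    rw [aj]
    have := h l
    omega
  have z0 := ar 0 (by norm_num)
  have hodd : b (σ x) (ad 0) % 2 = 1 := by
    rw [← z0.1, ap]; exact hx
  obtain ⟨ρ, bw, r2, r3⟩ := H.odd_orbit am hodd (y := y) (fun i => by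
    have := key i; have := ai i; omega)
  refine ⟨ρ ∘ₗ σ, bw.comp ap, r2, fun i hi hxy => ?_⟩
  rw [LinearMap.comp_apply, (ar i hi).1]
  apply r3
  rw [← hxy, ← (ar i hi).1, ap]
end LL
end latt6
section latt7
variable {L : Type} [AddCommGroup L] {b : BL L}
theorem sum1 (S : SF) (f : FT → ℤ) (c : ℤ) (h : ∀ i ∈ S, c ≤ f i) {i : FT}
    (hi : i ∈ S) : f i + c * (S.card - 1) ≤ ∑ k ∈ S, f k := by
  rw [← Finset.add_sum_erase _ _ hi]
  have := Finset.card_nsmul_le_sum (S.erase i) f c (fun k hk => h k (Finset.mem_of_mem_erase hk))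
  rw [Finset.card_erase_of_mem hi, nsmul_eq_mul] at this
  have hc : 1 ≤ S.card := Finset.card_pos.2 ⟨i, hi⟩
  push_cast [hc] at this
  linarith
theorem sum2 (S : SF) (f : FT → ℤ) (c : ℤ) (h : ∀ i ∈ S, c ≤ f i) {i j : FT}
    (hi : i ∈ S) (hj : j ∈ S) (hij : j ≠ i) : f i + f j + c * (S.card - 2) ≤ ∑ k ∈ S, f k := by
  rw [← Finset.add_sum_erase _ _ hi]
  have := sum1 (S.erase i) f c (fun k hk => h k (Finset.mem_of_mem_erase hk))
    (i := j) (Finset.mem_erase.2 ⟨hij, hj⟩)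
  rw [Finset.card_erase_of_mem hi] at this
  have hc : 1 ≤ S.card := Finset.card_pos.2 ⟨i, hi⟩
  push_cast [hc] at this
  linarith
theorem odd_sq {x : ℤ} (h : x % 2 = 1) : 1 ≤ x * x := by
  have : x ≤ -1 ∨ 1 ≤ x := by omega
  rcases this with h | h <;> nlinarith
theorem zsq_le {x n : ℤ} (hn : 0 ≤ n) (h : x * x < (n + 1) * (n + 1)) : -n ≤ x ∧ x ≤ n := by
  constructor <;> nlinarith
theorem er_mem {i : FT} : i ∈ (Finset.univ : SF).erase 0 ↔ i ≠ 0 := by simp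
namespace LL
variable (H : LL b) {a ad : FT → L} (F : Fr b a) (am : Fr b ad)
include H
section
include F
theorem odd3 {v : L} (hv : b v v = 4) (ag : b v (a 0) = 3 ∨ b v (a 0) = -3) (i : FT)
    (hi : i ≠ 0) : b v (a i) = 1 ∨ b v (a i) = -1 := by
  have ao := H.sum0 F v v
  have hp : ∀ i, b v (a i) % 2 = 1 := fun i => by have := par F v i 0; omega
  have aa := sum1 (Finset.univ.erase 0) (fun i => b v (a i) * b v (a i)) 1
    (fun i _ => odd_sq (hp i)) (i := i) (er_mem.2 hi)
  rw [card_er] at aa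
  have ae : b v (a 0) * b v (a 0) = 9 := by rcases ag with h | h <;> rw [h] <;> rfl
  have := zsq_le (x := b v (a i)) (n := 1) (by norm_num) (by push_cast at aa; omega)
  have := hp i
  omega
theorem odd1 {v : L} (hv : b v v = 4) (ag : b v (a 0) = 1 ∨ b v (a 0) = -1) :
    ∃ j, j ≠ 0 ∧ (b v (a j) = 3 ∨ b v (a j) = -3) ∧
      ∀ i, i ≠ 0 → i ≠ j → (b v (a i) = 1 ∨ b v (a i) = -1) := by
  have ao := H.sum0 F v v
  have hp : ∀ i, b v (a i) % 2 = 1 := fun i => by have := par F v i 0; omega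
  have ae : b v (a 0) * b v (a 0) = 1 := by rcases ag with h | h <;> rw [h] <;> rfl
  obtain ⟨j, hj, hj2⟩ : ∃ j, j ≠ 0 ∧ b v (a j) * b v (a j) ≠ 1 := by
    by_contra! hcon
    rw [Finset.sum_congr rfl (fun i hi => hcon i (er_mem.1 hi))] at ao
    rw [Finset.sum_const, card_er] at ao
    simp at ao; omega
  have hj9 : 9 ≤ b v (a j) * b v (a j) := by
    have := hp j
    have hb : b v (a j) ≤ -3 ∨ 3 ≤ b v (a j) := by
      by_contra! h
      have : b v (a j) = 1 ∨ b v (a j) = -1 := by omega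
      rcases this with h | h <;> rw [h] at hj2 <;> omega
    rcases hb with h | h <;> nlinarith
  have aa := sum1 (Finset.univ.erase 0) (fun i => b v (a i) * b v (a i)) 1
    (fun i _ => odd_sq (hp i)) (i := j) (er_mem.2 hj)
  rw [card_er] at aa
  refine ⟨j, hj, ?_, fun i hi hij => ?_⟩
  · have := zsq_le (x := b v (a j)) (n := 3) (by norm_num) (by push_cast at aa; omega)
    have := hp j
    by_contra! h
    have : b v (a j) = 1 ∨ b v (a j) = -1 := by omega
    rcases this with h | h <;> rw [h] at hj2 <;> omega
  · have ab := sum2 (Finset.univ.erase 0) (fun i => b v (a i) * b v (a i)) 1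
      (fun i _ => odd_sq (hp i)) (i := j) (j := i) (er_mem.2 hj) (er_mem.2 hi) hij
    rw [card_er] at ab
    have := zsq_le (x := b v (a i)) (n := 1) (by norm_num) (by push_cast at ab; omega)
    have := hp i
    omega
end
theorem c3 {s v : L} (hs : b s s = 6) (hv : b v v = 4) (h : b s v = 1) :
    ∃ a, Fr b a ∧ a 0 = s - v ∧ ∀ i, b s (a i) = if i = 0 then 5 else 1 := by
  have hn : b (s - v) (s - v) = 8 := by rw [H.sub2, hs, hv, h]; rfl
  obtain ⟨a, F, ha⟩ := H.mk_frame hn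
  have hv0 : b v (a 0) = -3 := by rw [ha, map_sub, H.symm v s, h, hv]; rfl
  have hs0 : b s (a 0) = 5 := by rw [ha, map_sub, h, hs]; rfl
  have hsi : ∀ i, i ≠ 0 → (b s (a i) = 1 ∨ b s (a i) = -1) := by
    intro i hi
    have aa := H.odd3 F hv (Or.inr hv0) i hi
    have ab : b (s - v) (a i) = 0 := by rw [← ha, F.ne hi.symm]
    rw [map_sub, LinearMap.sub_apply] at ab
    omega
  refine ⟨_, F.resign (fun i => if i = 0 then 1 else b s (a i)) (fun i => ?_), ?_, fun i => ?_⟩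
  · by_cases hi : i = 0
    · simp [hi]
    · simpa [hi] using hsi i hi
  · simp [ha]
  · by_cases hi : i = 0
    · simp [hi, hs0]
    · simp only [hi, if_false, map_smul, smul_eq_mul]
      rcases hsi i hi with h | h <;> rw [h] <;> rfl
theorem can3 {s : L} (hs : b s s = 6) : ∃ v, b v v = 4 ∧ b s v = 1 := by
  obtain ⟨a, F⟩ := H.ex_frame
  have key : ∃ i j, i ≠ j ∧ ∃ e : ℤ, (e = 1 ∨ e = -1) ∧
      (b s (a i) + e * b s (a j) = 2 ∨ b s (a i) + e * b s (a j) = -2) := by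
    have ao := H.sum8 F s s
    rcases Int.emod_two_eq_zero_or_one (b s (a 0)) with ag | ag
    · have hp : ∀ i, b s (a i) % 2 = 0 := fun i => by have := par F s i 0; omega
      set T : SF := Finset.univ.filter fun i => b s (a i) % 4 = 2 with hT
      have hTC : Cd b a T := ⟨s, fun i => by
        have := hp i
        simp only [hT, Finset.mem_filter, Finset.mem_univ, true_and]
        split_ifs <;> omega⟩
      have hTn : T.Nonempty := by
        by_contra hne
        have := H.mod4n F (x := s) (fun i => by
          have aa := hp i
          have : i ∉ T := fun h => hne ⟨i, h⟩
          simp only [hT, Finset.mem_filter, Finset.mem_univ, true_and] at this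
          omega)
        omega
      have h8c := H.cd_ge8 F hTC hTn
      have hsq : ∀ i, b s (a i) ≠ 0 → 4 ≤ b s (a i) * b s (a i) := by
        intro i hi
        have := hp i
        have : b s (a i) ≤ -2 ∨ 2 ≤ b s (a i) := by omega
        rcases this with h | h <;> nlinarith
      obtain ⟨i, hi⟩ := hTn
      have hi2 : b s (a i) % 4 = 2 := by simpa [hT] using hi
      have aa := sum1 T (fun i => b s (a i) * b s (a i)) 4 (fun k hk => hsq k (by
        have : b s (a k) % 4 = 2 := by simpa [hT] using hk
        omega)) hi
      have ab : ∑ k ∈ T, b s (a k) * b s (a k) ≤ ∑ k, b s (a k) * b s (a k) :=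
        Finset.sum_le_univ_sum_of_nonneg (fun i => mul_self_nonneg _)
      have ae := zsq_le (x := b s (a i)) (n := 4) (by norm_num) (by push_cast at aa; omega)
      obtain ⟨j, hj⟩ : ∃ j, b s (a j) = 0 := by
        by_contra! hcon
        have := Finset.card_nsmul_le_sum Finset.univ (fun i => b s (a i) * b s (a i)) 4
          (fun i _ => hsq i (hcon i))
        rw [Finset.card_univ, Fintype.card_fin, nsmul_eq_mul] at this
        push_cast at this; omega
      exact ⟨i, j, by rintro rfl; omega, 1, Or.inl rfl, by omega⟩
    · have hp : ∀ i, b s (a i) % 2 = 1 := fun i => by have := par F s i 0; omega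
      have aa := cnt Finset.univ (fun i => b s (a i) * b s (a i))
        (fun i => b s (a i) = 1 ∨ b s (a i) = -1) 9 0 (fun i _ hi => by
          have := hp i
          have : b s (a i) ≤ -3 ∨ 3 ≤ b s (a i) := by omega
          rcases this with h | h <;> nlinarith) (fun i _ _ => mul_self_nonneg _)
      rw [Finset.card_univ, Fintype.card_fin] at aa
      obtain ⟨i, hi, j, hj, hij⟩ := (Finset.one_lt_card (s := Finset.univ.filter
        (fun i => b s (a i) = 1 ∨ b s (a i) = -1))).1 (by push_cast at aa; omega)
      simp only [Finset.mem_filter, Finset.mem_univ, true_and] at hi hj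
      rcases hi with h | h <;> rcases hj with ai | ai
      · exact ⟨i, j, hij, 1, Or.inl rfl, by omega⟩
      · exact ⟨i, j, hij, -1, Or.inr rfl, by omega⟩
      · exact ⟨i, j, hij, -1, Or.inr rfl, by omega⟩
      · exact ⟨i, j, hij, 1, Or.inl rfl, by omega⟩
  obtain ⟨i, j, hij, e, he, h⟩ := key
  obtain ⟨w, -, hw, hwy⟩ := H.half F i j e he hij
  have := hwy s
  rcases h with h | h
  · exact ⟨w, hw, by omega⟩
  · exact ⟨-w, by rw [neg2, hw], by rw [map_neg]; omega⟩
theorem c3' {s : L} (hs : b s s = 6) :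
    ∃ a, Fr b a ∧ ∀ i, b s (a i) = if i = 0 then 5 else 1 := by
  obtain ⟨v, hv, h⟩ := H.can3 hs
  obtain ⟨a, F, -, h⟩ := H.c3 hs hv h
  exact ⟨a, F, h⟩
theorem orb3 {s ak : L} (hs : b s s = 6) (bv : b ak ak = 6) : Orb b s ak := by
  obtain ⟨a, F, h⟩ := H.c3' hs
  obtain ⟨ad, am, ai⟩ := H.c3' bv
  obtain ⟨σ, aa, ab, -⟩ := H.patOrb F am (fun i => if i = 0 then 5 else 1) (by
    intro i j hi hj
    rw [if_neg (by rintro rfl; simp at hi), if_neg (by rintro rfl; simp at hj)])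
    (by rw [h]; rfl) (fun i => Or.inl (h i)) (fun i => Or.inl (ai i))
  exact ⟨σ, aa, ab⟩
theorem orb1 {x y v w : L} (hv : b v v = 4) (hw : b w w = 4) (hx : b (x - v) (x - v) = 8)
    (hy : b (y - w) (y - w) = 8) {e : ℤ} (he : e = 1 ∨ e = -1) (hxv : b (x - v) v = e)
    (hyw : b (y - w) w = e) : Orb b x y := by
  have key : ∀ {x v : L}, b v v = 4 → b (x - v) (x - v) = 8 → b (x - v) v = e →
      ∃ a, Fr b a ∧ ∀ i, b x (a i) = (if i = 0 then 8 + e else if i = 1 then 3 else 1) ∨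
        b x (a i) = -(if i = 0 then 8 + e else if i = 1 then 3 else 1) := by
    intro x v hv hx hxv
    obtain ⟨a, F, ha⟩ := H.mk_frame hx
    have hv0 : b v (a 0) = e := by rw [ha, H.symm, hxv]
    obtain ⟨j, hj, aa, ab⟩ := H.odd1 F hv (by omega)
    have hxi : ∀ i, b x (a i) = (if i = 0 then 8 else 0) + b v (a i) := by
      intro i
      have : b (x - v) (a i) = if i = 0 then 8 else 0 := by
        rw [← ha, F.orth]; simp only [eq_comm]
      rw [map_sub, LinearMap.sub_apply] at this
      omega
    obtain ⟨p, bs, aw⟩ := perm2 hj.symm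
    refine ⟨_, F.reindex p, fun i => ?_⟩
    by_cases hi : i = 0
    · subst hi; left; simp [bs, hxi, hv0]
    · by_cases hi1 : i = 1
      · subst hi1
        simp only [aw, hxi, hj, if_false, zero_add]
        simpa using aa
      · have ah : p i ≠ 0 := by rw [← bs]; exact fun h => hi (p.injective h)
        have aj : p i ≠ j := by rw [← aw]; exact fun h => hi1 (p.injective h)
        simp only [hi, hi1, hxi, ah, if_false, zero_add]
        exact ab _ ah aj
  obtain ⟨a, F, h⟩ := key hv hx hxv
  obtain ⟨ad, am, ai⟩ := key hw hy hyw
  obtain ⟨σ, aa, ab, -⟩ := H.patOrb F am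
    (fun i => if i = 0 then 8 + e else if i = 1 then 3 else 1) (by
      intro i j hi hj
      rw [if_neg (by rintro rfl; simp at hi), if_neg (by rintro rfl; simp at hi),
        if_neg (by rintro rfl; simp at hj), if_neg (by rintro rfl; simp at hj)])
    (by have := h 0; simp only [if_true] at this; omega) h ai
  exact ⟨σ, aa, ab⟩
end LL
end latt7
section latt8
variable {L : Type} [AddCommGroup L] {b : BL L}
theorem ev_sq {x : ℤ} (h : x % 2 = 0) (ag : x ≠ 0) : 4 ≤ x * x := by
  have : x ≤ -2 ∨ 2 ≤ x := by omega
  rcases this with h | h <;> nlinarith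
theorem od_sq {x : ℤ} (h : x % 2 = 1) (ag : ¬ (x = 1 ∨ x = -1)) : 9 ≤ x * x := by
  have : x ≤ -3 ∨ 3 ≤ x := by omega
  rcases this with h | h <;> nlinarith
namespace LL
variable (H : LL b) {a ad : FT → L} (F : Fr b a) (am : Fr b ad)
include H
theorem uframe {u z : L} (hu : b u u = 4) (hz : b z z = 4) (huz : b u z = 0) :
    ∃ a, Fr b a ∧ a 0 = u + z ∧ a 1 = u - z := by
  have ht : b (u + z) (u + z) = 8 := by rw [H.add2, hu, hz, huz]; norm_num
  obtain ⟨a, F, ha⟩ := H.mk_frame ht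
  have cr : b (u - z) (u - z) = 8 := by rw [H.sub2, hu, hz, huz]; norm_num
  obtain ⟨k, hk⟩ := H.mem_frame F cr ⟨0, -z, by rw [ha]; module⟩
  have hk0 : k ≠ 0 := by
    rintro rfl
    have aa : b (u - z) (u + z) = 0 := by
      simp only [map_sub, map_add, LinearMap.sub_apply]
      rw [hu, hz, H.symm z u, huz]; norm_num
    rw [← ha] at aa
    rcases hk with h | h
    · rw [h, F.self] at aa; omega
    · rw [h, map_neg, LinearMap.neg_apply, F.self] at aa; omega
  obtain ⟨p, bs, aw⟩ := perm2 hk0.symm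
  rcases hk with h | h
  · exact ⟨_, F.reindex p, by simp only [bs, ha], by simp only [aw, h]⟩
  · refine ⟨_, (F.reindex p).resign (fun i => if i = 1 then -1 else 1) (fun i => ?_), ?_, ?_⟩
    · by_cases hi : i = 1 <;> simp [hi]
    · simp [bs, ha]
    · simp [aw, h]
theorem ex_perp (u af : L) (hu : b u u ≤ 4) (bb : b af af ≤ 4) :
    ∃ z, b z z = 4 ∧ b u z = 0 ∧ b af z = 0 := by
  obtain ⟨a, F⟩ := H.ex_frame
  obtain ⟨i, -, j, -, -, w, hw, aa, ab, -⟩ := H.pig F hu bb Finset.univ (by simp)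
  exact ⟨w, hw, aa, ab⟩
include F in
theorem half_get {x : L} {i j : FT} (hij : i ≠ j) (e : ℤ) (he : e = 1 ∨ e = -1) {m : ℤ}
    (h : b x (a i) + e * b x (a j) = 2 * m) : ∃ v, b v v = 4 ∧ b x v = m := by
  obtain ⟨w, -, hw, hwy⟩ := H.half F i j e he hij
  exact ⟨w, hw, by have := hwy x; omega⟩
theorem can5 {u af : L} (hu : b u u = 4) (bb : b af af = 4) (h : b u af = 1) :
    ∃ v, b v v = 4 ∧ b (u + af) v = 3 := by
  obtain ⟨z, hz, huz, -⟩ := H.ex_perp u u hu.le hu.le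
  obtain ⟨a, F, cs, bx⟩ := H.uframe hu hz huz
  set x := u + af with hx
  have hxx : b x x = 10 := by rw [hx, H.add2, hu, bb, h]; rfl
  have hpq : b x (a 0) + b x (a 1) = 10 := by
    have e : a 0 + a 1 = (2:ℤ) • u := by rw [cs, bx]; module
    rw [← map_add, e, map_smul, hx, map_add, LinearMap.add_apply, hu, H.symm af, h]; rfl
  have ao := H.sum8 F x x
  rw [← Finset.add_sum_erase _ _ (Finset.mem_univ (0 : FT)),
    ← Finset.add_sum_erase _ _ (show (1 : FT) ∈ Finset.univ.erase 0 by simp)] at ao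
  have hcard : ((Finset.univ.erase (0 : FT)).erase 1).card = 22 := by
    rw [Finset.card_erase_of_mem (by simp), card_er]
  set S := (Finset.univ.erase (0 : FT)).erase 1 with hS
  have hnn : 0 ≤ ∑ i ∈ S, b x (a i) * b x (a i) := Finset.sum_nonneg fun i _ => mul_self_nonneg _
  have hr : 2 ≤ b x (a 0) ∧ b x (a 0) ≤ 8 := by constructor <;> nlinarith
  have hq : b x (a 1) = 10 - b x (a 0) := by omega
  rcases Int.emod_two_eq_zero_or_one (b x (a 0)) with ag | ag
  · have hp : ∀ i, b x (a i) % 2 = 0 := fun i => by have := par F x i 0; omega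
    obtain ⟨j, hj, hj0⟩ : ∃ j ∈ S, b x (a j) = 0 := by
      by_contra! hcon
      have := Finset.card_nsmul_le_sum S (fun i => b x (a i) * b x (a i)) 4
        (fun i hi => ev_sq (hp i) (hcon i hi))
      rw [hcard, nsmul_eq_mul] at this
      push_cast at this
      nlinarith
    simp only [hS, Finset.mem_erase] at hj
    have : b x (a 0) = 2 ∨ b x (a 0) = 4 ∨ b x (a 0) = 6 ∨ b x (a 0) = 8 := by omega
    rcases this with aa | aa | aa | aa
    · exact H.half_get F (i := 1) (j := 0) (by decide) (-1) (by norm_num) (by omega)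
    · exact H.half_get F (i := 1) (j := j) hj.1.symm 1 (by norm_num) (by omega)
    · exact H.half_get F (i := 0) (j := j) hj.2.1.symm 1 (by norm_num) (by omega)
    · exact H.half_get F (i := 0) (j := 1) (by decide) (-1) (by norm_num) (by omega)
  · have hp : ∀ i, b x (a i) % 2 = 1 := fun i => by have := par F x i 0; omega
    obtain ⟨j, hj, hj0⟩ : ∃ j ∈ S, b x (a j) = 1 ∨ b x (a j) = -1 := by
      by_contra! hcon
      have := Finset.card_nsmul_le_sum S (fun i => b x (a i) * b x (a i)) 9
        (fun i hi => od_sq (hp i) (by have := hcon i hi; tauto))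
      rw [hcard, nsmul_eq_mul] at this
      push_cast at this
      nlinarith
    simp only [hS, Finset.mem_erase] at hj
    have hi : ∃ i, i ≠ j ∧ (b x (a i) = 5 ∨ b x (a i) = 7) := by
      by_cases aa : 5 ≤ b x (a 0)
      · exact ⟨0, hj.2.1.symm, by omega⟩
      · exact ⟨1, hj.1.symm, by omega⟩
    obtain ⟨i, hij, hi⟩ := hi
    rcases hi with aa | aa <;> rcases hj0 with ab | ab
    · exact H.half_get F hij 1 (by norm_num) (by omega)
    · exact H.half_get F hij (-1) (by norm_num) (by omega)
    · exact H.half_get F hij (-1) (by norm_num) (by omega)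
    · exact H.half_get F hij 1 (by norm_num) (by omega)
theorem orb5 {u af w bf : L} (hu : b u u = 4) (bb : b af af = 4) (h : b u af = 1)
    (hw : b w w = 4) (bz : b bf bf = 4) (ai : b w bf = 1) : Orb b (u + af) (w + bf) := by
  obtain ⟨v, hv, aa⟩ := H.can5 hu bb h
  obtain ⟨cj, bq, ct⟩ := H.can5 hw bz ai
  have ah : b (u + af) (u + af) = 10 := by rw [H.add2, hu, bb, h]; rfl
  have aj : b (w + bf) (w + bf) = 10 := by rw [H.add2, hw, bz, ai]; rfl
  generalize u + af = x at *
  generalize w + bf = y at *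
  refine H.orb1 hv bq ?_ ?_ (e := -1) (by norm_num) ?_ ?_
  · rw [H.sub2, ah, aa, hv]; rfl
  · rw [H.sub2, aj, ct, bq]; rfl
  · rw [map_sub, LinearMap.sub_apply, aa, hv]; rfl
  · rw [map_sub, LinearMap.sub_apply, ct, bq]; rfl
include F in
theorem move {s : L} (hs : b s s = 6) (hp : ∀ i, b s (a i) = if i = 0 then 5 else 1)
    {i j : FT} (hi : i ≠ 0) (hj : j ≠ 0) (hij : i ≠ j) :
    ∃ ad , Fr b ad ∧ (∀ i, b s (ad i) = if i = 0 then 5 else 1) ∧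
      ∀ y, 2 * b y (ad 0) = 2 * b y s - (b y (a i) + b y (a j)) := by
  obtain ⟨w, -, hw, hwy⟩ := H.half F i j 1 (by norm_num) hij
  have aa := hwy s
  rw [hp, hp, if_neg hi, if_neg hj] at aa
  obtain ⟨ad, am, ab, ae⟩ := H.c3 hs hw (by omega)
  refine ⟨ad, am, ae, fun y => ?_⟩
  have := hwy y
  rw [ab, map_sub]; omega
include F in
theorem sumS {s y : L} (hp : ∀ i, b s (a i) = if i = 0 then 5 else 1) :
    ∑ i ∈ (Finset.univ : SF).erase 0, b y (a i) = 8 * b s y - 5 * b y (a 0) := by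
  have := H.sum0 F s y
  rw [hp 0, if_pos rfl] at this
  rw [← this]
  exact scg fun i hi => by rw [hp, if_neg (er_mem.1 hi), one_mul]
include F in
theorem t7A {s u : L} (hp : ∀ i, b s (a i) = if i = 0 then 5 else 1) (hu : b u u = 4)
    (h : b s u = 2) (ab : 2 ≤ b u (a 0)) : ∃ v, b v v = 4 ∧ b (s + u) v = 5 := by
  have bh := H.sumS F (y := u) hp
  have az := H.sum0 F u u
  rw [h] at bh; rw [hu] at az
  have key : ∃ i, i ≠ 0 ∧ (b u (a i) = 4 - b u (a 0) ∨ b u (a i) = b u (a 0) - 6) := by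
    by_contra! hcon
    have hr := H.coord_le F (x := u) (n := 5) (by norm_num) (by omega)
    have hp := fun i => par F u i 0
    have hr0 := (hr 0).2
    have : b u (a 0) = 2 ∨ b u (a 0) = 3 ∨ b u (a 0) = 4 ∨ b u (a 0) = 5 := by omega
    rcases this with ag | ag | ag | ag <;> rw [ag] at bh az hcon hp
    · have : (12:ℤ) ∣ ∑ i ∈ (Finset.univ : SF).erase 0,
          (b u (a i) * b u (a i) - 4 * b u (a i)) := by
        refine Finset.dvd_sum fun i hi => ?_
        have aa := hcon i (er_mem.1 hi)
        have ab := hr i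
        have ae := hp i
        have : b u (a i) = 0 ∨ b u (a i) = 4 ∨ b u (a i) = -2 := by omega
        rcases this with h | h | h <;> rw [h] <;> norm_num
      rw [Finset.sum_sub_distrib, ← Finset.mul_sum, bh, az] at this
      norm_num at this
    · have : (0:ℤ) ≤ ∑ i ∈ (Finset.univ : SF).erase 0,
          (b u (a i) * b u (a i) - 2 * b u (a i) - 3) := by
        refine Finset.sum_nonneg fun i hi => ?_
        have aa := hcon i (er_mem.1 hi)
        have ae := hp i
        have : b u (a i) ≤ -1 ∨ 3 ≤ b u (a i) := by omega
        rcases this with h | h <;> nlinarith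
      rw [Finset.sum_sub_distrib, Finset.sum_sub_distrib, ← Finset.mul_sum, bh, az,
        Finset.sum_const, card_er] at this
      norm_num at this
    · have := Finset.card_nsmul_le_sum (Finset.univ.erase 0) (fun i => b u (a i) * b u (a i)) 4
        (fun i hi => ev_sq (by have := hp i; omega) (by have := hcon i (er_mem.1 hi); omega))
      rw [card_er, az] at this
      norm_num at this
    · have := Finset.card_nsmul_le_sum (Finset.univ.erase 0) (fun i => b u (a i) * b u (a i)) 1
        (fun i hi => odd_sq (by have := hp i; omega))
      rw [card_er, az] at this
      norm_num at this
  obtain ⟨i, hi, ae⟩ := key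
  have bl : b (s + u) (a 0) = 5 + b u (a 0) := by
    rw [map_add, LinearMap.add_apply, hp, if_pos rfl]
  have ei : b (s + u) (a i) = 1 + b u (a i) := by
    rw [map_add, LinearMap.add_apply, hp, if_neg hi]
  rcases ae with ae | ae
  · exact H.half_get F hi.symm 1 (by norm_num) (by rw [bl, ei]; omega)
  · exact H.half_get F hi.symm (-1) (by norm_num) (by rw [bl, ei]; omega)
theorem can7 {s u : L} (hs : b s s = 6) (hu : b u u = 4)
    (h : b s u = 2) : ∃ v, b v v = 4 ∧ b (s + u) v = 5 := by
  obtain ⟨a, F, hp⟩ := H.c3' hs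
  by_cases ab : 2 ≤ b u (a 0)
  · exact H.t7A F hp hu h ab
  have bh := H.sumS F (y := u) hp
  have az := H.sum0 F u u
  rw [h] at bh; rw [hu] at az
  have hpar := fun i => par F u i 0
  obtain ⟨i, hi, hi0⟩ : ∃ i, i ≠ 0 ∧ b u (a i) ≤ 0 := by
    by_contra! hcon
    rcases Int.emod_two_eq_zero_or_one (b u (a 0)) with ag | ag
    · have := Finset.card_nsmul_le_sum (Finset.univ.erase 0) (fun i => b u (a i) * b u (a i)) 4
        (fun i hi => ev_sq (by have := hpar i; omega) (by have := hcon i (er_mem.1 hi); omega))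
      rw [card_er, az] at this
      norm_num at this
      nlinarith [mul_self_nonneg (b u (a 0))]
    · have ae := Finset.card_nsmul_le_sum (Finset.univ.erase 0) (fun i => b u (a i)) 1
        (fun i hi => by have := hcon i (er_mem.1 hi); omega)
      have al : ∑ i ∈ (Finset.univ : SF).erase 0, b u (a i) ≤
          ∑ i ∈ (Finset.univ : SF).erase 0, b u (a i) * b u (a i) :=
        Finset.sum_le_sum fun i hi => by
          have := hcon i (er_mem.1 hi); nlinarith
      rw [card_er, bh] at ae
      rw [bh, az] at al
      norm_num at ae
      have : b u (a 0) ≤ -3 := by omega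
      nlinarith
  obtain ⟨j, hj, hij, hj0⟩ : ∃ j, j ≠ 0 ∧ i ≠ j ∧ b u (a i) + b u (a j) ≤ 0 := by
    by_contra! hcon
    have ae := Finset.card_nsmul_le_sum ((Finset.univ.erase 0).erase i)
      (fun i => b u (a i) * b u (a i)) 4 (fun k hk => by
        rw [Finset.mem_erase, er_mem] at hk
        have aa := hcon k hk.2 hk.1.symm
        have ab := hpar i
        have ae := hpar k
        have : 2 ≤ b u (a k) := by omega
        nlinarith)
    rw [Finset.card_erase_of_mem (er_mem.2 hi), card_er] at ae
    have al := Finset.add_sum_erase _ (fun i => b u (a i) * b u (a i)) (er_mem.2 hi)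
    rw [az] at al
    norm_num at ae
    nlinarith [mul_self_nonneg (b u (a 0)), mul_self_nonneg (b u (a i))]
  obtain ⟨ad, am, cu, hy⟩ := H.move F hs hp hi hj hij
  refine H.t7A am cu hu h ?_
  have := hy u
  rw [H.symm u s, h] at this
  omega
theorem orb7 {s u t w : L} (hs : b s s = 6) (hu : b u u = 4) (h : b s u = 2)
    (ht : b t t = 6) (hw : b w w = 4) (ai : b t w = 2) : Orb b (s + u) (t + w) := by
  obtain ⟨v, hv, aa⟩ := H.can7 hs hu h
  obtain ⟨cj, bq, ct⟩ := H.can7 ht hw ai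
  have ah : b (s + u) (s + u) = 14 := by rw [H.add2, hu, hs, h]; rfl
  have aj : b (t + w) (t + w) = 14 := by rw [H.add2, hw, ht, ai]; rfl
  generalize s + u = x at *
  generalize t + w = y at *
  refine H.orb1 hv bq ?_ ?_ (e := 1) (by norm_num) ?_ ?_
  · rw [H.sub2, ah, aa, hv]; rfl
  · rw [H.sub2, aj, ct, bq]; rfl
  · rw [map_sub, LinearMap.sub_apply, aa, hv]; rfl
  · rw [map_sub, LinearMap.sub_apply, ct, bq]; rfl
end LL
end latt8
section latt9
variable {L : Type} [AddCommGroup L] {b : BL L}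
def S3 (b : BL L) (x : L) : Prop := ∀ w, 2 * b x w ≤ 3 * b w w
def sup2 (b : BL L) (a : FT → L) (x : L) : SF :=
  Finset.univ.filter fun i => b x (a i) % 4 = 2
theorem mem_sup2 {a : FT → L} {x : L} {i : FT} : i ∈ sup2 b a x ↔ b x (a i) % 4 = 2 := by
  simp [sup2]
namespace LL
variable (H : LL b) {a ad : FT → L} (F : Fr b a) (am : Fr b ad)
theorem sup2_cd {x : L} (hp : ∀ i, b x (a i) % 2 = 0) : Cd b a (sup2 b a x) :=
  ⟨x, fun i => by
    have := hp i
    simp only [mem_sup2]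
    split_ifs <;> omega⟩
include H
theorem S3_isom {x : L} (h : S3 b x) {σ : EL L} (hσ : Isom b σ) : S3 b (σ x) := by
  intro w
  obtain ⟨τ, -, -, ae⟩ := H.isom_inv hσ
  rw [← ae w, hσ, hσ]
  exact h _
include F in
theorem sup2_le (x : L) : 4 * ((sup2 b a x).card : ℤ) ≤ ∑ i ∈ sup2 b a x, b x (a i) * b x (a i) := by
  have := Finset.card_nsmul_le_sum (sup2 b a x) (fun i => b x (a i) * b x (a i)) 4
    (fun i hi => by rw [mem_sup2] at hi; exact ev_sq (by omega) (by omega))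
  rw [nsmul_eq_mul] at this
  linarith
theorem can622 {u af : L} (hu : b u u = 4) (bb : b af af = 4) (h : b u af = 2) :
    ∃ a, Fr b a ∧ (2:ℤ) • u = a 0 + a 1 ∧ (2:ℤ) • af = a 0 + a 2 := by
  obtain ⟨z, hz, huz, huz'⟩ : ∃ z, b z z = 4 ∧ b u z = 0 ∧ b af z = 2 := by
    obtain ⟨w, hw, aa, ab⟩ := H.ex_perp u af hu.le bb.le
    obtain ⟨a, F, cs, bx⟩ := H.uframe hu hw aa
    have c0 : b af (a 0) = 2 := by rw [cs, map_add, H.symm af u, h, ab]; rfl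
    have bn : b af (a 1) = 2 := by rw [bx, map_sub, H.symm af u, h, ab]; rfl
    have hp : ∀ i, b af (a i) % 2 = 0 := fun i => by have := par F af i 0; omega
    have h0T : (0 : FT) ∈ sup2 b a af := by rw [mem_sup2, c0]; rfl
    have ao := H.cd_ge8 F (sup2_cd hp) ⟨0, h0T⟩
    have hle : ∑ i ∈ sup2 b a af, b af (a i) * b af (a i) ≤ ∑ i, b af (a i) * b af (a i) :=
      Finset.sum_le_univ_sum_of_nonneg (fun i => mul_self_nonneg _)
    rw [← H.sum8 F, bb] at hle
    have hT2 : ∀ i ∈ sup2 b a af, b af (a i) = 2 ∨ b af (a i) = -2 := by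
      intro i hi
      have aa := sum1 (sup2 b a af) (fun i => b af (a i) * b af (a i)) 4
        (fun i hi => by rw [mem_sup2] at hi; exact ev_sq (by omega) (by omega)) hi
      have := zsq_le (x := b af (a i)) (n := 2) (by norm_num) (by omega)
      have := mem_sup2.1 hi
      omega
    obtain ⟨i, hi, j, hj, hij⟩ := (Finset.one_lt_card (s := ((sup2 b a af).erase 0).erase 1)).1 (by
      have aa := Finset.pred_card_le_card_erase (s := (sup2 b a af).erase 0) (a := 1)
      have ab := Finset.pred_card_le_card_erase (s := sup2 b a af) (a := 0)
      omega)
    simp only [Finset.mem_erase] at hi hj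
    have key : ∃ e f : ℤ, (e = 1 ∨ e = -1) ∧ (f = 1 ∨ f = -1) ∧
        f * (b af (a i) + e * b af (a j)) = 4 := by
      rcases hT2 i hi.2.2 with h | h <;> rcases hT2 j hj.2.2 with ai | ai <;> rw [h, ai]
      · exact ⟨1, 1, by norm_num⟩
      · exact ⟨-1, 1, by norm_num⟩
      · exact ⟨-1, -1, by norm_num⟩
      · exact ⟨1, -1, by norm_num⟩
    obtain ⟨e, f, he, hf, hef⟩ := key
    obtain ⟨bf, -, bz, hwy⟩ := H.half F i j e he hij
    refine ⟨f • bf, ?_, ?_, ?_⟩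
    · rw [smul2, bz]; rcases hf with h | h <;> rw [h] <;> rfl
    · have bl := hwy (a 0)
      have ah := hwy (a 1)
      rw [F.ne hi.2.1.symm, F.ne hj.2.1.symm] at bl
      rw [F.ne hi.1.symm, F.ne hj.1.symm] at ah
      have : b (a 0 + a 1) bf = 0 := by rw [map_add, LinearMap.add_apply]; omega
      have e : a 0 + a 1 = (2:ℤ) • u := by rw [cs, bx]; module
      rw [e, map_smul, LinearMap.smul_apply, smul_eq_mul] at this
      rw [map_smul, smul_eq_mul]
      have : b u bf = 0 := by omega
      rw [this, mul_zero]
    · rw [map_smul, smul_eq_mul]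
      have := hwy af
      rw [← this] at hef
      linarith
  obtain ⟨a, F, cs, bx⟩ := H.uframe hu hz huz
  have c0 : b af (a 0) = 4 := by rw [cs, map_add, H.symm af u, h, huz']; rfl
  have bn : b af (a 1) = 0 := by rw [bx, map_sub, H.symm af u, h, huz']; rfl
  have hp : ∀ i, b af (a i) % 2 = 0 := fun i => by have := par F af i 0; omega
  have az := H.sum0 F af af
  rw [bb, c0] at az
  have hemp : ∀ i, b af (a i) % 4 = 0 := by
    intro i
    by_contra hi
    have hiT : i ∈ sup2 b a af := by rw [mem_sup2]; have := hp i; omega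
    have ao := H.cd_ge8 F (sup2_cd hp) ⟨i, hiT⟩
    have aa := H.sup2_le F af
    have ab : ∑ i ∈ sup2 b a af, b af (a i) * b af (a i) ≤
        ∑ i ∈ (Finset.univ : SF).erase 0, b af (a i) * b af (a i) :=
      Finset.sum_le_sum_of_subset_of_nonneg (fun i hi => by
        rw [er_mem]; rintro rfl; rw [mem_sup2, c0] at hi; norm_num at hi)
        (fun i _ _ => mul_self_nonneg _)
    omega
  obtain ⟨j, hj, hj0⟩ : ∃ j, j ≠ 0 ∧ b af (a j) ≠ 0 := by
    by_contra! hcon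
    rw [Finset.sum_congr rfl (fun i hi => by rw [hcon i (er_mem.1 hi), mul_zero])] at az
    simp at az
  have hj1 : j ≠ 1 := by rintro rfl; exact hj0 bn
  have hj16 : 16 ≤ b af (a j) * b af (a j) := by
    have := hemp j
    have : b af (a j) ≤ -4 ∨ 4 ≤ b af (a j) := by omega
    rcases this with h | h <;> nlinarith
  have hj4 : b af (a j) = 4 ∨ b af (a j) = -4 := by
    have aa := sum1 (Finset.univ.erase 0) (fun i => b af (a i) * b af (a i)) 0
      (fun i _ => mul_self_nonneg _) (er_mem.2 hj)
    have := zsq_le (x := b af (a j)) (n := 4) (by norm_num) (by omega)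
    have := hemp j
    omega
  have hoth : ∀ i, i ≠ 0 → i ≠ j → b af (a i) = 0 := by
    intro i hi hij
    have aa := sum2 (Finset.univ.erase 0) (fun i => b af (a i) * b af (a i)) 0
      (fun i _ => mul_self_nonneg _) (er_mem.2 hj) (er_mem.2 hi) hij
    have := zsq_le (x := b af (a i)) (n := 0) (by norm_num) (by omega)
    omega
  obtain ⟨e, he, hje⟩ : ∃ e : ℤ, (e = 1 ∨ e = -1) ∧ b af (a j) = 4 * e := by
    rcases hj4 with h | h
    · exact ⟨1, by norm_num, by omega⟩
    · exact ⟨-1, by norm_num, by omega⟩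
  have h2u' : (2:ℤ) • af = a 0 + e • a j := by
    apply H.ext F
    intro i
    rw [map_smul, map_add, map_smul, LinearMap.smul_apply, LinearMap.add_apply,
      LinearMap.smul_apply, F.orth, F.orth, smul_eq_mul, smul_eq_mul]
    by_cases hi : i = 0
    · subst hi; rw [c0, if_pos rfl, if_neg hj]; norm_num
    · by_cases hij : i = j
      · subst hij; rw [hje, if_neg (Ne.symm hi), if_pos rfl]; ring
      · rw [hoth i hi hij, if_neg (Ne.symm hi), if_neg (Ne.symm hij)]; ring
  obtain ⟨p, bs, aw, ba⟩ := perm3 (show (0 : FT) ≠ 1 by decide) hj.symm hj1.symm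
  refine ⟨_, (F.reindex p).resign (fun i => if i = 2 then e else 1) (fun i => ?_), ?_, ?_⟩
  · by_cases hi : i = 2 <;> simp [hi, he]
  · simp [bs, aw, cs, bx, two_smul]
  · simp [bs, ba, h2u']
theorem orb622 {u af w bf : L} (hu : b u u = 4) (bb : b af af = 4) (h : b u af = 2)
    (hw : b w w = 4) (bz : b bf bf = 4) (ai : b w bf = 2) : Orb b (u + af) (w + bf) := by
  obtain ⟨a, F, aa, ab⟩ := H.can622 hu bb h
  obtain ⟨ad, am, ct, h2'⟩ := H.can622 hw bz ai
  obtain ⟨σ, ap, ar, -⟩ := H.main5 F am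
  refine ⟨σ, ap, H.smul_inj two_ne_zero ?_⟩
  rw [← map_smul, smul_add, smul_add, aa, ab, ct, h2']
  simp only [map_add]
  rw [ar 0 (by norm_num), ar 1 (by norm_num), ar 2 (by norm_num)]
theorem can632 (F : Fr b a) {x y : L} (hx : x = a 0 + (2:ℤ) • y)
    (h : ∀ i, b x (a i) = 2 ∨ b x (a i) = -2) :
    ∃ a v, Fr b a ∧ x = a 0 + (2:ℤ) • v ∧ b v (a 0) = -3 ∧ ∀ i, i ≠ 0 → b v (a i) = 1 ∨ b v (a i) = -1 := by
  have hi : ∀ i, b x (a i) = (if i = 0 then 8 else 0) + 2 * b y (a i) := by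
    intro i
    rw [hx, map_add, LinearMap.add_apply, map_smul, LinearMap.smul_apply, F.orth, smul_eq_mul]
    simp only [eq_comm]
  rcases h 0 with ag | ag
  · refine ⟨a, y, F, hx, ?_, fun i aa => ?_⟩
    · have := hi 0; rw [if_pos rfl] at this; omega
    · have := hi i; rw [if_neg aa] at this; have := h i; omega
  · refine ⟨_, y + a 0, F.resign (fun i => if i = 0 then -1 else 1) (fun i => ?_), ?_, ?_, fun i aa => ?_⟩
    · by_cases h : i = 0 <;> simp [h]
    · rw [hx]; simp only [if_true]; module
    · have := hi 0; rw [if_pos rfl] at this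
      simp only [if_true, map_smul, map_add, LinearMap.add_apply, F.self, smul_eq_mul]; omega
    · have := hi i; rw [if_neg aa] at this; have := h i
      simp only [aa, if_false, one_smul, map_add, LinearMap.add_apply, F.ne (Ne.symm aa)]; omega
theorem orb632 {x au v cj : L} (F : Fr b a) (am : Fr b ad) (hx : x = a 0 + (2:ℤ) • v)
    (hv : b v (a 0) = -3) (h : ∀ i, i ≠ 0 → b v (a i) = 1 ∨ b v (a i) = -1)
    (hx' : au = ad 0 + (2:ℤ) • cj) (bq : b cj (ad 0) = -3)
    (ai : ∀ i, i ≠ 0 → b cj (ad i) = 1 ∨ b cj (ad i) = -1) : Orb b x au := by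
  have key : ∀ {v : L} {a : FT → L}, b v (a 0) = -3 →
      (∀ i, i ≠ 0 → b v (a i) = 1 ∨ b v (a i) = -1) → ∀ i, b v (a i) = (if i = 0 then 3 else 1) ∨
      b v (a i) = -(if i = 0 then 3 else 1) := by
    intro v a aa ab i
    by_cases hi : i = 0
    · subst hi; right; rw [aa]; rfl
    · simp only [hi, if_false]; exact ab i hi
  obtain ⟨σ, ap, ar, be⟩ := H.patOrb F am (fun i => if i = 0 then 3 else 1) (by
    intro i j hi hj
    rw [if_neg (by rintro rfl; simp at hi), if_neg (by rintro rfl; simp at hj)])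
    (by rw [hv]; rfl) (key hv h) (key bq ai)
  exact ⟨σ, ap, by rw [hx, hx', map_add, map_smul, ar, be 0 (by norm_num) (by rw [hv, bq])]⟩
theorem can8 (F : Fr b a) {x y : L} (hn : b x x = 16) (hx : x = a 0 + (2:ℤ) • y)
    (h : ∀ i, b x (a i) = 0 ∨ b x (a i) = 4 ∨ b x (a i) = -4) :
    ∃ a, Fr b a ∧ (∀ i, b x (a i) = 0 ∨ b x (a i) = 4 ∨ b x (a i) = -4) ∧
      (∀ i : FT, i.1 < 5 → b x (a i) ≠ 0) ∧
      ∀ i, b y (a i) % 4 = if b x (a i) = 0 then 0 else 2 := by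
  have hi : ∀ i, b x (a i) = (if i = 0 then 8 else 0) + 2 * b y (a i) := by
    intro i
    rw [hx, map_add, LinearMap.add_apply, map_smul, LinearMap.smul_apply, F.orth, smul_eq_mul]
    simp only [eq_comm]
  have ay : 5 ≤ (Finset.univ.filter fun i => b x (a i) ≠ 0).card := by
    have ao := H.sum8 F x x
    have aa := cnt Finset.univ (fun i => - (b x (a i) * b x (a i))) (fun i => b x (a i) ≠ 0) 0 (-16)
      (fun i _ hi => by simp only [not_not] at hi; rw [hi]; norm_num)
      (fun i _ _ => by rcases h i with h | h | h <;> rw [h] <;> norm_num)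
    rw [Finset.sum_neg_distrib] at aa
    omega
  obtain ⟨p, hp⟩ := perm50 ay
  refine ⟨_, F.reindex p, fun i => h _, fun i hi5 => ?_, fun i => ?_⟩
  · simpa using hp i hi5
  · have aa := hi (p i)
    have ab := h (p i)
    split_ifs at aa ⊢ <;> omega
theorem par8 (F : Fr b a) {x : L} (hn : b x x = 16) (hS : S3 b x)
    (h : ∀ i, b x (a i) = 0 ∨ b x (a i) = 4 ∨ b x (a i) = -4) {O : SF}
    (hO : ∀ i, i ∈ O ↔ b x (a i) ≠ 0) (hC : Cd b a O) :
    ∃ X, ∀ i, 2 * b X (a i) = b x (a i) + if i = 0 then 8 else 0 := by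
  have hh : ∀ i, ∃ c, b x (a i) = 2 * c := fun i => ⟨b x (a i) / 2, by have := h i; omega⟩
  choose c hc using hh
  obtain ⟨X, e, he, hX⟩ := H.near F hC c (fun i => by
    have aa := hc i
    have ab := h i
    have ae := hO i
    split_ifs with al
    · rw [ae] at al; omega
    · rw [ae] at al; omega) 0
  rcases he with rfl | rfl
  · exfalso
    have hX' : ∀ i, b x (a i) = 2 * b X (a i) := fun i => by
      rw [hX, hc]; split_ifs <;> ring
    have hxX : x = (2:ℤ) • X := H.ext F fun i => by
      rw [hX', map_smul, LinearMap.smul_apply, smul_eq_mul]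
    have aa := hS X
    rw [hxX, smul2] at hn
    rw [hxX, map_smul, LinearMap.smul_apply, smul_eq_mul] at aa
    omega
  · refine ⟨X, fun i => ?_⟩
    rw [hX, hc]; split_ifs <;> ring
theorem orb8 {x au y y' : L} (hn : b x x = 16) (hS : S3 b x) (hn' : b au au = 16) (ce : S3 b au)
    (F : Fr b a) (am : Fr b ad)
    (h : ∀ i, b x (a i) = 0 ∨ b x (a i) = 4 ∨ b x (a i) = -4)
    (ay : ∀ i : FT, i.1 < 5 → b x (a i) ≠ 0)
    (hy : ∀ i, b y (a i) % 4 = if b x (a i) = 0 then 0 else 2)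
    (ai : ∀ i, b au (ad i) = 0 ∨ b au (ad i) = 4 ∨ b au (ad i) = -4)
    (h5' : ∀ i : FT, i.1 < 5 → b au (ad i) ≠ 0)
    (hy' : ∀ i, b y' (ad i) % 4 = if b au (ad i) = 0 then 0 else 2) : Orb b x au := by
  obtain ⟨σ, t, ap, ar, be⟩ := H.main5' F am
  have tr : ∀ z l, b (σ z) (ad (t l)) = b z (a l) ∨ b (σ z) (ad (t l)) = - b z (a l) := by
    intro z l
    rw [← ap z (a l)]
    rcases be l with h | h <;> rw [h]
    · exact Or.inl rfl
    · right; rw [map_neg, neg_neg]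
  refine Orb.trans ⟨σ, ap, rfl⟩ ?_
  have g : ∀ i, b (σ x) (ad i) = 0 ∨ b (σ x) (ad i) = 4 ∨ b (σ x) (ad i) = -4 := by
    intro i
    obtain ⟨l, rfl⟩ := t.surjective i
    have := tr x l; have := h l; omega
  have g5 : ∀ i : FT, i.1 < 5 → b (σ x) (ad i) ≠ 0 := by
    intro i hi
    rw [← (ar i hi).1, ap]; exact ay i hi
  have gy : ∀ i, b (σ y) (ad i) % 4 = if b (σ x) (ad i) = 0 then 0 else 2 := by
    intro i
    obtain ⟨l, rfl⟩ := t.surjective i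
    have aa := tr x l; have ab := tr y l; have ae := hy l
    split_ifs at ae ⊢ <;> omega
  have gn : b (σ x) (σ x) = 16 := by rw [ap, hn]
  have gS := H.S3_isom hS ap
  generalize σ x = z at *
  generalize σ y = w at *
  have hcard : ∀ {z w : L}, b z z = 16 → (∀ i, b z (ad i) = 0 ∨ b z (ad i) = 4 ∨ b z (ad i) = -4) →
      (∀ i, b w (ad i) % 4 = if b z (ad i) = 0 then 0 else 2) →
      Cd b ad (Finset.univ.filter fun i => b z (ad i) ≠ 0) ∧
      (Finset.univ.filter fun i => b z (ad i) ≠ 0).card = 8 := by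
    intro z w hn h hw
    refine ⟨⟨w, fun i => ?_⟩, ?_⟩
    · rw [hw]; by_cases hi : b z (ad i) = 0 <;> simp [hi]
    · have ao := H.sum8 am z z
      have : ∑ i, b z (ad i) * b z (ad i) = ∑ i, if b z (ad i) ≠ 0 then 16 else 0 :=
        scg fun i _ => by rcases h i with h | h | h <;> rw [h] <;> rfl
      rw [this, ← Finset.sum_filter, Finset.sum_const, nsmul_eq_mul] at ao
      omega
  obtain ⟨C1, bn⟩ := hcard gn g gy
  obtain ⟨C2, co⟩ := hcard hn' ai hy'
  set bj := Finset.univ.filter fun i => b z (ad i) ≠ 0 with cp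
  set cf := Finset.univ.filter fun i => b au (ad i) ≠ 0 with hO2
  have hO : bj = cf := by
    refine H.octad_unique am C1 C2 bn co ?_
    have : (Finset.univ.filter fun i : FT => i.1 < 5) ⊆ bj ∩ cf := by
      intro i hi
      simp only [Finset.mem_filter, Finset.mem_univ, true_and] at hi
      simp [cp, hO2, g5 i hi, h5' i hi]
    refine le_trans ?_ (Finset.card_le_card this)
    decide
  have cv : ∀ i, i ∈ cf ↔ b z (ad i) ≠ 0 := fun i => by rw [← hO]; simp [cp]
  have cw : ∀ i, i ∈ cf ↔ b au (ad i) ≠ 0 := fun i => by simp [hO2]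
  obtain ⟨X, hX⟩ := H.par8 am gn gS g cv C2
  obtain ⟨ck, hX'⟩ := H.par8 am hn' ce ai cw C2
  set χ := Finset.univ.filter fun i => b z (ad i) ≠ b au (ad i) with hχ
  have hχO : χ ⊆ cf := by
    intro i hi
    by_contra hn
    have ah : b z (ad i) = 0 := by have := cv i; tauto
    have aj : b au (ad i) = 0 := by have := cw i; tauto
    simp [hχ, ah, aj] at hi
  have hv : ∀ i, b (X - ck) (ad i) = 0 ∧ i ∉ χ ∨
      (b (X - ck) (ad i) = 4 ∨ b (X - ck) (ad i) = -4) ∧ i ∈ χ := by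
    intro i
    have ah := hX i; have aj := hX' i
    rw [map_sub, LinearMap.sub_apply]
    have ae : i ∈ χ ↔ b z (ad i) ≠ b au (ad i) := by simp [hχ]
    rw [ae]
    have aa := g i; have ab := ai i
    have cv := cv i; have cw := cw i
    rw [cv] at cw
    split_ifs at ah aj <;> omega
  have hev : χ.card % 2 = 0 := by
    have al := H.mod4n am (x := X - ck) (fun i => by have := hv i; omega)
    have ao := H.sum8 am (X - ck) (X - ck)
    have : ∑ i, b (X - ck) (ad i) * b (X - ck) (ad i) = ∑ i, if i ∈ χ then 16 else 0 :=
      scg fun i _ => by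
        rcases hv i with ⟨h, ai⟩ | ⟨h | h, ai⟩ <;> rw [h] <;> simp [ai]
    rw [this, Finset.sum_ite_mem, Finset.univ_inter, Finset.sum_const, nsmul_eq_mul] at ao
    omega
  obtain ⟨c, hc, hcS⟩ := H.duality am (S := cf) (χ := χ) hχO (by
    intro d hd hdS
    rcases d.eq_empty_or_nonempty with rfl | hne
    · simp
    · have := H.cd_ge8 am hd hne
      have : d = cf := Finset.eq_of_subset_of_card_le hdS (by omega)
      rw [this, Finset.inter_eq_right.2 hχO]; exact hev)
  obtain ⟨τ, bm, t2, -⟩ := H.sgn am hc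
  refine ⟨τ, bm, H.ext am fun i => ?_⟩
  rw [t2]
  by_cases hi : i ∈ cf
  · have ae : i ∈ c ↔ b z (ad i) ≠ b au (ad i) := by
      have : i ∈ c ∩ cf ↔ i ∈ χ := by rw [hcS]
      simpa [hi, hχ] using this
    have ah := (cv i).1 hi; have aj := (cw i).1 hi
    have := g i; have := ai i
    split_ifs with al
    · rw [ae] at al; omega
    · rw [ae] at al; omega
  · have ah : b z (ad i) = 0 := by have := cv i; tauto
    have aj : b au (ad i) = 0 := by have := cw i; tauto
    rw [ah, aj, mul_zero]
end LL
end latt9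
section latt10
variable {L : Type} [AddCommGroup L] {b : BL L} {a ad : FT → L}
theorem two_of (f : FT → ℤ) (P : FT → Prop) (c d : ℤ) (hcd : d ≤ c)
    (aa : ∀ i, i ≠ 0 → ¬ P i → c ≤ f i) (ab : ∀ i, i ≠ 0 → P i → d ≤ f i)
    (hlt : ∑ i ∈ Finset.univ.erase 0, f i < c * 22 + d) :
    ∃ i j, i ≠ 0 ∧ j ≠ 0 ∧ i ≠ j ∧ P i ∧ P j := by
  classical
  have h := cnt (Finset.univ.erase 0) f P c d (fun i hi => aa i (er_mem.1 hi))
    (fun i hi => ab i (er_mem.1 hi))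
  rw [card_er] at h
  have ae : 1 < (Finset.filter P (Finset.univ.erase 0)).card := by
    by_contra hc
    have al : ((Finset.filter P (Finset.univ.erase 0)).card : ℤ) ≤ 1 := by exact_mod_cast not_lt.1 hc
    push_cast at h
    nlinarith
  obtain ⟨i, hi, j, hj, hij⟩ := Finset.one_lt_card.1 ae
  rw [Finset.mem_filter, er_mem] at hi hj
  exact ⟨i, j, hi.1, hj.1, hij, hi.2, hj.2⟩
def c9 (i : FT) : ℤ := if i = 0 then 9 else if i.1 < 6 then 3 else 1
namespace LL
variable (H : LL b)
include H
theorem can9 {s ak : L} (hs : b s s = 6) (bv : b ak ak = 6) (h : b s ak = 3) :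
    ∃ a, Fr b a ∧ b (s + ak) (a 0) = 9 ∧
      ∀ i, b (s + ak) (a i) = c9 i ∨ b (s + ak) (a i) = - c9 i := by
  have ai : b ak s = 3 := by rw [H.symm, h]
  have SS : ∀ {a : FT → L}, Fr b a → (∀ i, b s (a i) = if i = 0 then 5 else 1) →
      ∑ i ∈ Finset.univ.erase 0, b ak (a i) = 24 - 5 * b ak (a 0) ∧
      ∑ i ∈ Finset.univ.erase 0, b ak (a i) * b ak (a i) = 48 - b ak (a 0) * b ak (a 0) := by
    intro a F hp
    have bh := H.sumS F (y := ak) hp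
    have az := H.sum0 F ak ak
    rw [h] at bh; rw [bv] at az
    exact ⟨bh, az⟩
  obtain ⟨a, F, hp, ag⟩ : ∃ a, Fr b a ∧ (∀ i, b s (a i) = if i = 0 then 5 else 1) ∧ 2 ≤ b ak (a 0) := by
    obtain ⟨a, F, hp⟩ := H.c3' hs
    by_cases ag : 2 ≤ b ak (a 0)
    · exact ⟨a, F, hp, ag⟩
    obtain ⟨bh, az⟩ := SS F hp
    obtain ⟨i, j, hi, hj, hij, aa, ab⟩ := two_of (fun i => b ak (a i) * b ak (a i))
      (fun i => b ak (a i) ≤ 1) 4 0 (by norm_num) (fun i _ h => by nlinarith)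
      (fun i _ _ => mul_self_nonneg _) (by nlinarith [mul_self_nonneg (b ak (a 0))])
    obtain ⟨ad, am, cu, hy⟩ := H.move F hs hp hi hj hij
    refine ⟨ad, am, cu, ?_⟩
    have := hy ak
    omega
  obtain ⟨a, F, hp, ag⟩ : ∃ a, Fr b a ∧ (∀ i, b s (a i) = if i = 0 then 5 else 1) ∧
      (b ak (a 0) = 4 ∨ b ak (a 0) % 2 = 1 ∧ 3 ≤ b ak (a 0)) := by
    by_cases aa : b ak (a 0) = 4 ∨ b ak (a 0) % 2 = 1 ∧ 3 ≤ b ak (a 0)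
    · exact ⟨a, F, hp, aa⟩
    obtain ⟨bh, az⟩ := SS F hp
    have hpar := fun i => par F ak i 0
    obtain ⟨i, j, hi, hj, hij, aa, ab⟩ := two_of (fun i => b ak (a i) * b ak (a i))
      (fun i => b ak (a i) = 0) 4 0 (by norm_num) (fun i _ h => ev_sq (by have := hpar i; omega) h)
      (fun i _ _ => mul_self_nonneg _) (by nlinarith [mul_self_nonneg (b ak (a 0))])
    obtain ⟨ad, am, cu, hy⟩ := H.move F hs hp hi hj hij
    refine ⟨ad, am, cu, ?_⟩
    have := hy ak
    omega
  obtain ⟨a, F, hp, ag⟩ : ∃ a, Fr b a ∧ (∀ i, b s (a i) = if i = 0 then 5 else 1) ∧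
      b ak (a 0) = 4 := by
    rcases ag with ag | ⟨ag, aa⟩
    · exact ⟨a, F, hp, ag⟩
    obtain ⟨bh, az⟩ := SS F hp
    have hpar := fun i => par F ak i 0
    obtain ⟨i, j, hi, hj, hij, aa, ab⟩ := two_of
      (fun i => b ak (a i) * b ak (a i) + 2 * b ak (a i) - 3)
      (fun i => b ak (a i) = -1) 0 (-4) (by norm_num) (fun i _ h => by
        have := hpar i
        have : b ak (a i) ≤ -3 ∨ 1 ≤ b ak (a i) := by omega
        rcases this with h | h <;> nlinarith)
      (fun i _ h => by simp only [h]; norm_num) (by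
        rw [Finset.sum_sub_distrib, Finset.sum_add_distrib, ← Finset.mul_sum, bh, az,
          Finset.sum_const, card_er]
        norm_num
        nlinarith)
    obtain ⟨ad, am, cu, hy⟩ := H.move F hs hp hi hj hij
    refine ⟨ad, am, cu, ?_⟩
    have := hy ak
    omega
  obtain ⟨bh, az⟩ := SS F hp
  rw [ag] at bh az
  have hpar : ∀ i, b ak (a i) % 2 = 0 := fun i => by have := par F ak i 0; omega
  have hne : (sup2 b a ak).Nonempty := by
    by_contra hc
    rw [Finset.not_nonempty_iff_eq_empty] at hc
    have := H.mod4n F (x := ak) (fun i => by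
      have aa : i ∉ sup2 b a ak := by simp [hc]
      rw [mem_sup2] at aa
      have := hpar i; omega)
    omega
  have ao := H.cd_ge8 F (sup2_cd hpar) hne
  have hle := H.sup2_le F ak
  have hsub : sup2 b a ak ⊆ Finset.univ.erase 0 := fun i hi => by
    rw [er_mem]; rintro rfl; rw [mem_sup2, ag] at hi; norm_num at hi
  have key : ∀ i, i ≠ 0 → b ak (a i) = 0 ∨ b ak (a i) = 2 ∨ b ak (a i) = -2 := by
    intro i hi
    have ah := Finset.single_le_sum (f := fun i => b ak (a i) * b ak (a i))
      (fun j _ => mul_self_nonneg _) (er_mem.2 hi)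
    rw [az] at ah
    have aj : b ak (a i) ≤ 5 := by nlinarith
    have bc : -5 ≤ b ak (a i) := by nlinarith
    have br := hpar i
    by_contra hc
    have e5 : i ∉ sup2 b a ak := by rw [mem_sup2]; omega
    have e6 : ∑ i ∈ insert i (sup2 b a ak), b ak (a i) * b ak (a i) ≤
        ∑ i ∈ Finset.univ.erase 0, b ak (a i) * b ak (a i) :=
      Finset.sum_le_sum_of_subset_of_nonneg (Finset.insert_subset (er_mem.2 hi) hsub)
        (fun j _ _ => mul_self_nonneg _)
    rw [Finset.sum_insert e5, az] at e6
    have : b ak (a i) = 4 ∨ b ak (a i) = -4 := by omega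
    rcases this with h | h <;> rw [h] at e6 <;> omega
  have hZ : ((Finset.univ.erase 0).filter fun i => b ak (a i) = 2).card = 5 := by
    have : ∑ i ∈ Finset.univ.erase 0, (b ak (a i) * b ak (a i) + 2 * b ak (a i)) =
        ∑ i ∈ Finset.univ.erase 0, if b ak (a i) = 2 then 8 else 0 :=
      scg fun i hi => by
        rcases key i (er_mem.1 hi) with h | h | h <;> rw [h] <;> rfl
    rw [Finset.sum_add_distrib, ← Finset.mul_sum, bh, az, ← Finset.sum_filter, Finset.sum_const,
      nsmul_eq_mul] at this
    omega
  obtain ⟨p, bs, pz⟩ := perm5 hZ (i := 0) (by simp)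
  refine ⟨_, F.reindex p, ?_, fun i => ?_⟩
  · rw [bs, map_add, LinearMap.add_apply, hp, ag]; rfl
  · rw [map_add, LinearMap.add_apply, hp]
    have := pz i
    simp only [Finset.mem_filter, er_mem] at this
    unfold c9
    by_cases hi : i = 0
    · rw [hi, bs, ag]; simp
    · have hi' : p i ≠ 0 := fun h => hi (p.injective (h.trans bs.symm))
      have hk := key _ hi'
      simp only [hi, hi', ne_eq, not_false_eq_true, true_and, if_false] at this ⊢
      split_ifs with bt <;> simp only [bt, iff_true, iff_false] at this <;> omega
theorem no_oct (F : Fr b a) {x : L} (hn : b x x = 18) (hS : S3 b x) (c : FT → ℤ)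
    (hx0 : b x (a 0) = 9)
    (h : ∀ i, b x (a i) = c i ∨ b x (a i) = - c i) {O : SF}
    (hO : Cd b a O) (bo : O.card = 8) (ag : 0 ∈ O) (hs : ∑ i ∈ O, c i = 26) (hc0 : c 0 = 9) :
    False := by
  obtain ⟨X, e, he, hX⟩ := H.near F hO
    (fun i => if i ∈ O then (if b x (a i) = c i then 2 else -2) else 0)
    (fun i => by split_ifs <;> rfl) 0
  have ah := H.sum8 F x X
  have aj := H.sum8 F X X
  have bw : ∀ i, b x (a i) * b X (a i) = (if i ∈ O then 2 * c i else 0) + if i = 0 then 36 * e else 0 := by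
    intro i
    rw [hX]
    have aa := h i
    by_cases hi : i = 0
    · subst hi; simp only [ag, hx0, hc0, if_true]; ring
    · simp only [hi, if_false, add_zero]
      split_ifs with ab ae
      · rw [ae]; ring
      · rcases aa with aa | aa
        · exact absurd aa ae
        · rw [aa]; ring
      · ring
  have r2 : ∀ i, b X (a i) * b X (a i) = (if i ∈ O then 4 else 0) + if i = 0 then 32 * e else 0 := by
    intro i
    rw [hX]
    by_cases hi : i = 0
    · subst hi; simp only [ag, hx0, hc0, if_true]; rcases he with rfl | rfl <;> norm_num
    · simp only [hi, if_false, add_zero]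
      split_ifs <;> rfl
  rw [scg fun i _ => bw i, Finset.sum_add_distrib, Finset.sum_ite_mem,
    Finset.univ_inter, ← Finset.mul_sum, hs] at ah
  rw [scg fun i _ => r2 i, Finset.sum_add_distrib, Finset.sum_ite_mem,
    Finset.univ_inter, Finset.sum_const, bo] at aj
  simp at ah aj
  have bc := hS (x - X)
  rw [H.sub2, map_sub] at bc
  omega
theorem orb9 {x au : L} (hn : b x x = 18) (hS : S3 b x) (hn' : b au au = 18) (ce : S3 b au)
    (F : Fr b a) (am : Fr b ad) (ag : b x (a 0) = 9) (h : ∀ i, b x (a i) = c9 i ∨ b x (a i) = - c9 i)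
    (h0' : b au (ad 0) = 9) (ai : ∀ i, b au (ad i) = c9 i ∨ b au (ad i) = - c9 i) : Orb b x au := by
  obtain ⟨σ, t, ap, ar, be⟩ := H.main5' F am
  have tr : ∀ l, b (σ x) (ad (t l)) = b x (a l) ∨ b (σ x) (ad (t l)) = - b x (a l) := by
    intro l
    rw [← ap x (a l)]
    rcases be l with h | h <;> rw [h]
    · exact Or.inl rfl
    · right; rw [map_neg, neg_neg]
  refine Orb.trans ⟨σ, ap, rfl⟩ ?_
  have g0 : b (σ x) (ad 0) = 9 := by rw [← (ar 0 (by norm_num)).1, ap, ag]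
  have gn : b (σ x) (σ x) = 18 := by rw [ap, hn]
  have gS := H.S3_isom hS ap
  have g : ∀ i, b (σ x) (ad i) = c9 (t.symm i) ∨ b (σ x) (ad i) = - c9 (t.symm i) := by
    intro i
    have aa := tr (t.symm i); have ab := h (t.symm i)
    rw [Equiv.apply_symm_apply] at aa; omega
  generalize σ x = z at *
  have ts : ∀ i : FT, i.1 < 5 → t.symm i = i := fun i hi => by
    rw [Equiv.symm_apply_eq, (ar i hi).2]
  obtain ⟨O, hO, bo, hQ⟩ := H.octad am (Q := Finset.univ.filter fun i : FT => i.1 < 5) (by decide)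
  have cx : ∀ i : FT, i.1 < 5 → i ∈ O := fun i hi => hQ (by simp [hi])
  have hsum : ∀ (w : Equiv.Perm FT), (∀ i : FT, i.1 < 5 → w i = i) → w.symm 5 ∈ O →
      ∑ i ∈ O, c9 (w i) = 26 := by
    intro w hw ay
    have hns : w.symm 5 ∉ Finset.univ.filter fun i : FT => i.1 < 5 := by
      intro hm
      simp only [Finset.mem_filter, Finset.mem_univ, true_and] at hm
      have := hw _ hm
      rw [Equiv.apply_symm_apply] at this
      rw [← this] at hm
      norm_num at hm
    have hsub := Finset.insert_subset ay hQ
    have bl : ∑ i ∈ Finset.univ.filter (fun i : FT => i.1 < 5), c9 (w i) =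
        ∑ i ∈ Finset.univ.filter (fun i : FT => i.1 < 5), c9 i :=
      scg fun i hi => by rw [hw i (by simpa using hi)]
    rw [← Finset.sum_sdiff hsub, Finset.sum_insert hns, bl]
    have ah : ∑ i ∈ Finset.univ.filter (fun i : FT => i.1 < 5), c9 i = 21 := by decide
    have aj : c9 (w (w.symm 5)) = 3 := by rw [Equiv.apply_symm_apply]; decide
    have bc : ∑ i ∈ O \ insert (w.symm 5) (Finset.univ.filter fun i : FT => i.1 < 5), c9 (w i) =
        ∑ i ∈ O \ insert (w.symm 5) (Finset.univ.filter fun i : FT => i.1 < 5), 1 := by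
      refine scg fun i hi => ?_
      rw [Finset.mem_sdiff, Finset.mem_insert, not_or] at hi
      have bt : ¬ (w i).1 < 5 := fun h => hi.2.2 (by
        have := w.injective (hw _ h)
        rw [this] at h; simpa using h)
      have h7 : w i ≠ 5 := fun h => hi.2.1 (by rw [← h, Equiv.symm_apply_apply])
      have ao : ¬ (w i).1 < 6 := fun h => h7 (by apply Fin.ext; show (w i).1 = 5; omega)
      have h9 : w i ≠ 0 := fun h => bt (by rw [h]; norm_num)
      simp [c9, ao, h9]
    rw [ah, aj, bc, Finset.sum_const, Finset.card_sdiff_of_subset hsub, bo,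
      Finset.card_insert_of_notMem hns]
    have : (Finset.univ.filter fun i : FT => i.1 < 5).card = 5 := by decide
    rw [this]; norm_num
  have n5 : (5:FT) ∉ O := fun ay => H.no_oct am hn' ce c9 h0' ai hO bo (cx 0 (by norm_num))
    (hsum (Equiv.refl _) (fun _ _ => rfl) ay) rfl
  have nk : t 5 ∉ O := fun ay => H.no_oct am gn gS (fun i => c9 (t.symm i)) g0 g hO bo
    (cx 0 (by norm_num)) (hsum t.symm ts ay) (by show c9 (t.symm 0) = 9; rw [ts 0 (by norm_num)]; rfl)
  have fin : ∃ ρ : EL L, Isom b ρ ∧ (∀ o ∈ O, ρ (ad o) = ad o) ∧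
      (ρ (ad (t 5)) = ad 5 ∨ ρ (ad (t 5)) = - ad 5) := by
    by_cases hk : t 5 = 5
    · exact ⟨LinearMap.id, fun _ _ => rfl, fun _ _ => rfl, Or.inl (by rw [hk]; rfl)⟩
    · exact H.step am hO bo nk n5 hk
  obtain ⟨ρ, bw, r2, r3⟩ := fin
  obtain ⟨τ, cl, cy, ca⟩ := H.isom_inv bw
  refine Orb.trans ⟨ρ, bw, rfl⟩ ?_
  have bn : ∀ {m l i}, (ρ (ad m) = ad i ∨ ρ (ad m) = - ad i) → (ρ (ad l) = ad i ∨ ρ (ad l) = - ad i) →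
      m = l := by
    intro m l i aa ab
    by_contra hne
    have ae := am.ne hne
    rw [← bw] at ae
    rcases aa with aa | aa <;> rcases ab with ab | ab <;> rw [aa, ab] at ae <;>
      simp [am.self] at ae
  have co : ∀ {l i j}, (ρ (ad l) = ad i ∨ ρ (ad l) = - ad i) → (ρ (ad l) = ad j ∨ ρ (ad l) = - ad j) →
      i = j := by
    intro l i j aa ab
    by_contra hne
    have ae := am.ne hne
    have al := am.self l
    rw [← bw] at al
    rcases aa with aa | aa <;> rcases ab with ab | ab <;> nth_rewrite 1 [aa] at al <;>
      rw [ab] at al <;> simp [ae] at al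
  have m0 : ∀ i : FT, i.1 < 5 → ρ (ad i) = ad i := fun i hi => r2 i (cx i hi)
  have key : ∀ i, b (ρ z) (ad i) = c9 i ∨ b (ρ z) (ad i) = - c9 i := by
    intro i
    have ah : τ (ad 0) = ad 0 := by
      have := cy (ad 0)
      rwa [m0 0 (by norm_num)] at this
    obtain ⟨l, hl⟩ := H.frame_pres am am cl (Or.inl ah) i
    have hl : ρ (ad l) = ad i ∨ ρ (ad l) = - ad i := by
      have aj : ρ (τ (ad i)) = ad i := ca _
      rcases hl with hl | hl <;> rw [hl] at aj
      · exact Or.inl aj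
      · right; rw [← aj, map_neg, neg_neg]
    have bc : b (ρ z) (ad i) = b z (ad l) ∨ b (ρ z) (ad i) = - b z (ad l) := by
      rw [← bw z (ad l)]
      rcases hl with hl | hl <;> rw [hl]
      · exact Or.inl rfl
      · right; rw [map_neg, neg_neg]
    have br : c9 (t.symm l) = c9 i := by
      by_cases i5 : i.1 < 5
      · rw [bn hl (Or.inl (m0 i i5)), ts i i5]
      by_cases i6 : i = 5
      · subst i6; rw [bn hl r3, Equiv.symm_apply_apply]
      have l5 : ¬ l.1 < 5 := fun h => i5 (by rw [co hl (Or.inl (m0 l h))]; exact h)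
      have l6 : t.symm l ≠ 5 := fun h => i6 (by
        rw [Equiv.symm_apply_eq] at h
        subst h; exact co hl r3)
      have l7 : ¬ (t.symm l).1 < 5 := fun h => l5 (by
        have := (ar _ h).2
        rw [Equiv.apply_symm_apply] at this
        rw [this]; exact h)
      have o1 : ∀ k : FT, ¬ k.1 < 5 → k ≠ 5 → c9 k = 1 := by decide
      rw [o1 _ l7 l6, o1 _ i5 i6]
    have := g l
    omega
  have k0 : b (ρ z) (ad 0) = 9 := by rw [← m0 0 (by norm_num), bw, g0]
  obtain ⟨μ, hμ, hz, -⟩ := H.odd_orbit am (x := ρ z) (y := au) (by rw [k0]; rfl) (fun i => by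
    have := key i; have := ai i; omega)
  exact ⟨μ, hμ, hz⟩
end LL
end latt10
section latt11
variable {L : Type} [AddCommGroup L] {b : BL L} {a ad : FT → L}
def SumOf (b : BL L) (p q r : ℤ) (x : L) : Prop :=
  ∃ u af, b u u = p ∧ b af af = q ∧ b u af = r ∧ x = u + af
def P32 (b : BL L) (x : L) : Prop :=
  ∃ (a : FT → L) (v : L), Fr b a ∧ x = a 0 + (2:ℤ) • v ∧ b v (a 0) = -3 ∧
      ∀ i, i ≠ 0 → b v (a i) = 1 ∨ b v (a i) = -1
def P8 (b : BL L) (x : L) : Prop :=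
  ∃ (a : FT → L) (y : L), Fr b a ∧ (∀ i, b x (a i) = 0 ∨ b x (a i) = 4 ∨ b x (a i) = -4) ∧
      (∀ i : FT, i.1 < 5 → b x (a i) ≠ 0) ∧ ∀ i, b y (a i) % 4 = if b x (a i) = 0 then 0 else 2
inductive Cl (b : BL L) (x : L) : Prop
  | c0 (e : b x x = 0 ∨ b x x = 4 ∨ b x x = 6 ∨ b x x = 8)
  | c5 (e : b x x = 10) (f : SumOf b 4 4 1 x)
  | c22 (e : b x x = 12) (f : SumOf b 4 4 2 x)
  | c32 (e : b x x = 12) (f : P32 b x)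
  | c7 (e : b x x = 14) (f : SumOf b 6 4 2 x)
  | c8 (e : b x x = 16) (f : P8 b x)
  | c9 (e : b x x = 18) (f : SumOf b 6 6 3 x)
namespace LL
variable (H : LL b)
include H
theorem nrm (x : L) : b x x = 0 ∨ 4 ≤ b x x ∧ b x x % 2 = 0 := by
  have aa := H.nonneg x
  have ab := H.even x
  have ae := H.no2 x
  omega
omit H in
theorem SumOf_symm (H : LL b) {p q r : ℤ} {x : L} (h : SumOf b p q r x) : SumOf b q p r x := by
  obtain ⟨u, af, aa, ab, ae, al⟩ := h
  exact ⟨af, u, ab, aa, by rw [H.symm, ae], by rw [al, add_comm]⟩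
theorem pairs {x t y : L} (hS : S3 b x) (hx : x = t + (2:ℤ) • y) :
    b y y ≤ b t t ∧ b (y + t) (y + t) ≤ b t t ∧ b x x = 2 * b y y + 2 * b (y + t) (y + t) - b t t ∧
    2 * b y (y + t) = b y y + b (y + t) (y + t) - b t t ∧ x = y + (y + t) ∧
    2 * b x t = b x x + b t t - 4 * b y y := by
  have aa := hS y
  have ab := hS (y + t)
  have aj := H.add2 y t
  have bc := H.symm y t
  have ex : x = y + (y + t) := by rw [hx, two_smul]; abel
  refine ⟨?_, ?_, ?_, ?_, ex, ?_⟩ <;> rw [hx] at * <;>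
  simp only [map_add, LinearMap.add_apply, map_smul, LinearMap.smul_apply, smul_eq_mul] at * <;> omega
theorem cls {x : L} (hS : S3 b x) : Cl b x := by
  obtain ⟨t, y, hx, hT⟩ := H.rep x
  obtain ⟨aa, ab, ae, al, ay, -⟩ := H.pairs hS hx
  have n1 := H.nrm y
  have n2 := H.nrm (y + t)
  have n3 := H.nrm x
  have mk : ∀ {p q r : ℤ}, b y y = p → b (y + t) (y + t) = q → b y (y + t) = r → SumOf b p q r x :=
    fun ah aj bc => ⟨y, y + t, ah, aj, bc, ay⟩
  rcases hT with hT | hT | hT | hT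
  · exact .c0 (by omega)
  · by_cases h : b x x = 12
    · exact .c22 h (mk (by omega) (by omega) (by omega))
    · exact .c0 (by omega)
  · by_cases e10 : b x x = 10
    · exact .c5 e10 (mk (by omega) (by omega) (by omega))
    by_cases e14 : b x x = 14
    · refine .c7 e14 ?_
      by_cases bt : b y y = 6
      · exact mk (by omega) (by omega) (by omega)
      · exact SumOf_symm H (mk (by omega) (by omega) (by omega))
    by_cases e18 : b x x = 18
    · exact .c9 e18 (mk (by omega) (by omega) (by omega))
    exact .c0 (by omega)
  · by_cases hn : b x x < 12
    · exact .c0 (by omega)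
    obtain ⟨a, ha, ha0, hat⟩ := H.frame t hT
    have F : Fr b a := ⟨ha, fun i j => by
      obtain ⟨p, hp⟩ := hat i
      obtain ⟨q, hq⟩ := hat j
      exact ⟨p - q, by rw [hp, hq, smul_sub]; abel⟩⟩
    have hb : ∀ i, b x (a i) % 4 = (b x x / 2) % 4 ∧ b x x + 2 * b x (a i) ≤ 24 ∧
        b x x - 2 * b x (a i) ≤ 24 := by
      intro i
      obtain ⟨p, hp⟩ := hat i
      have hx' : x = a i + (2:ℤ) • (y - p) := by rw [hx, hp, smul_sub]; abel
      obtain ⟨k1, k2, k3, -, -, k4⟩ := H.pairs hS hx'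
      rw [F.self] at *
      have := H.even (y - p)
      omega
    have ao := H.sum8 F x x
    have e12 : b x x = 12 ∨ b x x = 16 ∨ b x x = 20 ∨ b x x = 24 := by omega
    rcases e12 with e | e | e | e
    · have hall : ∀ i, b x (a i) = 2 ∨ b x (a i) = -2 := by
        by_contra! hcon
        obtain ⟨i, hi⟩ := hcon
        have q : ∀ j, 4 ≤ b x (a j) * b x (a j) := fun j =>
          ev_sq (by have := hb j; omega) (by have := hb j; omega)
        have ca : 36 ≤ b x (a i) * b x (a i) := by
          have := hb i
          have : b x (a i) = 6 ∨ b x (a i) = -6 := by omega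
          rcases this with h | h <;> rw [h] <;> norm_num
        have := Finset.card_nsmul_le_sum (Finset.univ.erase i) (fun i => b x (a i) * b x (a i)) 4
          (fun j _ => q j)
        rw [Finset.card_erase_of_mem (Finset.mem_univ i)] at this
        simp at this
        omega
      exact .c32 e (H.can632 F (x := x) (y := y) (by rw [ha0, hx]) hall)
    · obtain ⟨a, F, cl, ca, cy⟩ := H.can8 F (x := x) (y := y) e (by rw [ha0, hx])
        (fun i => by have := hb i; omega)
      exact .c8 e ⟨a, y, F, cl, ca, cy⟩
    all_goals
      exfalso
      have := Finset.sum_le_card_nsmul Finset.univ (fun i => b x (a i) * b x (a i)) 4 (fun i _ => by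
        have := hb i
        have : -2 ≤ b x (a i) ∧ b x (a i) ≤ 2 := by omega
        nlinarith)
      simp at this
      omega
theorem orbs {x au : L} (hS : S3 b x) (ce : S3 b au) (h : b x x = b au au) (h12 : b x x ≠ 12) :
    Orb b x au := by
  rcases H.cls hS with e | ⟨e, f⟩ | ⟨e, f⟩ | ⟨e, f⟩ | ⟨e, f⟩ | ⟨e, f⟩ | ⟨e, f⟩ <;>
  rcases H.cls ce with bk | ⟨bk, cg⟩ | ⟨bk, cg⟩ | ⟨bk, cg⟩ | ⟨bk, cg⟩ | ⟨bk, cg⟩ | ⟨bk, cg⟩ <;>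
  first
    | (exfalso; omega)
    | skip
  · rcases e with e | e | e | e
    · rw [H.eq_zero (x := x) (by omega), H.eq_zero (x := au) (by omega)]
      exact ⟨LinearMap.id, fun _ _ => rfl, rfl⟩
    · exact H.t2 e (by omega)
    · exact H.orb3 e (by omega)
    · exact H.t4 e (by omega)
  · obtain ⟨u, af, aa, ab, ae, rfl⟩ := f
    obtain ⟨w, bf, k1, k2, k3, rfl⟩ := cg
    exact H.orb5 aa ab ae k1 k2 k3
  · obtain ⟨u, af, aa, ab, ae, rfl⟩ := f
    obtain ⟨w, bf, k1, k2, k3, rfl⟩ := cg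
    exact H.orb7 aa ab ae k1 k2 k3
  · obtain ⟨a, y, F, cl, ca, cy⟩ := f
    obtain ⟨ad, y', am, q1', q2', q3'⟩ := cg
    exact H.orb8 e hS bk ce F am cl ca cy q1' q2' q3'
  · obtain ⟨u, af, aa, ab, ae, rfl⟩ := f
    obtain ⟨w, bf, k1, k2, k3, rfl⟩ := cg
    obtain ⟨a, F, f1, cn⟩ := H.can9 aa ab ae
    obtain ⟨ad, am, f1', f2'⟩ := H.can9 k1 k2 k3
    exact H.orb9 e hS bk ce F am f1 cn f1' f2'
omit [AddCommGroup L] H in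
theorem czero {A : Finset L} {g : L → ℂ} (hc : ∀ x ∈ A, ∀ y ∈ A, g x = g y) (hs : ∑ x ∈ A, g x = 0)
    {x : L} (hx : x ∈ A) : g x = 0 := by
  rw [scg fun y hy => hc y hy x hx, Finset.sum_const, nsmul_eq_mul, mul_eq_zero] at hs
  rcases hs with h | h
  · rw [Nat.cast_eq_zero, Finset.card_eq_zero] at h
    rw [h] at hx; simp at hx
  · exact h
theorem lat_final (g : L → ℂ) (S : Finset L) (hsup : ∀ x, g x ≠ 0 → x ∈ S)
    (hg : ∀ σ : EL L, Isom b σ → ∀ x, g (σ x) = g x) (ae : ∀ x, g x ≠ 0 → S3 b x)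
    (hr : ∀ n : ℤ, ∑ x ∈ S with b x x = n, g x = 0)
    (hd : ∀ v, b v v = 4 → ∑ x ∈ S, g x * ∏ j ∈ Finset.Icc (-6:ℤ) 5, ((b x v : ℂ) - j) = 0) :
    ∀ x, g x = 0 := by
  classical
  have orb : ∀ {x y}, Orb b x y → g x = g y := by
    rintro x y ⟨σ, hσ, rfl⟩; exact (hg σ hσ x).symm
  have bp : ∀ n : ℤ, ∑ x ∈ S with (b x x = n ∧ g x ≠ 0), g x = 0 := by
    intro n
    rw [← Finset.filter_filter, Finset.sum_filter_ne_zero (f := g) (S.filter fun x => b x x = n), hr]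
  have ap : ∀ x, b x x ≠ 12 → g x = 0 := by
    intro x hx
    by_contra hne
    refine hne (czero (A := S.filter fun y => b y y = b x x ∧ g y ≠ 0) ?_ (bp _) ?_)
    · intro y hy z hz
      rw [Finset.mem_filter] at hy hz
      exact orb (H.orbs (ae _ hy.2.2) (ae _ hz.2.2) (by omega) (by omega))
    · simp [hsup x hne, hne]
  have ar : ∀ x, b x x = 12 → SumOf b 4 4 2 x → g x = 0 := by
    intro x hx hf
    have hf' := hf
    obtain ⟨u, af, aa, ab, al, hxu⟩ := hf
    by_contra hne
    have hz := hd u aa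
    have key : ∀ y, g y * ∏ j ∈ Finset.Icc (-6:ℤ) 5, ((b y u : ℂ) - j) ≠ 0 →
        b y u = 6 ∧ g y = g x := by
      intro y hy
      have hgy : g y ≠ 0 := left_ne_zero_of_mul hy
      have hb : b y u = 6 := by
        have cl := ae y hgy u
        have ca := ae y hgy (-u)
        rw [neg2, map_neg] at ca
        by_contra hc
        refine hy (mul_eq_zero_of_right _ (Finset.prod_eq_zero (i := b y u) ?_ (sub_self _)))
        rw [Finset.mem_Icc]; omega
      have h12 : b y y = 12 := by by_contra h; exact hgy (ap y h)
      refine ⟨hb, orb ?_⟩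
      have ah : b (y - u) (y - u) = 4 := by rw [H.sub2, h12, hb, aa]; rfl
      have aj : b u (y - u) = 2 := by rw [map_sub, H.symm u y, hb, aa]; rfl
      have := H.orb622 aa ah aj aa ab al
      rwa [add_sub_cancel, ← hxu] at this
    have hP : ∏ j ∈ Finset.Icc (-6:ℤ) 5, (((6:ℤ) : ℂ) - j) ≠ 0 := by
      rw [Finset.prod_ne_zero_iff]
      intro j hj
      rw [Finset.mem_Icc] at hj
      rw [← Int.cast_sub, Int.cast_ne_zero]; omega
    have hbx : b x u = 6 := by
      rw [hxu, map_add, LinearMap.add_apply, aa, H.symm, al]; rfl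
    set G : L → ℂ := fun y => g y * ∏ j ∈ Finset.Icc (-6:ℤ) 5, ((b y u : ℂ) - j) with hG
    have hGx : G x ≠ 0 := by simp only [hG, hbx]; exact mul_ne_zero hne hP
    refine hGx (czero (A := S.filter fun y => G y ≠ 0) ?_ ?_ ?_)
    · intro y hy z hz
      rw [Finset.mem_filter] at hy hz
      have ah := key y hy.2
      have aj := key z hz.2
      simp only [hG]
      rw [ah.1, ah.2, aj.1, aj.2]
    · rw [Finset.sum_filter_ne_zero]; exact hz
    · rw [Finset.mem_filter]; exact ⟨hsup x hne, hGx⟩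
  intro x
  by_contra hne
  have hx12 : b x x = 12 := by by_contra h; exact hne (ap x h)
  refine hne (czero (A := S.filter fun y => b y y = 12 ∧ g y ≠ 0) ?_ (bp _) ?_)
  · have : ∀ y, b y y = 12 → g y ≠ 0 → P32 b y := by
      intro y aa ab
      rcases H.cls (ae y ab) with e | ⟨e, f⟩ | ⟨e, f⟩ | ⟨e, f⟩ | ⟨e, f⟩ | ⟨e, f⟩ | ⟨e, f⟩ <;>
      first
        | exact f
        | exact absurd (ar y aa f) ab
        | (exfalso; omega)
    intro y hy z hz
    rw [Finset.mem_filter] at hy hz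
    obtain ⟨a, v, F, f1, cn, f3⟩ := this y hy.2.1 hy.2.2
    obtain ⟨ad, cj, am, f1', f2', f3'⟩ := this z hz.2.1 hz.2.2
    exact orb (H.orb632 F am f1 cn f3 f1' f2' f3')
  · simp [hsup x hne, hne, hx12]
end LL
end latt11
section theta1
def dotq {n : ℕ} (x y : Fin n → ℚ) : ℚ := ∑ i, x i * y i
def cq {n : ℕ} (m : Fin n → ℤ) : Fin n → ℚ := fun i => (m i : ℚ)
inductive DQ : (n : ℕ) → ((Fin n → ℚ) → ℚ) → ((Fin n → ℚ) → ℚ) → Prop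
  | nil : DQ 0 (fun _ => 0) (fun _ => 0)
  | cons {n : ℕ} {S bu : (Fin n → ℚ) → ℚ} (h : DQ n S bu) (a : ℚ) (ha : 0 < a) (v : Fin n → ℚ) :
    DQ (n+1) (fun m => a * (m 0 + dotq v (Fin.tail m)) ^ 2 + S (Fin.tail m))
      (fun k => k 0 ^ 2 / a + bu (fun i => k i.succ - k 0 * v i))
theorem dotq_sq {n : ℕ} (x y : Fin n → ℚ) : dotq x y ^ 2 ≤ dotq x x * dotq y y := by
  have := Finset.sum_mul_sq_le_sq_mul_sq Finset.univ x y
  simp only [dotq, ← sq]; exact this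
theorem dotq_self_nonneg {n : ℕ} (x : Fin n → ℚ) : 0 ≤ dotq x x :=
  Finset.sum_nonneg fun i _ => mul_self_nonneg _
theorem dotq_succ {n : ℕ} (x y : Fin (n+1) → ℚ) :
    dotq x y = x 0 * y 0 + dotq (Fin.tail x) (Fin.tail y) := by
  simp only [dotq, Fin.sum_univ_succ]; rfl
theorem dotq_par {n : ℕ} (x y : Fin n → ℚ) :
    dotq (fun i => x i + y i) (fun i => x i + y i) ≤ 2 * dotq x x + 2 * dotq y y := by
  simp only [dotq, Finset.mul_sum, ← Finset.sum_add_distrib]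
  exact Finset.sum_le_sum fun i _ => by nlinarith [sq_nonneg (x i - y i)]
theorem DQ.bound {n : ℕ} {Q ax : (Fin n → ℚ) → ℚ} (h : DQ n Q ax) :
    ∃ c : ℚ, 0 < c ∧ (∀ m, dotq m m ≤ c * Q m) ∧ ∀ m, dotq m m ≤ c * ax m := by
  induction h with
  | nil => exact ⟨1, one_pos, fun m => by simp [dotq], fun m => by simp [dotq]⟩
  | @cons n S bu h a ha v ih =>
    obtain ⟨c, hc, aa, ab⟩ := ih
    have hV := dotq_self_nonneg v
    set V := dotq v v with hVd
    have ha' : (0:ℚ) ≤ 1 / a := by positivity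
    refine ⟨2 / a + (2 * V + 2) * c + a * (1 + 2 * V) , by positivity, fun m => ?_, fun m => ?_⟩
    · rw [dotq_succ]
      set s := dotq v (Fin.tail m) with hs
      have ah := dotq_sq v (Fin.tail m)
      have aj := aa (Fin.tail m)
      have bc := dotq_self_nonneg (Fin.tail m)
      rw [← hs] at ah
      set T := dotq (Fin.tail m) (Fin.tail m)
      have br : 0 ≤ S (Fin.tail m) := by
        by_contra hcc
        have := mul_neg_of_pos_of_neg hc (not_le.1 hcc)
        linarith
      set R := S (Fin.tail m)
      have e5 : T * (2 * V + 1) ≤ (2 * V + 2) * c * R := by nlinarith [mul_nonneg hc.le br]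
      have e6 : 2 * (m 0 + s) ^ 2 = 2 / a * (a * (m 0 + s) ^ 2) := by field_simp
      have e7 : m 0 * m 0 ≤ 2 * (m 0 + s) ^ 2 + 2 * s ^ 2 := by nlinarith [sq_nonneg (m 0 + 2 * s)]
      have e8 : 0 ≤ a * (m 0 + s) ^ 2 := by positivity
      have e9 : 0 ≤ (a * (1 + 2 * V)) * (a * (m 0 + s) ^ 2 + R) := by positivity
      have e10 : 0 ≤ ((2 * V + 2) * c) * (a * (m 0 + s) ^ 2) := by positivity
      have e11 : 0 ≤ 2 / a * R := by positivity
      nlinarith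
    · rw [dotq_succ]
      have ah := dotq_par (fun i => m i.succ - m 0 * v i) (fun i => m 0 * v i)
      have aj := ab (fun i => m i.succ - m 0 * v i)
      have bc : dotq (fun i => m 0 * v i) (fun i => m 0 * v i) = m 0 ^ 2 * V := by
        simp only [hVd, dotq, Finset.mul_sum]; exact scg fun i _ => by ring
      have e3' := dotq_self_nonneg (fun i => m i.succ - m 0 * v i)
      have br : 0 ≤ bu (fun i => m i.succ - m 0 * v i) := by
        by_contra hcc
        have := mul_neg_of_pos_of_neg hc (not_le.1 hcc)
        linarith
      simp only [sub_add_cancel] at ah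
      change dotq (Fin.tail m) (Fin.tail m) ≤ _ at ah
      set R := bu (fun i => m i.succ - m 0 * v i)
      have e5 : m 0 ^ 2 * (1 + 2 * V) = a * (1 + 2 * V) * (m 0 ^ 2 / a) := by field_simp
      have e6 : 0 ≤ m 0 ^ 2 / a := by positivity
      have e7 : 0 ≤ (2 / a) * (m 0 ^ 2 / a + R) := by positivity
      have e8 : 0 ≤ ((2 * V + 2) * c) * (m 0 ^ 2 / a) := by positivity
      have e9 : 0 ≤ (a * (1 + 2 * V)) * R := by positivity
      have e10 : 0 ≤ 2 * V * c * R := by positivity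
      nlinarith
theorem DQ.grad {n : ℕ} {Q ax : (Fin n → ℚ) → ℚ} (h : DQ n Q ax) (m k : Fin n → ℚ)
    (hk : ∀ y, Q (fun i => m i + y i) = Q m + 2 * dotq k y + Q y) : ax k = Q m := by
  induction h with
  | nil => rfl
  | @cons n S bu h a ha v ih =>
    have bm : ∀ x y : Fin n → ℚ, dotq v (fun i => x i + y i) = dotq v x + dotq v y := by
      intro x y; simp only [dotq, mul_add, Finset.sum_add_distrib]
    beta_reduce at hk
    have ag := hk (Fin.cons 1 0)
    have t0 : dotq v (0 : Fin n → ℚ) = 0 := by simp [dotq]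
    have s0 : S 0 = 0 := by
      have := hk 0
      simp [dotq] at this
      simpa [Fin.tail_def, Pi.zero_def] using this
    have cl : Fin.tail (fun i => m i + (Fin.cons 1 0 : Fin (n+1) → ℚ) i) = Fin.tail m := by
      ext i; simp [Fin.tail]
    have ca : k 0 = a * (m 0 + dotq v (Fin.tail m)) := by
      rw [cl, dotq_succ] at ag
      simp only [Fin.cons_zero, Fin.tail_cons, t0, s0] at ag
      have : dotq (Fin.tail k) 0 = 0 := by simp [dotq]
      rw [this] at ag
      linarith
    have cy := ih (Fin.tail m) (fun i => k i.succ - k 0 * v i) (fun y => by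
      have aa := hk (Fin.cons (- dotq v y) y)
      have q4 : Fin.tail (fun i => m i + (Fin.cons (- dotq v y) y : Fin (n+1) → ℚ) i) =
          fun i => Fin.tail m i + y i := by
        ext i; simp [Fin.tail]
      rw [q4, dotq_succ, bm] at aa
      simp only [Fin.cons_zero, Fin.tail_cons] at aa
      have q5 : dotq (fun i => k i.succ - k 0 * v i) y = dotq (Fin.tail k) y - k 0 * dotq v y := by
        simp only [dotq, Finset.mul_sum, ← Finset.sum_sub_distrib, Fin.tail]
        exact scg fun i _ => by ring
      rw [q5]
      ring_nf at aa ⊢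
      linarith)
    show k 0 ^ 2 / a + bu _ = _
    rw [cy, ca]
    field_simp
theorem DQ.exists (n : ℕ) (A : Fin n → Fin n → ℚ) (hs : ∀ i j, A i j = A j i)
    (hp : ∀ m : Fin n → ℚ, m ≠ 0 → 0 < ∑ i, ∑ j, m i * A i j * m j) :
    ∃ ax, DQ n (fun m => ∑ i, ∑ j, m i * A i j * m j) ax := by
  induction n with
  | zero => exact ⟨_, by convert DQ.nil using 2; simp⟩
  | succ n ih =>
    set a := A 0 0 with had
    have ha : 0 < a := by
      have := hp (Pi.single 0 1) (by simp)
      simpa [Pi.single_apply] using this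
    set v : Fin n → ℚ := fun j => A 0 j.succ / a with hv
    have key : ∀ m : Fin (n+1) → ℚ, ∑ i, ∑ j, m i * A i j * m j =
        a * (m 0 + dotq v (Fin.tail m)) ^ 2 + ∑ i : Fin n, ∑ j : Fin n, Fin.tail m i *
          (A i.succ j.succ - A 0 i.succ * A 0 j.succ / a) * Fin.tail m j := by
      intro m
      set s := dotq v (Fin.tail m) with bv
      have ah : ∑ j : Fin n, A 0 j.succ * m j.succ = a * s := by
        simp only [bv, dotq, Finset.mul_sum, hv, Fin.tail]
        exact scg fun i _ => by field_simp
      have aj : ∑ i : Fin n, ∑ j : Fin n, Fin.tail m i *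
          (A 0 i.succ * A 0 j.succ / a) * Fin.tail m j = a * s ^ 2 := by
        have : a * s ^ 2 = (a * s) * (a * s) / a := by field_simp
        rw [this, ← ah, Finset.sum_mul_sum, Finset.sum_div]
        refine scg fun i _ => ?_
        rw [Finset.sum_div]
        exact scg fun j _ => by simp only [Fin.tail]; ring
      simp only [mul_sub, sub_mul, Finset.sum_sub_distrib, aj]
      simp only [Fin.sum_univ_succ, Finset.sum_add_distrib]
      have bc : ∑ i : Fin n, m 0 * A 0 i.succ * m i.succ = m 0 * (a * s) := by
        rw [← ah, Finset.mul_sum]; exact scg fun i _ => by ring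
      have br : ∑ i : Fin n, m i.succ * A i.succ 0 * m 0 = m 0 * (a * s) := by
        rw [← ah, Finset.mul_sum]; exact scg fun i _ => by rw [hs]; ring
      rw [bc, br, ← had]
      simp only [Fin.tail]
      ring
    obtain ⟨bu, ce⟩ := ih (fun i j => A i.succ j.succ - A 0 i.succ * A 0 j.succ / a)
      (fun i j => by rw [hs]; ring) (fun m hm => by
        have aa := hp (Fin.cons (- dotq v m) m) (by
          intro ag
          apply hm
          ext i
          have := congrFun ag i.succ
          simpa using this)
        rw [key] at aa
        simpa using aa)
    refine ⟨fun k => k 0 ^ 2 / a + bu (fun i => k i.succ - k 0 * v i), ?_⟩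
    convert DQ.cons ce a ha v using 1
    ext m
    exact key m
end theta1
section theta2
theorem theta_one {τ : ℂ} (hτ : 0 < τ.im) (s x : ℂ) :
    ∑' m : ℤ, cexp (π * Complex.I * τ * (m + s) ^ 2 + 2 * π * Complex.I * x * m) =
      1 / (-Complex.I * τ) ^ (1/2 : ℂ) * ∑' k : ℤ, cexp (π * Complex.I * (-1/τ) * (k + x) ^ 2 - 2 * π * Complex.I * (k + x) * s) := by
  have ag : τ ≠ 0 := by rintro rfl; simp at hτ
  have h := jacobiTheta₂_functional_equation (τ * s + x) τ
  have ah : ∑' m : ℤ, cexp (π * Complex.I * τ * (m + s) ^ 2 + 2 * π * Complex.I * x * m) =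
      cexp (π * Complex.I * τ * s ^ 2) * jacobiTheta₂ (τ * s + x) τ := by
    rw [jacobiTheta₂, ← tsum_mul_left]
    refine tsum_congr fun m => ?_
    rw [jacobiTheta₂_term, ← Complex.exp_add]
    congr 1; ring
  have aj : ∑' k : ℤ, cexp (π * Complex.I * (-1/τ) * (k + x) ^ 2 - 2 * π * Complex.I * (k + x) * s) =
      cexp (π * Complex.I * τ * s ^ 2) * cexp (-π * Complex.I * (τ * s + x) ^ 2 / τ) *
        jacobiTheta₂ ((τ * s + x) / τ) (-1/τ) := by
    rw [jacobiTheta₂, ← tsum_mul_left, ← (Equiv.neg ℤ).tsum_eq]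
    refine tsum_congr fun m => ?_
    rw [jacobiTheta₂_term, ← Complex.exp_add, ← Complex.exp_add]
    congr 1; simp only [Equiv.neg_apply]; push_cast; field_simp; ring
  rw [ah, aj, h]; ring
theorem summable_gauss1 {c : ℝ} (hc : 0 < c) : Summable fun m : ℤ => Real.exp (-c * (m:ℝ) ^ 2) := by
  have h := (summable_jacobiTheta₂_term_iff 0 (Complex.I * (c / π))).2 (by
    have : (Complex.I * ((c:ℂ) / π)).im = c / π := by
      rw [← Complex.ofReal_div]; simp
    rw [this]; positivity)
  refine h.norm.congr fun m => ?_
  rw [norm_jacobiTheta₂_term]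
  congr 1
  have : (Complex.I * ((c:ℂ) / π)).im = c / π := by
    rw [← Complex.ofReal_div]; simp
  rw [this]; simp; field_simp
theorem summable_gauss (n : ℕ) {c : ℝ} (hc : 0 < c) :
    Summable fun m : Fin n → ℤ => Real.exp (-c * ((dotq (cq m) (cq m) : ℚ) : ℝ)) := by
  induction n with
  | zero => exact Summable.of_finite
  | succ n ih =>
    rw [← (Fin.consEquiv (fun _ : Fin (n+1) => ℤ)).summable_iff]
    refine ((summable_gauss1 hc).mul_of_nonneg ih (fun _ => (Real.exp_pos _).le)
      (fun _ => (Real.exp_pos _).le)).congr fun p => ?_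
    have bl : (Fin.consEquiv (fun _ : Fin (n+1) => ℤ)) p = Fin.cons p.1 p.2 := rfl
    simp only [Function.comp, bl]
    rw [dotq_succ, ← Real.exp_add]
    congr 1
    have : Fin.tail (cq (Fin.cons p.1 p.2 : Fin (n+1) → ℤ)) = cq p.2 := by ext i; simp [cq, Fin.tail]
    rw [this]; simp [cq]; ring
def gth {n : ℕ} (Q : (Fin n → ℚ) → ℚ) (τ : ℂ) (ξ : Fin n → ℚ) (m : Fin n → ℤ) : ℂ :=
  cexp (π * Complex.I * τ * (Q (cq m) : ℚ) + 2 * π * Complex.I * (dotq ξ (cq m) : ℚ))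
def gth' {n : ℕ} (ax : (Fin n → ℚ) → ℚ) (τ : ℂ) (ξ : Fin n → ℚ) (k : Fin n → ℤ) : ℂ :=
  cexp (π * Complex.I * (-1/τ) * (ax (fun i => k i + ξ i) : ℚ))
theorem gth_norm {n : ℕ} (Q : (Fin n → ℚ) → ℚ) (τ : ℂ) (ξ : Fin n → ℚ) (m : Fin n → ℤ) :
    ‖gth Q τ ξ m‖ = Real.exp (-(π * τ.im) * (Q (cq m) : ℚ)) := by
  rw [gth, Complex.norm_exp]; congr 1
  have : (π * Complex.I * τ * (Q (cq m) : ℚ) + 2 * π * Complex.I * (dotq ξ (cq m) : ℚ) : ℂ) =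
    ((π * (Q (cq m) : ℚ) : ℝ) : ℂ) * (Complex.I * τ) + ((2 * π * (dotq ξ (cq m) : ℚ) : ℝ) : ℂ) * Complex.I := by
    push_cast; ring
  rw [this, Complex.add_re, Complex.re_ofReal_mul, Complex.re_ofReal_mul]; simp; ring
theorem gth'_norm {n : ℕ} (Q : (Fin n → ℚ) → ℚ) (τ : ℂ) (ξ : Fin n → ℚ) (m : Fin n → ℤ) :
    ‖gth' Q τ ξ m‖ = Real.exp (-(π * (-1/τ).im) * (Q (fun i => m i + ξ i) : ℚ)) := by
  rw [gth', Complex.norm_exp]; congr 1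
  have : (π * Complex.I * (-1/τ) * (Q (fun i => m i + ξ i) : ℚ) : ℂ) =
    ((π * (Q (fun i => m i + ξ i) : ℚ) : ℝ) : ℂ) * (Complex.I * (-1/τ)) := by
    push_cast; ring
  rw [this, Complex.re_ofReal_mul, Complex.I_mul_re]; ring
theorem neg_inv_im {τ : ℂ} (hτ : 0 < τ.im) : 0 < (-1/τ).im := by
  have ag : τ ≠ 0 := by rintro rfl; simp at hτ
  have : 0 < normSq τ := normSq_pos.2 ag
  rw [neg_div, one_div, Complex.neg_im, Complex.inv_im]
  rw [neg_div, neg_neg]; positivity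
theorem DQ.summable {n : ℕ} {Q ax : (Fin n → ℚ) → ℚ} (h : DQ n Q ax) {τ : ℂ} (hτ : 0 < τ.im)
    (ξ : Fin n → ℚ) : Summable fun m => ‖gth Q τ ξ m‖ := by
  obtain ⟨c, hc, aa, -⟩ := h.bound
  have hc' : (0:ℝ) < c := by exact_mod_cast hc
  refine (summable_gauss n (c := π * τ.im / c) (by positivity)).of_nonneg_of_le
    (fun _ => norm_nonneg _) fun m => ?_
  rw [gth_norm, Real.exp_le_exp]
  have ab : ((dotq (cq m) (cq m) : ℚ) : ℝ) ≤ c * (Q (cq m) : ℚ) := by exact_mod_cast aa (cq m)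
  have : π * τ.im / c * ((dotq (cq m) (cq m) : ℚ) : ℝ) ≤ π * τ.im / c * (c * (Q (cq m) : ℚ)) :=
    mul_le_mul_of_nonneg_left ab (by positivity)
  have e : π * τ.im / c * (c * (Q (cq m) : ℚ)) = π * τ.im * (Q (cq m) : ℚ) := by field_simp
  linarith
theorem DQ.summable' {n : ℕ} {Q ax : (Fin n → ℚ) → ℚ} (h : DQ n Q ax) {τ : ℂ} (hτ : 0 < τ.im)
    (ξ : Fin n → ℚ) : Summable fun m => ‖gth' ax τ ξ m‖ := by
  obtain ⟨c, hc, -, aa⟩ := h.bound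
  have hc' : (0:ℝ) < c := by exact_mod_cast hc
  have ht := neg_inv_im hτ
  set t := (-1/τ).im with htd
  refine ((summable_gauss n (c := π * t / c / 2) (by positivity)).mul_left
    (Real.exp (π * t / c * (dotq ξ ξ : ℚ)))).of_nonneg_of_le
    (fun _ => norm_nonneg _) fun m => ?_
  rw [gth'_norm, ← Real.exp_add, Real.exp_le_exp, ← htd]
  have ae := dotq_par (fun i => m i + ξ i) (fun i => - ξ i)
  simp only [add_neg_cancel_right] at ae
  have ah : dotq (fun i => -ξ i) (fun i => - ξ i) = dotq ξ ξ := by simp [dotq]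
  change dotq (cq m) (cq m) ≤ _ at ae
  rw [ah] at ae
  have al := aa (fun i => m i + ξ i)
  have ay : ((dotq (cq m) (cq m) : ℚ) : ℝ) ≤ 2 * (c * (ax (fun i => m i + ξ i) : ℚ)) + 2 * (dotq ξ ξ : ℚ) := by
    exact_mod_cast (by linarith : dotq (cq m) (cq m) ≤ 2 * (c * ax (fun i => m i + ξ i)) + 2 * dotq ξ ξ)
  have := mul_le_mul_of_nonneg_left ay (by positivity : 0 ≤ π * t / c / 2)
  have e : π * t / c / 2 * (2 * (c * (ax (fun i => m i + ξ i) : ℚ)) + 2 * (dotq ξ ξ : ℚ)) =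
    π * t * (ax (fun i => m i + ξ i) : ℚ) + π * t / c * (dotq ξ ξ : ℚ) := by field_simp
  linarith
theorem cq_cons {n : ℕ} (p : ℤ) (m : Fin n → ℤ) :
   cq (Fin.cons p m : Fin (n+1) → ℤ) = Fin.cons (p:ℚ) (cq m) := by
  ext i; refine Fin.cases ?_ (fun j => ?_) i <;> simp [cq]
theorem cpow_w {a : ℚ} (ha : 0 < a) (τ : ℂ) :
    (-Complex.I * ((a:ℂ) * τ)) ^ (1/2 : ℂ) = (a:ℂ) ^ (1/2:ℂ) * (-Complex.I * τ) ^ (1/2:ℂ) := by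
  have : -Complex.I * ((a:ℂ) * τ) = ((a:ℝ):ℂ) * (-Complex.I * τ) := by push_cast; ring
  have haR : (0:ℝ) < a := by exact_mod_cast ha
  by_cases ag : -Complex.I * τ = 0
  · rw [this, ag]; simp
  have hn : ((a:ℝ):ℂ) ≠ 0 := by exact_mod_cast haR.ne'
  rw [this, Complex.cpow_def_of_ne_zero (mul_ne_zero hn ag), Complex.log_ofReal_mul haR ag,
    Complex.cpow_def_of_ne_zero (by exact_mod_cast ha.ne'), Complex.cpow_def_of_ne_zero ag,
    ← Complex.exp_add, Complex.ofReal_log haR.le]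
  congr 1; push_cast; ring
theorem DQ.theta {n : ℕ} {Q ax : (Fin n → ℚ) → ℚ} (h : DQ n Q ax) :
    ∃ C : ℂ, ∀ τ : ℂ, 0 < τ.im → ∀ ξ : Fin n → ℚ,
      ∑' m, gth Q τ ξ m = C * (1 / (-Complex.I * τ) ^ (1/2 : ℂ)) ^ n * ∑' k, gth' ax τ ξ k := by
  induction h with
  | nil =>
    refine ⟨1, fun τ hτ ξ => ?_⟩
    simp [gth, gth', dotq]
  | @cons n S bu h a ha v ih =>
    obtain ⟨C, hC⟩ := ih
    refine ⟨C * (1 / (a:ℂ) ^ (1/2:ℂ)), fun τ hτ ξ => ?_⟩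
    have hcons := DQ.cons h a ha v
    set Q : (Fin (n+1) → ℚ) → ℚ := fun m => a * (m 0 + dotq v (Fin.tail m)) ^ 2 + S (Fin.tail m) with hQ
    set ax : (Fin (n+1) → ℚ) → ℚ := fun k => k 0 ^ 2 / a + bu (fun i => k i.succ - k 0 * v i) with cx
    have haR : (0:ℝ) < a := by exact_mod_cast ha
    have haC : (a:ℂ) ≠ 0 := by exact_mod_cast ha.ne'
    have hτ0 : τ ≠ 0 := by rintro rfl; simp at hτ
    have haτ : 0 < ((a:ℂ) * τ).im := by
      have : (a:ℂ) * τ = ((a:ℝ):ℂ) * τ := by push_cast; rfl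
      rw [this, Complex.im_ofReal_mul]; positivity
    have hs1 := (hcons.summable hτ ξ).of_norm
    have hs2 := (hcons.summable' hτ ξ).of_norm
    set E := Fin.consEquiv (fun _ : Fin (n+1) => ℤ) with hE
    have hEa : ∀ p m, E (p, m) = Fin.cons p m := fun _ _ => rfl
    set K : (Fin n → ℤ) → ℤ → ℂ := fun m k => cexp (π * Complex.I * (-1/((a:ℂ)*τ)) * (k + (ξ 0 : ℚ)) ^ 2) *
      gth S τ (fun i => ξ i.succ - (k + ξ 0) * v i) m with hK
    have f1 : ∀ (m : Fin n → ℤ), ∑' p : ℤ, gth Q τ ξ (E (p, m)) =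
        1 / (-Complex.I * ((a:ℂ) * τ)) ^ (1/2:ℂ) * ∑' k : ℤ, K m k := by
      intro m
      have ah : ∀ p : ℤ, gth Q τ ξ (E (p, m)) =
        cexp (π * Complex.I * τ * (S (cq m) : ℚ) + 2 * π * Complex.I * (dotq (Fin.tail ξ) (cq m) : ℚ)) *
        cexp (π * Complex.I * ((a:ℂ) * τ) * (p + (dotq v (cq m) : ℚ)) ^ 2 + 2 * π * Complex.I * (ξ 0 : ℚ) * p) := by
        intro p
        rw [gth, ← Complex.exp_add, hEa, cq_cons, dotq_succ]
        simp only [hQ, Fin.cons_zero, Fin.tail_cons]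
        congr 1; push_cast; ring
      simp_rw [ah]
      rw [tsum_mul_left, theta_one haτ, mul_left_comm, ← tsum_mul_left]
      congr 1
      refine tsum_congr fun k => ?_
      rw [hK]; simp only [gth]
      rw [← Complex.exp_add, ← Complex.exp_add]
      have : dotq (fun i => ξ i.succ - (k + ξ 0) * v i) (cq m) = dotq (Fin.tail ξ) (cq m) - (k + ξ 0) * dotq v (cq m) := by
        simp only [dotq, Finset.mul_sum, ← Finset.sum_sub_distrib, Fin.tail]
        exact scg fun i _ => by ring
      rw [this]
      congr 1; push_cast; ring
    have hKs : Summable (Function.uncurry K) := by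
      have aa : Summable fun k : ℤ => ‖cexp (π * Complex.I * (-1/((a:ℂ)*τ)) * (k + (ξ 0 : ℚ)) ^ 2)‖ := by
        have hd := (DQ.cons DQ.nil a ha 0).summable' hτ (fun _ => ξ 0)
        rw [← (Equiv.funUnique (Fin 1) ℤ).symm.summable_iff] at hd
        refine hd.congr fun k => ?_
        simp only [Function.comp, gth']
        congr 2
        simp [Equiv.funUnique]; field_simp
      have ab := (h.summable hτ 0).mul_of_nonneg aa (fun _ => norm_nonneg _) (fun _ => norm_nonneg _)
      refine Summable.of_norm (ab.congr fun p => ?_)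
      simp only [Function.uncurry, hK, norm_mul, gth_norm]; ring
    have cn : ∀ k : ℤ, ∑' m, K m k = C * (1 / (-Complex.I * τ) ^ (1/2 : ℂ)) ^ n * ∑' j, gth' ax τ ξ (E (k, j)) := by
      intro k
      simp only [hK]
      rw [tsum_mul_left, hC τ hτ, mul_left_comm, ← tsum_mul_left]
      congr 1
      refine tsum_congr fun j => ?_
      simp only [gth', cx, hEa, Fin.cons_zero, Fin.cons_succ]
      rw [← Complex.exp_add]
      have : (fun i => (j i : ℚ) + (ξ i.succ - (k + ξ 0) * v i)) = (fun i => (j i : ℚ) + ξ i.succ - (k + ξ 0) * v i) := by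
        ext i; ring
      rw [this]
      congr 1; push_cast; field_simp; ring
    calc ∑' m, gth Q τ ξ m = ∑' p : ℤ × (Fin n → ℤ), gth Q τ ξ (E p) := (E.tsum_eq _).symm
      _ = ∑' m, ∑' p, gth Q τ ξ (E (p, m)) := by
        rw [← (Equiv.prodComm _ _).tsum_eq]
        exact Summable.tsum_prod ((Equiv.prodComm _ _).summable_iff.2 (E.summable_iff.2 hs1))
      _ = 1 / (-Complex.I * ((a:ℂ) * τ)) ^ (1/2:ℂ) * ∑' m, ∑' k, K m k := by
        rw [← tsum_mul_left]; exact tsum_congr f1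
      _ = 1 / (-Complex.I * ((a:ℂ) * τ)) ^ (1/2:ℂ) * ∑' k, ∑' m, K m k := by
        congr 1; exact hKs.tsum_comm.symm
      _ = 1 / (-Complex.I * ((a:ℂ) * τ)) ^ (1/2:ℂ) * (C * (1 / (-Complex.I * τ) ^ (1/2 : ℂ)) ^ n * ∑' k : ℤ, ∑' j, gth' ax τ ξ (E (k, j))) := by
        congr 1; rw [← tsum_mul_left]; exact tsum_congr cn
      _ = 1 / (-Complex.I * ((a:ℂ) * τ)) ^ (1/2:ℂ) * (C * (1 / (-Complex.I * τ) ^ (1/2 : ℂ)) ^ n * ∑' k, gth' ax τ ξ k) := by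
        congr 2
        rw [← E.tsum_eq (gth' ax τ ξ)]
        exact (Summable.tsum_prod (E.summable_iff.2 hs2)).symm
      _ = _ := by
        rw [cpow_w ha, pow_succ]
        ring
end theta2
section mf
open scoped ModularForm
theorem qpar_pow (τ : ℍ) (n : ℕ) : Function.Periodic.qParam 1 (τ:ℂ) ^ n = eC ((n:ℂ) * τ) := by
  rw [Function.Periodic.qParam, eC, ← Complex.exp_nat_mul]; congr 1; push_cast; ring
theorem mdiff_qser (c : ℕ → ℂ) (F : ℍ → ℂ)
    (hq : ∀ τ : ℍ, HasSum (fun n => c n * eC ((n:ℂ) * τ)) (F τ)) : MDifferentiable 𝓘(ℂ) 𝓘(ℂ) F := by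
  rw [UpperHalfPlane.mdifferentiable_iff]
  intro z hz
  have cb : 0 < z.im := hz
  set y : ℍ := ⟨(z.im / 2 : ℝ) * Complex.I, by simp; positivity⟩ with hy
  set U : Set ℂ := {w | z.im / 2 < w.im} with hU
  have hUo : IsOpen U := isOpen_lt continuous_const Complex.continuous_im
  have hn : ∀ (n : ℕ) (w : ℂ), ‖eC ((n:ℂ) * w)‖ = Real.exp (-(2 * π * n * w.im)) := by
    intro n w
    rw [eC, Complex.norm_exp]; congr 1
    have : 2 * (π:ℂ) * Complex.I * (n * w) = ((2 * π * n : ℝ) : ℂ) * (Complex.I * w) := by push_cast; ring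
    rw [this, Complex.re_ofReal_mul, Complex.I_mul_re]; ring
  have hd : DifferentiableOn ℂ (fun w => ∑' n, c n * eC ((n:ℂ) * w)) U := by
    refine Complex.differentiableOn_tsum_of_summable_norm (u := fun n => ‖c n * eC ((n:ℂ) * y)‖)
      (hq y).summable.norm ?_ hUo ?_
    · intro n; unfold eC; fun_prop
    · intro n w hw
      rw [norm_mul, norm_mul, hn, hn]
      refine mul_le_mul_of_nonneg_left ?_ (norm_nonneg _)
      rw [Real.exp_le_exp]
      have aa : (y:ℂ).im = z.im / 2 := by simp [hy]
      rw [aa]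
      have : z.im / 2 ≤ w.im := le_of_lt hw
      have := mul_le_mul_of_nonneg_left this (by positivity : (0:ℝ) ≤ 2 * π * n)
      linarith
  have hzU : z ∈ U := by simp [hU]; linarith
  refine ((hd.differentiableAt (hUo.mem_nhds hzU)).congr_of_eventuallyEq ?_).differentiableWithinAt
  filter_upwards [hUo.mem_nhds hzU] with w hw
  have hw0 : 0 < w.im := lt_trans (by positivity) (show z.im / 2 < w.im from hw)
  have := (hq ⟨w, hw0⟩).tsum_eq
  simp only [Function.comp, UpperHalfPlane.ofComplex_apply_of_im_pos hw0]
  rw [← this]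
theorem mkMF (k : ℤ) (F : ℍ → ℂ) (c : ℕ → ℂ)
    (hq : ∀ τ : ℍ, HasSum (fun n => c n * eC ((n:ℂ) * τ)) (F τ))
    (hS : ∀ τ : ℍ, F (ModularGroup.S • τ) = (τ:ℂ) ^ k * F τ) :
    ∃ f : ModularForm 𝒮ℒ k, ⇑f = F ∧ ∀ n, (qExpansion 1 f).coeff n = c n := by
  have hq' : ∀ τ : ℍ, HasSum (fun n => c n • Function.Periodic.qParam 1 (τ:ℂ) ^ n) (F τ) := by
    intro τ; simpa only [qpar_pow, smul_eq_mul] using hq τ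
  have hSS : F ∣[k] ModularGroup.S = F := by
    ext z
    rw [ModularForm.SL_slash_apply, hS]
    have aa : denom (ModularGroup.S : GL (Fin 2) ℝ) z = (z:ℂ) := ModularGroup.denom_S z
    rw [aa, mul_right_comm, ← zpow_add₀ (UpperHalfPlane.ne_zero z)]; simp
  have hTT : F ∣[k] ModularGroup.T = F := by
    ext z
    rw [ModularForm.SL_slash_apply]
    have aa : denom (ModularGroup.T : GL (Fin 2) ℝ) z = 1 := by rw [ModularGroup.denom_apply]; simp [ModularGroup.T]
    rw [aa, _root_.one_zpow, mul_one]
    refine (hq _).unique ?_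
    have e : ∀ n : ℕ, eC ((n:ℂ) * ((ModularGroup.T • z : ℍ) : ℂ)) = eC ((n:ℂ) * z) := by
      intro n
      rw [UpperHalfPlane.modular_T_smul, eC, eC]
      simp only [UpperHalfPlane.coe_vadd]
      rw [Complex.exp_eq_exp_iff_exists_int]
      exact ⟨n, by push_cast; ring⟩
    simp_rw [e]
    exact hq z
  have hall := SlashInvariantForm.slash_action_generators_SL2Z hSS hTT
  let f : ModularForm 𝒮ℒ k :=
    { toFun := F
      slash_action_eq' := by rintro A ⟨A, rfl⟩; exact hall A
      holo' := mdiff_qser c F hq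
      bdd_at_cusps' := by
        intro c' hc
        rw [Subgroup.IsArithmetic.isCusp_iff_isCusp_SL2Z] at hc
        rw [OnePoint.isBoundedAt_iff_forall_SL2Z hc]
        intro γ _
        rw [show F ∣[k] γ = F from hall γ]
        exact UpperHalfPlane.isBoundedAtImInfty_of_hasSum_qExpansion one_pos hq' }
  exact ⟨f, rfl, fun n => (ModularFormClass.qExpansion_coeff_unique one_pos
    (by simp) (f := f) hq' n).symm⟩
theorem sturm_q (k : ℤ) (F : ℍ → ℂ) (c : ℕ → ℂ) (av : ℕ)
    (hq : ∀ τ : ℍ, HasSum (fun n => c n * eC ((n:ℂ) * τ)) (F τ))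
    (hS : ∀ τ : ℍ, F (ModularGroup.S • τ) = (τ:ℂ) ^ k * F τ) (ag : ∀ n < av, c n = 0)
    (hk : k < 12 * av ∨ k = 2) : ∀ n, c n = 0 := by
  obtain ⟨f, -, hc⟩ := mkMF k F c hq hS
  have : f = 0 := by
    rcases hk with hk | rfl
    · rcases lt_or_ge k 0 with hk0 | hk0
      · exact rank_zero_iff_forall_zero.mp (ModularForm.levelOne_neg_weight_rank_zero hk0) f
      apply ModularForm.sturm_bound_levelOne
      have aa : ((av : ℕ) : ℕ∞) ≤ (qExpansion 1 f).order :=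
        PowerSeries.nat_le_order _ _ fun i hi => by rw [hc, ag i hi]
      refine lt_of_lt_of_le ?_ aa
      exact_mod_cast (by omega : k.toNat / 12 < av)
    · exact rank_zero_iff_forall_zero.mp ModularForm.levelOne_weight_two_rank_zero f
  intro n
  rw [← hc n, this]
  simp [qExpansion_zero]
end mf
section wt12
open ModularForm EisensteinSeries
theorem wt12 (f : ModularForm 𝒮ℒ 12) (ag : (qExpansion 1 f).coeff 0 = 1) (aa : (qExpansion 1 f).coeff 1 = 0) :
    (qExpansion 1 f).coeff 2 = 196560 ∧ (qExpansion 1 f).coeff 3 = 16773120 ∧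
    (qExpansion 1 f).coeff 4 = 398034000 := by
  have hp : (1:ℝ) ∈ (𝒮ℒ).strictPeriods := by simp
  set X : ModularForm 𝒮ℒ 12 := ModularForm.mcast (by decide) (E₄.pow 3) with hX
  set Y : ModularForm 𝒮ℒ 12 := ModularForm.mcast (by decide) (E₆.pow 2) with hY
  set g : ModularForm 𝒮ℒ 12 := (7/12 : ℂ) • X + (5/12 : ℂ) • Y with hg
  have b4 : bernoulli 4 = -1 / 30 := by decide +kernel
  have b6 : bernoulli 6 = 1 / 42 := by decide +kernel
  have a4 : ∀ m, (qExpansion 1 E₄).coeff m = if m = 0 then 1 else 240 * (ArithmeticFunction.sigma 3 m : ℂ) := by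
    intro m
    rw [E_qExpansion_coeff _ ⟨2, rfl⟩, b4]; norm_num
  have a6 : ∀ m, (qExpansion 1 E₆).coeff m = if m = 0 then 1 else -504 * (ArithmeticFunction.sigma 5 m : ℂ) := by
    intro m
    rw [E_qExpansion_coeff _ ⟨3, rfl⟩, b6]; norm_num
  have s31 : ArithmeticFunction.sigma 3 1 = 1 := by decide +kernel
  have s32 : ArithmeticFunction.sigma 3 2 = 9 := by decide +kernel
  have s33 : ArithmeticFunction.sigma 3 3 = 28 := by decide +kernel
  have s34 : ArithmeticFunction.sigma 3 4 = 73 := by decide +kernel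
  have s51 : ArithmeticFunction.sigma 5 1 = 1 := by decide +kernel
  have s52 : ArithmeticFunction.sigma 5 2 = 33 := by decide +kernel
  have s53 : ArithmeticFunction.sigma 5 3 = 244 := by decide +kernel
  have s54 : ArithmeticFunction.sigma 5 4 = 1057 := by decide +kernel
  have hq : qExpansion 1 g = (7/12 : ℂ) • (qExpansion 1 E₄ * qExpansion 1 E₄ * qExpansion 1 E₄) +
      (5/12 : ℂ) • (qExpansion 1 E₆ * qExpansion 1 E₆) := by
    have ah : qExpansion 1 X = qExpansion 1 E₄ ^ 3 := by
      rw [hX, coe_mcast, ModularForm.qExpansion_pow one_pos hp]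
    have aj : qExpansion 1 Y = qExpansion 1 E₆ ^ 2 := by
      rw [hY, coe_mcast, ModularForm.qExpansion_pow one_pos hp]
    rw [hg, FunLike.coe_add, ModularForm.qExpansion_add one_pos hp, FunLike.coe_smul, FunLike.coe_smul,
      ModularForm.qExpansion_smul one_pos hp, ModularForm.qExpansion_smul one_pos hp, ah, aj]
    congr 2 <;> ring
  have c : ∀ n, (qExpansion 1 g).coeff n = (7/12 : ℂ) * ((qExpansion 1 E₄ * qExpansion 1 E₄ * qExpansion 1 E₄).coeff n) +
      (5/12 : ℂ) * (qExpansion 1 E₆ * qExpansion 1 E₆).coeff n := by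
    intro n; rw [hq]; simp
  have g0 : (qExpansion 1 g).coeff 0 = 1 := by
    rw [c]; norm_num [PowerSeries.coeff_mul, Finset.Nat.antidiagonal_succ, a4, a6, -PowerSeries.coeff_zero_eq_constantCoeff]
  have g1 : (qExpansion 1 g).coeff 1 = 0 := by
    rw [c]; norm_num [PowerSeries.coeff_mul, Finset.Nat.antidiagonal_succ, a4, a6, s31, s51, -PowerSeries.coeff_zero_eq_constantCoeff]
  have hfg : f - g = 0 := by
    apply ModularForm.sturm_bound_levelOne
    refine lt_of_lt_of_le (?_ : _ < ((2:ℕ):ℕ∞)) (PowerSeries.nat_le_order _ _ fun i hi => ?_)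
    · exact_mod_cast (by decide : (12:ℤ).toNat / 12 < 2)
    rw [FunLike.coe_sub, ModularForm.qExpansion_sub one_pos hp, map_sub]
    interval_cases i
    · rw [ag, g0, sub_self]
    · rw [aa, g1, sub_self]
  rw [sub_eq_zero.1 hfg]
  refine ⟨?_, ?_, ?_⟩ <;> rw [c] <;>
  norm_num [PowerSeries.coeff_mul, Finset.Nat.antidiagonal_succ, a4, a6, s31, s51, s32, s33, s34, s52, s53, s54, -PowerSeries.coeff_zero_eq_constantCoeff]
end wt12
section leechTheta
variable {B : MZ}
def QB (B : MZ) (m : FT → ℚ) : ℚ := ∑ i, ∑ j, m i * (B i j : ℚ) * m j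
theorem QB_cq (m : LV) : QB B (cq m) = (pairZ B m m : ℤ) := by
  simp only [QB, cq, pairZ, dotProduct, mulVec]
  push_cast
  refine scg fun i _ => ?_
  rw [Finset.mul_sum]; exact scg fun j _ => by ring
theorem QB_pos (hB : IsLeech B) (m : FT → ℚ) (hm : m ≠ 0) : 0 < QB B m := by
  obtain ⟨D, hD⟩ := IsLocalization.exist_integer_multiples_of_finite (nonZeroDivisors ℤ) m
  have hD0 : (D : ℤ) ≠ 0 := nonZeroDivisors.coe_ne_zero D
  choose m' hm' using hD
  have aa : ∀ i, (m' i : ℚ) = (D:ℤ) * m i := by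
    intro i; have := hm' i
    simpa [Submonoid.smul_def] using this
  have ab : m' ≠ 0 := by
    intro h; apply hm; ext i
    have := aa i
    rw [h] at this
    have hDq : ((D:ℤ):ℚ) ≠ 0 := by exact_mod_cast hD0
    simpa [hDq, hD0] using this.symm
  have ae := hB.2.2.1 m' ab
  have al : QB B (cq m') = (D:ℤ) ^ 2 * QB B m := by
    simp only [QB, cq, aa, Finset.mul_sum]
    exact scg fun i _ => scg fun j _ => by ring
  rw [QB_cq] at al
  have ay : (0:ℚ) < (pairZ B m' m' : ℤ) := by exact_mod_cast ae
  rw [al] at ay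
  have hDq : (0:ℚ) < ((D:ℤ):ℚ) ^ 2 := by positivity
  exact (pos_iff_pos_of_mul_pos ay).1 hDq
theorem QB_DQ (hB : IsLeech B) : ∃ ax, DQ 24 (QB B) ax :=
  DQ.exists 24 (fun i j => (B i j : ℚ)) (fun i j => by
    have := congrFun (congrFun hB.1 j) i
    rw [Matrix.transpose_apply] at this
    exact_mod_cast this) (fun m hm => QB_pos hB m hm)
def thB (B : MZ) (τ : ℂ) : ℂ := ∑' m : LV, cexp (π * Complex.I * τ * (pairZ B m m : ℤ))
theorem thB_summable (hB : IsLeech B) {τ : ℂ} (hτ : 0 < τ.im) :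
    Summable fun m : LV => cexp (π * Complex.I * τ * (pairZ B m m : ℤ)) := by
  obtain ⟨ax, h⟩ := QB_DQ hB
  refine (h.summable hτ 0).of_norm.congr fun m => ?_
  simp [gth, dotq, QB_cq]
theorem thB_inv (hB : IsLeech B) {τ : ℂ} (hτ : 0 < τ.im) : thB B (-1/τ) = τ ^ 12 * thB B τ := by
  obtain ⟨ax, h⟩ := QB_DQ hB
  obtain ⟨C, hC⟩ := h.theta
  have hu : IsUnit B.det := by rw [hB.2.1]; exact isUnit_one
  let E : LV ≃ LV :=
    { toFun := B.mulVec
      invFun := B⁻¹.mulVec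
      left_inv := fun v => by simp [Matrix.mulVec_mulVec, Matrix.nonsing_inv_mul _ hu]
      right_inv := fun v => by simp [Matrix.mulVec_mulVec, Matrix.mul_nonsing_inv _ hu] }
  have hsym : ∀ i j, B i j = B j i := fun i j => by
    have := congrFun (congrFun hB.1 j) i
    rwa [Matrix.transpose_apply] at this
  have cx : ∀ m : LV, ax (cq (E m)) = (pairZ B m m : ℤ) := by
    intro m
    rw [← QB_cq]
    refine h.grad _ _ fun y => ?_
    have ah : dotq (cq (E m)) y = ∑ i, ∑ j, cq m i * (B i j : ℚ) * y j := by
      rw [Finset.sum_comm]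
      simp only [dotq, cq, E, Equiv.coe_fn_mk, mulVec, dotProduct]
      push_cast
      refine scg fun i _ => ?_
      rw [Finset.sum_mul]; exact scg fun j _ => by rw [hsym]; ring
    have aj : ∑ i, ∑ j, y i * (B i j : ℚ) * cq m j = ∑ i, ∑ j, cq m i * (B i j : ℚ) * y j := by
      rw [Finset.sum_comm]
      exact scg fun i _ => scg fun j _ => by rw [hsym]; ring
    rw [ah, two_mul]
    nth_rewrite 1 [← aj]
    simp only [QB, ← Finset.sum_add_distrib]
    exact scg fun i _ => scg fun j _ => by ring
  have main : ∀ τ : ℂ, 0 < τ.im → thB B τ = C * (τ ^ 12)⁻¹ * thB B (-1/τ) := by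
    intro τ hτ
    have aa := hC τ hτ 0
    have ah : ∑' m, gth (QB B) τ 0 m = thB B τ := by
      refine tsum_congr fun m => ?_
      simp [gth, dotq, QB_cq]
    have aj : ∑' m, gth' ax τ 0 m = thB B (-1/τ) := by
      rw [← E.tsum_eq, thB]
      refine tsum_congr fun m => ?_
      have : (fun i => ((E m i : ℤ):ℚ) + (0 : FT → ℚ) i) = cq (E m) := by ext i; simp [cq]
      rw [gth', this, cx]; simp
    rw [ah, aj] at aa
    rw [aa]
    congr 2
    rw [div_pow, one_pow, one_div]
    congr 1
    have : ((-Complex.I * τ) ^ (1/2:ℂ)) ^ 24 = (((-Complex.I * τ) ^ (1/2:ℂ)) ^ 2) ^ 12 := by ring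
    rw [this]
    have ab : ((-Complex.I * τ) ^ (1/2:ℂ)) ^ 2 = -Complex.I * τ := by
      have := Complex.cpow_nat_inv_pow (-Complex.I * τ) (n := 2) two_ne_zero
      rw [one_div]; exact_mod_cast this
    rw [ab, mul_pow]
    have : (-Complex.I) ^ 12 = 1 := by
      have : (-Complex.I) ^ 12 = (Complex.I ^ 2) ^ 6 := by ring
      rw [this, Complex.I_sq]; norm_num
    rw [this, one_mul]
  have hI := main Complex.I (by simp)
  have hne : thB B Complex.I ≠ 0 := by
    have hs := thB_summable hB (τ := Complex.I) (by simp)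
    have e : ∀ m : LV, cexp (π * Complex.I * Complex.I * (pairZ B m m : ℤ)) =
        ((Real.exp (- π * (pairZ B m m : ℤ)) : ℝ) : ℂ) := by
      intro m; push_cast; congr 1
      rw [mul_assoc (π:ℂ), Complex.I_mul_I]; ring
    rw [thB]
    simp_rw [e] at hs ⊢
    rw [← Complex.ofReal_tsum]
    have bv : Summable fun m : LV => Real.exp (- π * (pairZ B m m : ℤ)) := Complex.summable_ofReal.1 hs
    have : 0 < ∑' m : LV, Real.exp (- π * (pairZ B m m : ℤ)) :=
      bv.tsum_pos (fun _ => (Real.exp_pos _).le) 0 (Real.exp_pos _)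
    exact_mod_cast this.ne'
  have hI2 : (-1 / Complex.I) = Complex.I := by rw [div_eq_iff Complex.I_ne_zero, Complex.I_mul_I]
  have hC1 : C = 1 := by
    rw [hI2] at hI
    have : Complex.I ^ 12 = 1 := by
      have : Complex.I ^ 12 = (Complex.I ^ 2) ^ 6 := by ring
      rw [this, Complex.I_sq]; norm_num
    rw [this, inv_one, mul_one] at hI
    exact (mul_right_cancel₀ hne (by rw [one_mul]; exact hI)).symm
  have ag : τ ≠ 0 := by rintro rfl; simp at hτ
  have := main τ hτ
  rw [hC1, one_mul] at this
  rw [this]; field_simp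
def cntB (B : MZ) (n : ℕ) : ℕ := Nat.card {m : LV // pairZ B m m = 2 * (n:ℤ)}
theorem finB (hB : IsLeech B) (n : ℤ) : {m : LV | pairZ B m m = n}.Finite := by
  have hs := (thB_summable hB (τ := Complex.I) (by simp)).subtype {m : LV | pairZ B m m = n}
  have : Summable fun _ : {m : LV | pairZ B m m = n} => cexp (π * Complex.I * Complex.I * (n:ℤ)) := by
    refine hs.congr fun m => ?_
    simp only [Function.comp]; rw [show pairZ B m.1 m.1 = n from m.2]
  by_contra hi
  have hI : Infinite {m : LV | pairZ B m m = n} := Set.infinite_coe_iff.2 hi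
  rw [summable_const_iff] at this
  exact Complex.exp_ne_zero _ this
theorem thB_q (hB : IsLeech B) (τ : ℍ) : HasSum (fun n => (cntB B n : ℂ) * eC ((n:ℂ) * τ)) (thB B τ) := by
  have hev : ∀ m : LV, ∃ n : ℕ, pairZ B m m = 2 * (n:ℤ) := by
    intro m
    obtain ⟨r, hr⟩ := hB.2.2.2.1 m
    have : 0 ≤ pairZ B m m := by
      by_cases h : m = 0
      · simp [h, pairZ]
      · exact (hB.2.2.1 m h).le
    exact ⟨r.toNat, by omega⟩
  choose t ht using hev
  have hs := (thB_summable hB τ.im_pos).hasSum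
  rw [← (Equiv.sigmaFiberEquiv t).hasSum_iff] at hs
  refine hs.sigma fun n => ?_
  have e : ∀ m : {m : LV // t m = n}, cexp (π * Complex.I * (τ:ℂ) * (pairZ B m.1 m.1 : ℤ)) = eC ((n:ℂ) * τ) := by
    intro m; rw [ht, m.2, eC]; congr 1; push_cast; ring
  have hfin : Finite {m : LV // t m = n} := by
    exact (Set.Finite.subset (finB hB (2 * n)) (fun m (hm : t m = n) =>
      show pairZ B m m = 2 * (n:ℤ) by rw [ht, hm]) : ({m : LV | t m = n}).Finite).to_subtype
  have hc : cntB B n = Nat.card {m : LV // t m = n} := by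
    refine Nat.card_congr (Equiv.subtypeEquivRight fun m => ?_)
    rw [ht]; omega
  simp only [Function.comp, Equiv.sigmaFiberEquiv_apply, e]
  have := Fintype.ofFinite {m : LV // t m = n}
  rw [hc, Nat.card_eq_fintype_card]
  have ab := hasSum_fintype (fun _ : {m : LV // t m = n} => eC ((n:ℂ) * τ))
  simpa using ab
theorem cntB_vals (hB : IsLeech B) : cntB B 2 = 196560 ∧ cntB B 3 = 16773120 ∧ cntB B 4 = 398034000 := by
  obtain ⟨f, -, hc⟩ := mkMF 12 (fun τ => thB B τ) (fun n => cntB B n) (thB_q hB) (fun τ => by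
    rw [UpperHalfPlane.modular_S_smul]
    have := thB_inv hB τ.im_pos
    simp only [UpperHalfPlane.coe_mk]
    rw [show (-(τ:ℂ))⁻¹ = -1 / τ by rw [neg_div, one_div, inv_neg]]
    exact_mod_cast this)
  have h := wt12 f (by
    rw [hc]
    have : cntB B 0 = 1 := by
      rw [cntB, Nat.card_eq_one_iff_unique]
      refine ⟨⟨fun a b => Subtype.ext ?_⟩, ⟨0, by simp [pairZ]⟩⟩
      have : ∀ a : {m : LV // pairZ B m m = 2 * ((0:ℕ):ℤ)}, a.1 = 0 := by
        intro a; by_contra h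
        have aa := hB.2.2.1 a.1 h
        have ab := a.2
        push_cast at ab; omega
      rw [this, this]
    rw [this]; simp) (by
    rw [hc]
    have : cntB B 1 = 0 := by
      have : IsEmpty {m : LV // pairZ B m m = 2 * ((1:ℕ):ℤ)} := ⟨fun a => hB.2.2.2.2 a.1 (by have := a.2; simpa using this)⟩
      rw [cntB]; exact Nat.card_of_isEmpty
    rw [this]; simp)
  rw [hc, hc, hc] at h
  exact_mod_cast h
end leechTheta
section leechLL
variable {B : MZ}
def bB (B : MZ) : LV →ₗ[ℤ] LV →ₗ[ℤ] ℤ := Matrix.toLinearMap₂' ℤ B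
theorem bB_apply (x y : LV) : bB B x y = pairZ B x y := Matrix.toLinearMap₂'_apply' _ _ _
theorem bB_symm (hB : IsLeech B) (x y : LV) : bB B x y = bB B y x := by
  rw [bB_apply, bB_apply, pairZ, pairZ, Matrix.dotProduct_mulVec, dotProduct_comm, ← Matrix.mulVec_transpose, hB.1]
theorem bB_pos (hB : IsLeech B) (x : LV) (h : x ≠ 0) : 0 < bB B x x := by
  rw [bB_apply]; exact hB.2.2.1 x h
theorem bB_nz4 (hB : IsLeech B) (x : LV) (h : x ≠ 0) : 4 ≤ bB B x x := by
  have aa := bB_pos hB x h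
  rw [bB_apply] at *
  have ab := hB.2.2.2.1 x
  have ae := hB.2.2.2.2 x
  obtain ⟨r, hr⟩ := ab
  omega
theorem orth_card (hB : IsLeech B) {ι : Type} [Fintype ι] (v : ι → LV) (ag : ∀ i, v i ≠ 0)
    (ho : ∀ i j, i ≠ j → bB B (v i) (v j) = 0) : Fintype.card ι ≤ 24 := by
  have : LinearIndependent ℤ v := by
    rw [Fintype.linearIndependent_iff]
    intro g hg i
    have aa : bB B (∑ j, g j • v j) (v i) = 0 := by rw [hg]; simp
    rw [map_sum, LinearMap.sum_apply, Finset.sum_eq_single i] at aa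
    · simp only [map_smul, LinearMap.smul_apply, smul_eq_mul] at aa
      exact (mul_eq_zero.1 aa).resolve_right (bB_pos hB _ (ag i)).ne'
    · intro j _ hj
      rw [map_smul, LinearMap.smul_apply, ho j i hj, smul_zero]
    · simp
  simpa using this.fintype_card_le_finrank
def red2 (x : LV) : FT → ZMod 2 := fun i => (x i : ZMod 2)
theorem red2_eq {x y : LV} (h : red2 x = red2 y) : ∃ u, x = y + (2:ℤ) • u := by
  have : ∀ i, ∃ r, x i - y i = 2 * r := by
    intro i
    have aa := congrFun h i
    simp only [red2] at aa
    rw [ZMod.intCast_eq_intCast_iff_dvd_sub] at aa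
    obtain ⟨r, hr⟩ := aa
    refine ⟨-r, ?_⟩
    push_cast at hr; linarith
  choose u hu using this
  refine ⟨u, ?_⟩
  ext i; simp only [Pi.add_apply, Pi.smul_apply, smul_eq_mul]; linarith [hu i]
theorem short_pair (hB : IsLeech B) {x y : LV} (h : red2 x = red2 y) (hx : bB B x x ≤ 8) (hy : bB B y y ≤ 8)
    (aa : x ≠ y) (ab : x ≠ -y) : bB B x x = 8 ∧ bB B y y = 8 ∧ bB B x y = 0 := by
  obtain ⟨u, hu⟩ := red2_eq h
  have hu0 : u ≠ 0 := by rintro rfl; apply aa; simpa using hu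
  have hv0 : y + u ≠ 0 := by
    intro h; apply ab
    rw [hu, eq_neg_of_add_eq_zero_right h]; ext i; simp; ring
  have bx := bB_nz4 hB u hu0
  have a2 := bB_nz4 hB (y + u) hv0
  have s := bB_symm hB u y
  rw [hu] at hx ⊢
  simp only [map_add, map_smul, LinearMap.add_apply, LinearMap.smul_apply, smul_eq_mul] at *
  rw [s] at *
  refine ⟨by linarith, by linarith, by linarith⟩
theorem orth_frame (hB : IsLeech B) (T : Finset LV) (ao : ∀ x ∈ T, bB B x x = 8)
    (ho : ∀ x ∈ T, ∀ y ∈ T, x ≠ y → x ≠ -y → bB B x y = 0) (t : LV) (ht : t ∈ T) :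
    T.card ≤ 48 ∧ (T.card = 48 → ∃ a : FT → LV, (∀ i j, bB B (a i) (a j) = if i = j then 8 else 0) ∧
      a 0 = t ∧ ∀ i, a i ∈ T) := by
  classical
  obtain ⟨O, hO, hmax⟩ := Finset.exists_max_image
    (T.powerset.filter fun O => t ∈ O ∧ ∀ x ∈ O, ∀ y ∈ O, x ≠ y → bB B x y = 0) Finset.card
    ⟨{t}, by simp [ht]⟩
  simp only [Finset.mem_filter, Finset.mem_powerset] at hO hmax
  obtain ⟨hOT, htO, hOo⟩ := hO
  have hcov : T ⊆ O ∪ O.image (fun x => -x) := by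
    intro y hy
    by_contra hn
    simp only [Finset.mem_union, Finset.mem_image, not_or, not_exists, not_and] at hn
    have hz : ∀ x ∈ O, bB B y x = 0 := fun x hx => ho y hy x (hOT hx) (fun e => hn.1 (e ▸ hx))
      (fun e => hn.2 x hx e.symm)
    have := hmax (insert y O) ⟨Finset.insert_subset hy hOT, Finset.mem_insert_of_mem htO, by
      intro x hx z cb hne
      rw [Finset.mem_insert] at hx cb
      rcases hx with rfl | hx <;> rcases cb with rfl | cb
      · exact absurd rfl hne
      · exact hz z cb
      · rw [bB_symm hB]; exact hz x hx
      · exact hOo x hx z cb hne⟩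
    rw [Finset.card_insert_of_notMem hn.1] at this
    omega
  have hO24 : O.card ≤ 24 := by
    have := orth_card hB (fun x : O => x.1) (fun x h => by
      have := ao x.1 (hOT x.2); rw [h] at this; simp at this)
      (fun x y h => hOo x.1 x.2 y.1 y.2 (fun e => h (Subtype.ext e)))
    simpa using this
  have hc := (Finset.card_le_card hcov).trans (Finset.card_union_le _ _)
  have hc2 := Finset.card_image_le (s := O) (f := fun x : LV => -x)
  refine ⟨by omega, fun h48 => ?_⟩
  have hc3 : Fintype.card O = 24 := by rw [Fintype.card_coe]; omega
  let e := (Fintype.equivFinOfCardEq hc3).symm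
  let bk := (Equiv.swap 0 (e.symm ⟨t, htO⟩)).trans e
  refine ⟨fun i => (bk i).1, fun i j => ?_, ?_, fun i => hOT (bk i).2⟩
  · split_ifs with h
    · subst h; exact ao _ (hOT (bk i).2)
    · exact hOo _ (bk i).2 _ (bk j).2 (fun ai => h (bk.injective (Subtype.ext ai)))
  · simp [bk]
def nrm (B : MZ) (hB : IsLeech B) (n : ℤ) : Finset LV := (finB hB n).toFinset
theorem mem_nrm (hB : IsLeech B) (n : ℤ) (x : LV) : x ∈ nrm B hB n ↔ bB B x x = n := by
  simp [nrm, bB_apply]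
theorem card_nrm (hB : IsLeech B) (n : ℕ) : (nrm B hB (2 * n)).card = cntB B n := by
  rw [cntB, nrm, ← Set.ncard_eq_toFinset_card _ (finB hB _)]; rfl
def wgt (B : MZ) (x : LV) : ℕ :=
  if bB B x x = 0 then 48 else if bB B x x = 8 then 1 else 24
theorem wgt_class (hB : IsLeech B) (c : FT → ZMod 2) :
    ∑ x ∈ (nrm B hB 0 ∪ nrm B hB 4 ∪ nrm B hB 6 ∪ nrm B hB 8) with red2 x = c, wgt B x = 48 := by
  classical
  set S := nrm B hB 0 ∪ nrm B hB 4 ∪ nrm B hB 6 ∪ nrm B hB 8 with hS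
  have hmem : ∀ x, x ∈ S ↔ bB B x x = 0 ∨ bB B x x = 4 ∨ bB B x x = 6 ∨ bB B x x = 8 := by
    intro x; simp only [hS, Finset.mem_union, mem_nrm]; tauto
  have hle : ∀ c, ∑ x ∈ S with red2 x = c, wgt B x ≤ 48 := by
    intro c
    by_cases h : ∃ x ∈ S, red2 x = c ∧ bB B x x ≠ 8
    · obtain ⟨x, hx, hxc, hx8⟩ := h
      have hsub : S.filter (fun y => red2 y = c) ⊆ {x, -x} := by
        intro y hy
        rw [Finset.mem_filter] at hy
        by_contra hn
        simp only [Finset.mem_insert, Finset.mem_singleton, not_or] at hn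
        have aa := (hmem x).1 hx
        have ab := (hmem y).1 hy.1
        exact hx8 (short_pair hB (hy.2.trans hxc.symm) (by omega) (by omega) hn.1 hn.2).2.1
      refine (Finset.sum_le_sum_of_subset hsub).trans ?_
      by_cases hx0 : x = 0
      · subst hx0; simp [wgt]
      · have h24 : ∀ y ∈ ({x, -x} : Finset LV), wgt B y ≤ 24 := by
          intro y hy
          have := bB_pos hB x hx0
          rcases Finset.mem_insert.1 hy with rfl | hy
          · simp [wgt, hx8, this.ne']
          · rw [Finset.mem_singleton.1 hy]; simp [wgt, hx8, hx0, this.ne']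
        have := Finset.sum_le_card_nsmul _ _ _ h24
        have ab := Finset.card_le_two (a := x) (b := -x)
        rw [smul_eq_mul] at this; exact this.trans (by omega)
    · push Not at h
      by_cases hne : ∃ t, t ∈ S.filter (fun y => red2 y = c)
      · obtain ⟨t, ht⟩ := hne
        have ao : ∀ x ∈ S.filter (fun y => red2 y = c), bB B x x = 8 := fun x hx => by
          rw [Finset.mem_filter] at hx; exact h x hx.1 hx.2
        have := (orth_frame hB _ ao (fun x hx y hy aa ab => by
          rw [Finset.mem_filter] at hx hy
          exact (short_pair hB (hx.2.trans hy.2.symm) (h x hx.1 hx.2).le (h y hy.1 hy.2).le aa ab).2.2) t ht).1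
        rw [Finset.sum_congr rfl (g := fun _ => 1) (fun x hx => by simp [wgt, ao x hx])]
        simpa using this
      · push Not at hne
        rw [Finset.eq_empty_of_forall_notMem hne]; simp
  have htot : ∑ c, ∑ x ∈ S with red2 x = c, wgt B x = ∑ c : FT → ZMod 2, 48 := by
    rw [Finset.sum_fiberwise]
    have hd : ∀ a b : ℤ, a ≠ b → Disjoint (nrm B hB a) (nrm B hB b) := by
      intro a b hab; rw [Finset.disjoint_left]; intro x aa ab
      rw [mem_nrm] at aa ab; exact hab (aa.symm.trans ab)
    have hw : ∀ (a : ℤ) (w : ℕ), (∀ x, bB B x x = a → wgt B x = w) → ∑ x ∈ nrm B hB a, wgt B x = (nrm B hB a).card * w := by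
      intro a w h
      rw [Finset.sum_congr rfl (g := fun _ => w) (fun x hx => h x ((mem_nrm hB _ _).1 hx))]; simp
    rw [hS, Finset.sum_union, Finset.sum_union, Finset.sum_union,
      hw 0 48 (fun x h => by simp [wgt, h]), hw 4 24 (fun x h => by simp [wgt, h]),
      hw 6 24 (fun x h => by simp [wgt, h]), hw 8 1 (fun x h => by simp [wgt, h])]
    · obtain ⟨aj, bc, br⟩ := cntB_vals hB
      have cn := card_nrm hB 2
      have f3 := card_nrm hB 3
      have f4 := card_nrm hB 4
      have f0 : nrm B hB 0 = {0} := by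
        ext x; rw [mem_nrm, Finset.mem_singleton]
        refine ⟨fun h => ?_, fun h => by simp [h]⟩
        by_contra ai; exact (bB_pos hB x ai).ne' h
      norm_num at cn f3 f4
      rw [cn, f3, f4, f0, aj, bc, br]
      simp
    · exact hd _ _ (by norm_num)
    · rw [Finset.disjoint_union_left]; exact ⟨hd _ _ (by norm_num), hd _ _ (by norm_num)⟩
    · rw [Finset.disjoint_union_left, Finset.disjoint_union_left]
      exact ⟨⟨hd _ _ (by norm_num), hd _ _ (by norm_num)⟩, hd _ _ (by norm_num)⟩
  exact (Finset.sum_eq_sum_iff_of_le (fun c _ => hle c)).1 htot c (Finset.mem_univ _)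
theorem leechLL (hB : IsLeech B) : LL (bB B) where
  symm := bB_symm hB
  pos := bB_pos hB
  even x := by
    rw [bB_apply]; obtain ⟨r, hr⟩ := hB.2.2.2.1 x; omega
  no2 x := by rw [bB_apply]; exact hB.2.2.2.2 x
  unim f := by
    have hu : IsUnit B.det := by rw [hB.2.1]; exact isUnit_one
    refine ⟨Matrix.vecMul (fun i => f (Pi.single i 1)) B⁻¹, fun y => ?_⟩
    rw [bB_apply, pairZ, Matrix.dotProduct_mulVec, Matrix.vecMul_vecMul, Matrix.nonsing_inv_mul _ hu,
      Matrix.vecMul_one]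
    conv_rhs => rw [← Finset.univ_sum_single y, map_sum]
    rw [dotProduct]
    refine scg fun i _ => ?_
    rw [show (Pi.single i (y i) : LV) = y i • Pi.single i 1 by rw [← Pi.single_smul]; simp, map_smul,
      smul_eq_mul, mul_comm]
  rank a ha x := by
    by_contra hne
    set z := (8:ℤ) • x - ∑ i, bB B x (a i) • a i with hz
    have hz0 : z ≠ 0 := sub_ne_zero.2 hne
    have hza : ∀ i, bB B z (a i) = 0 := by
      intro i
      rw [hz, map_sub, LinearMap.sub_apply, map_sum, LinearMap.sum_apply, Finset.sum_eq_single i]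
      · rw [map_smul, map_smul, LinearMap.smul_apply, LinearMap.smul_apply, ha, if_pos rfl, smul_eq_mul, smul_eq_mul]; ring
      · intro j _ hj; rw [map_smul, LinearMap.smul_apply, ha, if_neg hj, smul_zero]
      · simp
    have := orth_card hB (fun o : Option FT => o.elim z a) (by
      rintro (_ | i)
      · exact hz0
      · intro h
        have aa := ha i i
        change a i = 0 at h
        rw [h] at aa; simp at aa) (by
      rintro (_ | i) (_ | j) h
      · exact absurd rfl h
      · exact hza j
      · rw [bB_symm hB]; exact hza i
      · have : i ≠ j := fun e => h (by rw [e])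
        simp [ha, this])
    simp at this
  rep x := by
    have h := wgt_class hB (red2 x)
    obtain ⟨t, ht⟩ : ((nrm B hB 0 ∪ nrm B hB 4 ∪ nrm B hB 6 ∪ nrm B hB 8).filter fun t => red2 t = red2 x).Nonempty := by
      by_contra hn
      rw [Finset.not_nonempty_iff_eq_empty] at hn
      rw [hn] at h; simp at h
    simp only [Finset.mem_filter, Finset.mem_union, mem_nrm] at ht
    obtain ⟨y, hy⟩ := red2_eq ht.2.symm
    exact ⟨t, y, hy, by tauto⟩
  frame t ht := by
    have h := wgt_class hB (red2 t)
    set T := (nrm B hB 0 ∪ nrm B hB 4 ∪ nrm B hB 6 ∪ nrm B hB 8).filter fun x => red2 x = red2 t with hT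
    have hmem : ∀ x, x ∈ T → bB B x x ≤ 8 ∧ red2 x = red2 t := by
      intro x hx
      simp only [hT, Finset.mem_filter, Finset.mem_union, mem_nrm] at hx
      refine ⟨?_, hx.2⟩
      rcases hx.1 with ((h | h) | h) | h <;> omega
    have ao : ∀ x ∈ T, bB B x x = 8 := by
      intro x hx
      obtain ⟨aa, ab⟩ := hmem x hx
      by_cases ah : x = t
      · rw [ah, ht]
      by_cases aj : x = -t
      · rw [aj]; simpa using ht
      exact (short_pair hB ab aa ht.le ah aj).1
    obtain ⟨-, hf⟩ := orth_frame hB T ao (fun x hx y hy aa ab =>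
      (short_pair hB ((hmem x hx).2.trans (hmem y hy).2.symm) (ao x hx).le (ao y hy).le aa ab).2.2) t (by
        simp [hT, mem_nrm, ht])
    rw [Finset.sum_congr rfl (g := fun _ => 1) (fun x hx => by simp [wgt, ao x hx])] at h
    obtain ⟨a, aa, ab, ae⟩ := hf (by simpa using h)
    exact ⟨a, aa, ab, fun i => red2_eq (hmem _ (ae i)).2⟩
  ex8 := by
    have h := (cntB_vals hB).2.2
    rw [← card_nrm hB 4] at h
    obtain ⟨t, ht⟩ := Finset.card_pos.1 (by rw [h]; norm_num)
    rw [mem_nrm] at ht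
    exact ⟨t, by simpa using ht⟩
end leechLL
theorem hs_of {ι : Type} {f g : ι → ℂ} {a b : ℂ} (h : HasSum g b) (hf : ∀ i, f i = g i) (ha : a = b) : HasSum f a := by
  rw [funext hf, ha]; exact h
section fourierUniq
attribute [local instance] instMeasureSpaceUnitAddCircle
local instance : MeasureTheory.IsProbabilityMeasure (MeasureTheory.volume : MeasureTheory.Measure UnitAddCircle) :=
  inferInstanceAs (MeasureTheory.IsProbabilityMeasure AddCircle.haarAddCircle)
theorem torus_uniq {d : Type} [Fintype d] (c : (d → ℤ) → ℂ)
    (h : ∀ w : d → ℝ, HasSum (fun n => c n * eC ((∑ i, (n i : ℝ) * w i : ℝ) : ℂ)) 0) : c = 0 := by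
  have hs : Summable c := by
    have := (h 0).summable
    simpa [eC] using this
  have hF : HasSum (fun n => c n • UnitAddTorus.mFourier n) (0 : C(UnitAddTorus d, ℂ)) := by
    have hsm : Summable (fun n => c n • UnitAddTorus.mFourier n) := by
      refine Summable.of_norm ?_
      simpa [norm_smul, UnitAddTorus.mFourier_norm] using hs.norm
    have aa := hsm.hasSum
    convert aa using 1
    ext x
    have ab := aa.mapL (ContinuousMap.evalCLM ℂ x)
    choose w hw using fun i => QuotientAddGroup.mk_surjective (x i)
    have hx : x = fun i => ((w i : ℝ) : UnitAddCircle) := by ext1 i; exact (hw i).symm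
    have ae := h w
    refine HasSum.unique (f := fun n => c n * eC ((∑ i, (n i : ℝ) * w i : ℝ) : ℂ)) ae ?_
    change HasSum _ ((∑' (b : d → ℤ), c b • UnitAddTorus.mFourier b) x) at ab
    convert ab using 1
    ext n
    simp only [ContinuousMap.evalCLM_apply, ContinuousMap.smul_apply, smul_eq_mul, UnitAddTorus.mFourier, ContinuousMap.coe_mk, hx,
      fourier_coe_apply, eC, ← Complex.exp_sum]
    congr 2
    push_cast
    rw [Finset.mul_sum]
    exact scg fun i _ => by simp; ring
  ext n
  have aa := hF.mapL ((innerSL ℂ (UnitAddTorus.mFourierLp 2 n)).comp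
    (ContinuousMap.toLp (E := ℂ) 2 MeasureTheory.volume ℂ))
  have ab : HasSum (fun m => if m = n then c n else 0) 0 := by
    rw [map_zero] at aa
    refine hs_of aa (fun m => ?_) rfl
    symm
    have := (orthonormal_iff_ite.1 (UnitAddTorus.orthonormal_mFourier (d := d))) n m
    simp only [ContinuousLinearMap.comp_apply, map_smul, innerSL_apply_apply, smul_eq_mul]
    rw [this]
    by_cases e : m = n
    · simp [e]
    · simp [e, Ne.symm e]
  exact (hasSum_ite_eq n (c n)).unique ab
variable {B : MZ}
def zterm (B : MZ) (p : ℤ × LV) (τ : ℍ) (z : CV) : ℂ :=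
  eC ((p.1 : ℂ) * τ + pairC B (liftC p.2) z)
theorem pairC_lift (x y : LV) : pairC B (liftC x) (liftC y) = (bB B x y : ℤ) := by
  rw [bB_apply]
  simp only [pairC, pairZ, liftC, dotProduct, mulVec, Matrix.map_apply]
  push_cast; rfl
theorem pairC_add (x y z : CV) : pairC B (x + y) z = pairC B x z + pairC B y z := add_dotProduct _ _ _
theorem pairC_add' (x y z : CV) : pairC B z (x + y) = pairC B z x + pairC B z y := by
  simp [pairC, Matrix.mulVec_add]
theorem pairC_smul (a : ℂ) (x y : CV) : pairC B (a • x) y = a * pairC B x y := smul_dotProduct _ _ _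
theorem pairC_smul' (a : ℂ) (x y : CV) : pairC B x (a • y) = a * pairC B x y := by
  simp [pairC, Matrix.mulVec_smul]
theorem pairC_neg (x y : CV) : pairC B (-x) y = - pairC B x y := neg_dotProduct _ _
theorem pairC_neg' (x y : CV) : pairC B x (-y) = - pairC B x y := by
  simp [pairC, Matrix.mulVec_neg]
theorem zuniq (hB : IsLeech B) (F G : ℤ × LV → ℂ) (φ : ℍ → CV → ℂ)
    (hF : ∀ τ z, HasSum (fun p => F p * zterm B p τ z) (φ τ z))
    (hG : ∀ τ z, HasSum (fun p => G p * zterm B p τ z) (φ τ z)) : F = G := by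
  have hu : IsUnit B.det := by rw [hB.2.1]; exact isUnit_one
  set e := Fin.consEquiv (n := 24) (fun _ => ℤ) with he
  have ag : ∀ p : ℤ × LV, eC ((p.1 : ℂ) * Complex.I) ≠ 0 := fun p => Complex.exp_ne_zero _
  have key := torus_uniq (d := Fin 25) (fun n => (F (e.symm n) - G (e.symm n)) * eC (((e.symm n).1 : ℂ) * Complex.I)) (by
    intro w
    let τ : ℍ := ⟨w 0 + Complex.I, by simp⟩
    let z : CV := ((B⁻¹).map (Int.cast : ℤ → ℂ)).mulVec (fun i => (w i.succ : ℂ))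
    have aa := (hF τ z).sub (hG τ z)
    rw [sub_self, ← e.symm.hasSum_iff] at aa
    refine hs_of aa (fun n => ?_) rfl
    change _ = F (e.symm n) * zterm B (e.symm n) τ z - G (e.symm n) * zterm B (e.symm n) τ z
    rw [← sub_mul, mul_assoc]
    congr 1
    rw [zterm, eC, eC, eC, ← Complex.exp_add]
    congr 1
    rw [← mul_add]
    congr 1
    have hp : pairC B (liftC (e.symm n).2) z = ∑ i : FT, (n i.succ : ℂ) * w i.succ := by
      have : (B.map (Int.cast : ℤ → ℂ)) * ((B⁻¹).map (Int.cast : ℤ → ℂ)) = 1 := by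
        have := congrArg (fun M : MZ => M.map (Int.castRingHom ℂ)) (Matrix.mul_nonsing_inv B hu)
        simp only [Matrix.map_mul] at this
        rw [Matrix.map_one _ (map_zero _) (map_one _)] at this
        exact this
      simp only [pairC, z, Matrix.mulVec_mulVec, this, Matrix.one_mulVec, dotProduct, liftC]
      rfl
    rw [hp, Fin.sum_univ_succ]
    have : (e.symm n).1 = n 0 := rfl
    rw [this]
    push_cast
    simp only [τ, UpperHalfPlane.coe_mk]
    ring)
  ext p
  have := congrFun key (e p)
  simp only [Equiv.symm_apply_apply, Pi.zero_apply] at this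
  exact sub_eq_zero.1 ((mul_eq_zero.1 this).resolve_right (ag p))
def extF (f : ℕ → LV → ℂ) (p : ℤ × LV) : ℂ := if 0 ≤ p.1 then f p.1.toNat p.2 else 0
theorem extF_hasSum {k : ℤ} {φ : ℍ → CV → ℂ} {f : ℕ → LV → ℂ} (h : IsJacobiFormWith B k 3 φ f) (τ : ℍ) (z : CV) :
    HasSum (fun p => extF f p * zterm B p τ z) (φ τ z) := by
  have aa := h.expansion τ z
  let i : ℕ × LV → ℤ × LV := fun p => (p.1, p.2)
  have hi : Function.Injective i := by
    rintro ⟨a, b⟩ ⟨c, d⟩ h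
    simp only [i, Prod.mk.injEq, Nat.cast_inj] at h
    rw [h.1, h.2]
  rw [← hi.hasSum_iff]
  · convert aa using 1
    ext p
    simp only [Function.comp, i, extF, zterm, fterm, eC, mul_add, Complex.exp_add]
    simp
  · intro p hp
    have : ¬ 0 ≤ p.1 := fun ag => hp ⟨(p.1.toNat, p.2), by
      simp only [i]; rw [Int.toNat_of_nonneg ag]⟩
    simp [extF, this]
theorem extF_shift (hB : IsLeech B) {k : ℤ} {φ : ℍ → CV → ℂ} {f : ℕ → LV → ℂ} (h : IsJacobiFormWith B k 3 φ f)
    (x : LV) (r : ℤ) (hr : 2 * r = bB B x x) (n : ℤ) (ℓ : LV) :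
    extF f (n + bB B ℓ x + 3 * r, ℓ + (3:ℤ) • x) = extF f (n, ℓ) := by
  let e : ℤ × LV ≃ ℤ × LV :=
    { toFun := fun p => (p.1 + bB B p.2 x + 3 * r, p.2 + (3:ℤ) • x)
      invFun := fun p => (p.1 - bB B (p.2 - (3:ℤ) • x) x - 3 * r, p.2 - (3:ℤ) • x)
      left_inv := fun p => by ext1 <;> simp <;> ring
      right_inv := fun p => by ext1 <;> simp <;> ring }
  have key := zuniq hB (extF f) (fun p => extF f (e p)) (φ := φ) (extF_hasSum h) (fun τ z => by
    have aa := extF_hasSum h τ (z + (τ:ℂ) • liftC (-x) + liftC 0)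
    rw [h.quasi_periodic, ← e.hasSum_iff] at aa
    have hx : liftC (-x) = - liftC x := by ext i; simp [liftC]
    have ag : liftC 0 = 0 := by ext i; simp [liftC]
    have ab := aa.mul_left (eC (3 * r * τ - 3 * pairC B (liftC x) z))
    refine hs_of ab (fun p => ?_) ?_
    · simp only [Function.comp]
      rw [mul_left_comm]
      congr 1
      rw [zterm, zterm, eC, eC, eC, ← Complex.exp_add]
      congr 1
      rw [← mul_add]
      congr 1
      have ah : liftC (e p).2 = liftC p.2 + (3:ℂ) • liftC x := by ext i; simp [liftC, e]
      have aj : (((e p).1 : ℤ) : ℂ) = p.1 + (bB B p.2 x : ℤ) + 3 * r := by simp [e]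
      have bp : (2:ℂ) * r = (bB B x x : ℤ) := by rw [← hr]; push_cast; ring
      rw [ah, aj, hx, ag]
      simp only [pairC_add, pairC_add', pairC_smul, pairC_smul', pairC_neg', pairC_lift, smul_neg, add_zero]
      rw [← bp]; ring
    · rw [hx, pairC_neg, ← mul_assoc, eC, ← Complex.exp_add]
      have bp : (2:ℂ) * r = (bB B x x : ℤ) := by rw [← hr]; push_cast; ring
      have bc : pairZ B (-x) (-x) = bB B x x := by rw [← bB_apply]; simp
      rw [bc, ← bp]
      nth_rewrite 1 [← one_mul (φ τ z), ← Complex.exp_zero]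
      congr 2
      push_cast; ring)
  exact (congrFun key (n, ℓ)).symm
theorem isom_conway (hB : IsLeech B) (σ : LV →ₗ[ℤ] LV) (hσ : Isom (bB B) σ) :
    LinearMap.toMatrix' σ ∈ ConwayGroup B := by
  have aa : (LinearMap.toMatrix' σ)ᵀ * B * LinearMap.toMatrix' σ = B := by
    apply (Matrix.toLinearMap₂' ℤ : MZ ≃ₗ[ℤ] LV →ₗ[ℤ] LV →ₗ[ℤ] ℤ).injective
    refine LinearMap.ext fun x => LinearMap.ext fun y => ?_
    have := hσ x y
    simp only [bB, Matrix.toLinearMap₂'_apply', ] at this ⊢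
    rw [← this, ← LinearMap.toMatrix'_mulVec σ x, ← LinearMap.toMatrix'_mulVec σ y, ← Matrix.mulVec_mulVec, ← Matrix.mulVec_mulVec,
      Matrix.dotProduct_mulVec x, Matrix.vecMul_transpose]
  refine ⟨?_, aa⟩
  have ab := congrArg Matrix.det aa
  rw [Matrix.det_mul, Matrix.det_mul, Matrix.det_transpose, hB.2.1, mul_one] at ab
  exact IsUnit.of_mul_eq_one _ ab
theorem extF_inv (hB : IsLeech B) {k : ℤ} {φ : ℍ → CV → ℂ} {f : ℕ → LV → ℂ} (h : IsJacobiFormWith B k 3 φ f)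
    (σ : LV →ₗ[ℤ] LV) (hσ : Isom (bB B) σ) (n : ℤ) (ℓ : LV) :
    extF f (n, σ ℓ) = extF f (n, ℓ) := by
  obtain ⟨hu, hm⟩ := isom_conway hB σ hσ
  set M := LinearMap.toMatrix' σ with hM
  have hσM : ∀ x, σ x = M.mulVec x := fun x => (LinearMap.toMatrix'_mulVec σ x).symm
  let bl : LV ≃ LV :=
    { toFun := M.mulVec
      invFun := M⁻¹.mulVec
      left_inv := fun v => by simp [Matrix.mulVec_mulVec, Matrix.nonsing_inv_mul _ hu]
      right_inv := fun v => by simp [Matrix.mulVec_mulVec, Matrix.mul_nonsing_inv _ hu] }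
  let e : ℤ × LV ≃ ℤ × LV := Equiv.prodCongr (Equiv.refl ℤ) bl
  have hmC : (M.map (Int.cast : ℤ → ℂ))ᵀ * B.map (Int.cast : ℤ → ℂ) * M.map (Int.cast : ℤ → ℂ) = B.map (Int.cast : ℤ → ℂ) := by
    have := congrArg (fun M : MZ => M.map (Int.castRingHom ℂ)) hm
    simp only [Matrix.map_mul] at this
    exact this
  have key := zuniq hB (extF f) (fun p => extF f (e p)) (φ := φ) (extF_hasSum h) (fun τ z => by
    have aa := extF_hasSum h τ (actC M z)
    rw [h.conway_invar M ⟨hu, hm⟩, ← e.hasSum_iff] at aa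
    refine hs_of aa (fun p => ?_) rfl
    simp only [Function.comp]
    congr 1
    rw [zterm, zterm]
    congr 2
    have ah : liftC (e p).2 = (M.map (Int.cast : ℤ → ℂ)).mulVec (liftC p.2) := by
      ext i; simp [e, bl, liftC, mulVec, dotProduct]
    rw [ah, pairC, pairC, actC]
    nth_rewrite 1 [← hmC]
    rw [← Matrix.mulVec_mulVec, ← Matrix.mulVec_mulVec, Matrix.dotProduct_mulVec (liftC p.2), Matrix.vecMul_transpose])
  rw [hσM]
  exact (congrFun key (n, ℓ)).symm
theorem phi_even {k : ℤ} {φ : ℍ → CV → ℂ} {f : ℕ → LV → ℂ} (h : IsJacobiFormWith B k 3 φ f)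
    (τ : ℍ) (z : CV) : φ τ (-z) = φ τ z := by
  have := h.conway_invar (-1) ⟨by rw [Matrix.det_neg]; simp, by simp⟩ τ z
  rw [← this]; congr 1
  rw [actC, show (-1 : MZ).map (Int.cast : ℤ → ℂ) = -1 by
    ext i j; simp [Matrix.one_apply]]
  simp [Matrix.neg_mulVec]
theorem phi_odd {k : ℤ} {φ : ℍ → CV → ℂ} {f : ℕ → LV → ℂ} (h : IsJacobiFormWith B k 3 φ f)
    (hk : Odd k) (τ : ℍ) (z : CV) : φ τ z = 0 := by
  have := h.modular (-1) τ z
  have hj : jfactor (-1) τ = -1 := by simp [jfactor, slc, sld]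
  have hs : slc (-1) = 0 := by simp [slc]
  rw [hj, hs, hk.neg_one_zpow] at this
  simp [phi_even h] at this
  have ab : (2:ℂ) * φ τ z = 0 := by linear_combination this
  simpa using ab
end fourierUniq
section taylor
theorem tl (a : ℕ → ℂ) (G : ℂ → ℂ) (h : ∀ w, HasSum (fun d => a d * w ^ d) (G w)) (m : ℕ) :
    ∃ R : ℂ → ℂ, ContinuousAt R 0 ∧ R 0 = a m ∧ ∀ w, G w = ∑ d ∈ Finset.range m, a d * w ^ d + w ^ m * R w := by
  have hs : Summable fun d => ‖a (d + m)‖ := by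
    have := (h 1).summable.norm
    simp only [one_pow, mul_one] at this
    exact (summable_nat_add_iff m).2 this
  refine ⟨fun w => ∑' d, a (d + m) * w ^ d, ?_, ?_, fun w => ?_⟩
  · have : ContinuousOn (fun w => ∑' d, a (d + m) * w ^ d) (Metric.ball (0:ℂ) 1) := by
      refine continuousOn_tsum (fun d => by fun_prop) hs fun d w hw => ?_
      rw [norm_mul, norm_pow]
      refine mul_le_of_le_one_right (norm_nonneg _) (pow_le_one₀ (norm_nonneg _) ?_)
      rw [mem_ball_zero_iff] at hw; exact hw.le
    exact this.continuousAt (Metric.ball_mem_nhds _ one_pos)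
  · show ∑' d, a (d + m) * (0:ℂ) ^ d = a m
    rw [tsum_eq_single 0 (fun d hd => by simp [hd])]; simp
  · rw [← (h w).tsum_eq, ← (h w).summable.sum_add_tsum_nat_add m, ← tsum_mul_left]
    congr 1
    exact tsum_congr fun d => by ring
theorem eq_at0 {P Q : ℂ → ℂ} (hP : ContinuousAt P 0) (hQ : ContinuousAt Q 0) (h : ∀ w, w ≠ 0 → P w = Q w) : P 0 = Q 0 := by
  have aa := hP.tendsto.mono_left (nhdsWithin_le_nhds (s := {0}ᶜ))
  have ab := hQ.tendsto.mono_left (nhdsWithin_le_nhds (s := {0}ᶜ))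
  refine tendsto_nhds_unique (aa.congr' ?_) ab
  filter_upwards [self_mem_nhdsWithin] with w hw using h w hw
theorem dbl {ι : Type} (A : ι → ℂ) (s : ι → ℝ) (h : ∀ y : ℝ, Summable fun i => A i * Real.exp (s i * y)) (w : ℂ) :
    Summable fun p : ι × ℕ => A p.1 * (Complex.I * s p.1) ^ p.2 / (p.2.factorial : ℂ) * w ^ p.2 := by
  refine Summable.of_norm ?_
  have e : ∀ p : ι × ℕ, ‖A p.1 * (Complex.I * s p.1) ^ p.2 / (p.2.factorial : ℂ) * w ^ p.2‖ =
      ‖A p.1‖ * ((|s p.1| * ‖w‖) ^ p.2 / p.2.factorial) := by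
    intro p
    rw [norm_mul, norm_div, norm_mul, norm_pow, norm_pow, norm_mul, Complex.norm_I, Complex.norm_real, Complex.norm_natCast, mul_pow, one_pow, one_mul, Real.norm_eq_abs]
    ring
  have he : ∀ x : ℝ, HasSum (fun d : ℕ => x ^ d / d.factorial) (Real.exp x) := by
    intro x; rw [Real.exp_eq_exp_ℝ]; exact NormedSpace.expSeries_div_hasSum_exp x
  refine Summable.congr (f := fun p : ι × ℕ => ‖A p.1‖ * ((|s p.1| * ‖w‖) ^ p.2 / p.2.factorial)) ?_ fun p => (e p).symm
  have hnn : 0 ≤ fun p : ι × ℕ => ‖A p.1‖ * ((|s p.1| * ‖w‖) ^ p.2 / p.2.factorial) := fun p =>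
    mul_nonneg (norm_nonneg _) (div_nonneg (pow_nonneg (mul_nonneg (abs_nonneg _) (norm_nonneg _)) _) (Nat.cast_nonneg _))
  have hA : ∀ i, HasSum (fun d : ℕ => ‖A i‖ * ((|s i| * ‖w‖) ^ d / d.factorial)) (‖A i‖ * Real.exp (|s i| * ‖w‖)) :=
    fun i => (he _).mul_left _
  refine (summable_prod_of_nonneg hnn).2 ⟨fun i => (hA i).summable, ?_⟩
  refine Summable.congr (f := fun i => ‖A i‖ * Real.exp (|s i| * ‖w‖)) ?_ fun i => (hA i).tsum_eq.symm
  refine Summable.of_nonneg_of_le (fun i => mul_nonneg (norm_nonneg _) (Real.exp_nonneg _)) (fun i => ?_) ((h ‖w‖).norm.add (h (-‖w‖)).norm)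
  rw [norm_mul, norm_mul, Complex.norm_real, Complex.norm_real, Real.norm_eq_abs, Real.norm_eq_abs, Real.abs_exp, Real.abs_exp, ← mul_add]
  refine mul_le_mul_of_nonneg_left ?_ (norm_nonneg _)
  rcases abs_cases (s i) with ⟨aa, _⟩ | ⟨aa, _⟩ <;> rw [aa]
  · exact le_add_of_nonneg_right (Real.exp_nonneg _)
  · rw [show -s i * ‖w‖ = s i * -‖w‖ by ring]; exact le_add_of_nonneg_left (Real.exp_nonneg _)
variable {B : MZ}
def hco (B : MZ) (f : ℕ → LV → ℂ) (u : LV) (d : ℕ) (τ : ℍ) : ℂ :=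
  ∑' p : ℕ × LV, f p.1 p.2 * eC ((p.1:ℂ) * τ) * (Complex.I * ((2 * π * (bB B p.2 u : ℤ) : ℝ) : ℂ)) ^ d / (d.factorial : ℂ)
def cco (B : MZ) (f : ℕ → LV → ℂ) (u : LV) (d n : ℕ) : ℂ :=
  ∑' ℓ : LV, f n ℓ * ((Complex.I * ((2 * π * (bB B ℓ u : ℤ) : ℝ) : ℂ)) ^ d / (d.factorial : ℂ))
variable {k : ℤ} {φ : ℍ → CV → ℂ} {f : ℕ → LV → ℂ}
theorem hco_dbl (h : IsJacobiFormWith B k 3 φ f) (u : LV) (τ : ℍ) (w : ℂ) :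
    Summable fun p : (ℕ × LV) × ℕ => f p.1.1 p.1.2 * eC ((p.1.1:ℂ) * τ) *
      (Complex.I * ((2 * π * (bB B p.1.2 u : ℤ) : ℝ) : ℂ)) ^ p.2 / (p.2.factorial : ℂ) * w ^ p.2 := by
  refine dbl (fun p : ℕ × LV => f p.1 p.2 * eC ((p.1:ℂ) * τ)) (fun p => 2 * π * (bB B p.2 u : ℤ)) (fun y => ?_) w
  refine (h.expansion τ ((-Complex.I * y) • liftC u)).summable.congr fun p => ?_
  rw [fterm, mul_assoc, pairC_smul', pairC_lift]
  congr 2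
  rw [eC]; push_cast; congr 1
  linear_combination (-2 * π * (bB B p.2 u : ℤ) * y : ℂ) * Complex.I_mul_I
theorem hco_phi (h : IsJacobiFormWith B k 3 φ f) (u : LV) (τ : ℍ) (w : ℂ) :
    HasSum (fun d => hco B f u d τ * w ^ d) (φ τ (w • liftC u)) := by
  have hs := hco_dbl h u τ w
  have aa := ((Equiv.prodComm _ _).hasSum_iff).2 hs.hasSum
  have ab : ∑' p : (ℕ × LV) × ℕ, f p.1.1 p.1.2 * eC ((p.1.1:ℂ) * τ) *
      (Complex.I * ((2 * π * (bB B p.1.2 u : ℤ) : ℝ) : ℂ)) ^ p.2 / (p.2.factorial : ℂ) * w ^ p.2 = φ τ (w • liftC u) := by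
    refine HasSum.unique (hs.hasSum.prod_fiberwise (g := fun p : ℕ × LV => f p.1 p.2 * fterm B p.1 p.2 τ (w • liftC u))
      fun p => ?_) (h.expansion τ _)
    have he := (NormedSpace.expSeries_div_hasSum_exp (𝔸 := ℂ) (Complex.I * ((2 * π * (bB B p.2 u : ℤ) : ℝ) : ℂ) * w)).mul_left
      (f p.1 p.2 * eC ((p.1:ℂ) * τ))
    refine hs_of he (fun d => ?_) ?_
    · rw [mul_pow]; ring
    · rw [fterm, pairC_smul', pairC_lift, ← mul_assoc, ← Complex.exp_eq_exp_ℂ]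
      congr 1
      rw [eC]; congr 1; push_cast; ring
  rw [ab] at aa
  refine aa.prod_fiberwise fun d => ?_
  simp only [Function.comp, Equiv.prodComm_apply, Prod.swap_prod_mk]
  have ae := hs.prod_symm.prod_factor d
  simp only [Prod.swap_prod_mk] at ae
  rw [hco, ← tsum_mul_right]
  exact ae.hasSum
theorem hco_q (h : IsJacobiFormWith B k 3 φ f) (u : LV) (d : ℕ) (τ : ℍ) :
    HasSum (fun n => cco B f u d n * eC ((n:ℂ) * τ)) (hco B f u d τ) := by
  have hs := (hco_dbl h u τ 1).prod_symm.prod_factor d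
  simp only [Prod.swap_prod_mk, one_pow, mul_one] at hs
  refine hs.hasSum.prod_fiberwise fun n => ?_
  have ab := hs.prod_factor n
  refine hs_of ab.hasSum (fun _ => rfl) ?_
  rw [cco, ← tsum_mul_right]
  exact tsum_congr fun ℓ => by ring
theorem phi_S (h : IsJacobiFormWith B k 3 φ f) (u : LV) (τ : ℍ) (w : ℂ) :
    φ (ModularGroup.S • τ) ((w / τ) • liftC u) =
      (τ:ℂ) ^ k * cexp (3 * π * Complex.I * (bB B u u : ℤ) / τ * w ^ 2) * φ τ (w • liftC u) := by
  have := h.modular ModularGroup.S τ (w • liftC u)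
  have hj : jfactor ModularGroup.S τ = τ := by simp [jfactor, slc, sld, ModularGroup.S]
  have hs : slc ModularGroup.S = 1 := by simp [slc, ModularGroup.S]
  rw [hj, hs, pairC_smul, pairC_smul', pairC_lift, smul_smul, inv_mul_eq_div] at this
  rw [this]
  congr 3
  push_cast; ring
theorem hco_S (h : IsJacobiFormWith B k 3 φ f) (u : LV) (d : ℕ) (ag : ∀ e < d, ∀ τ, hco B f u e τ = 0) (τ : ℍ) :
    hco B f u d (ModularGroup.S • τ) = (τ:ℂ) ^ (k + d) * hco B f u d τ := by
  have hτ : (τ:ℂ) ≠ 0 := τ.ne_zero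
  obtain ⟨R, hR, hR0, hRG⟩ := tl _ _ (hco_phi h u τ) d
  obtain ⟨R', hR', hR0', hRG'⟩ := tl _ _ (hco_phi h u (ModularGroup.S • τ)) d
  have hz : ∀ τ w, ∑ e ∈ Finset.range d, hco B f u e τ * w ^ e = 0 := fun τ w =>
    Finset.sum_eq_zero fun e he => by rw [ag e (Finset.mem_range.1 he), zero_mul]
  simp only [hz, zero_add] at hRG hRG'
  have key := eq_at0 (P := fun w => R' (w / τ)) (Q := fun w => (τ:ℂ) ^ (k + d) * cexp (3 * π * Complex.I * (bB B u u : ℤ) / τ * w ^ 2) * R w)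
    (ContinuousAt.comp (g := R') (by simpa using hR') (by fun_prop)) (by fun_prop) (fun w hw => by
      have := phi_S h u τ w
      rw [hRG, hRG'] at this
      have bz : (w / τ) ^ d ≠ 0 := pow_ne_zero _ (div_ne_zero hw hτ)
      refine mul_left_cancel₀ bz (this.trans ?_)
      rw [zpow_add₀ hτ, zpow_natCast, div_pow]
      field_simp)
  simp only [zero_div] at key
  rw [hR0, hR0'] at key
  simpa using key
theorem hco_zero (h : IsJacobiFormWith B k 3 φ f) (av : ℕ) (hn0 : ∀ n < av, ∀ ℓ, f n ℓ = 0) (u : LV) (d : ℕ)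
    (hd : k + d < 12 * av) : (∀ τ, hco B f u d τ = 0) ∧ ∀ n, cco B f u d n = 0 := by
  induction d using Nat.strong_induction_on with
  | _ d ih =>
    have aa := sturm_q (k + d) (hco B f u d) (cco B f u d) av (hco_q h u d)
      (hco_S h u d fun e he => (ih e he (by have : (e:ℤ) < d := by exact_mod_cast he
                                            linarith)).1)
      (fun n hn => by rw [cco]; simp [hn0 n hn]) (Or.inl hd)
    refine ⟨fun τ => ?_, aa⟩
    have := hco_q h u d τ
    simp only [aa, zero_mul] at this
    exact this.unique hasSum_zero
theorem E2S (τ : ℍ) : EisensteinSeries.E2 (ModularGroup.S • τ) = (τ:ℂ) ^ 2 * EisensteinSeries.E2 τ + 6 / (π * Complex.I) * τ := by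
  have hτ : (τ:ℂ) ≠ 0 := τ.ne_zero
  have h := congrFun (EisensteinSeries.E2_slash_action ModularGroup.S) τ
  rw [ModularForm.SL_slash_apply, ModularGroup.denom_S] at h
  simp only [Pi.sub_apply, Pi.smul_apply, EisensteinSeries.D2, ModularGroup.denom_S, riemannZeta_two, smul_eq_mul] at h
  have hS : ((ModularGroup.S 1 0 : ℤ) : ℂ) = 1 := by simp [ModularGroup.S]
  have hp : (π:ℂ) ≠ 0 := by exact_mod_cast Real.pi_ne_zero
  rw [hS, _root_.zpow_neg, show ((2:ℤ)) = ((2:ℕ):ℤ) from rfl, zpow_natCast] at h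
  field_simp at h ⊢
  linear_combination Complex.I * h - 6 * (τ:ℂ) * Complex.I_sq
theorem hco_18 (h : IsJacobiFormWith B (-16) 3 φ f) (u : LV) :
    cco B f u 18 0 = - (π ^ 2 / 2) * (bB B u u : ℤ) * cco B f u 16 0 := by
  have hz : ∀ e < 16, ∀ τ, hco B f u e τ = 0 := fun e he => (hco_zero h 0 (fun n hn => absurd hn (by omega)) u e (by
    push_cast; omega)).1
  have h16S := hco_S h u 16 hz
  have hc : ∀ n, n ≠ 0 → cco B f u 16 n = 0 := by
    have := sturm_q 0 (fun τ => hco B f u 16 τ - cco B f u 16 0) (fun n => if n = 0 then 0 else cco B f u 16 n) 1 (fun τ => by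
      have aa := (hco_q h u 16 τ).sub (hasSum_ite_eq (0:ℕ) (cco B f u 16 0))
      refine hs_of aa (fun n => ?_) rfl
      by_cases hn : n = 0
      · subst hn; simp [eC]
      · simp [hn]) (fun τ => by rw [h16S]; simp) (fun n hn => by simp; omega) (Or.inl (by norm_num))
    intro n hn; have aa := this n; simpa [hn] using aa
  have h16 : ∀ τ, hco B f u 16 τ = cco B f u 16 0 := fun τ => by
    refine (hco_q h u 16 τ).unique ?_
    refine hs_of (hasSum_ite_eq (0:ℕ) (cco B f u 16 0)) (fun n => ?_) rfl
    by_cases hn : n = 0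
    · subst hn; simp [eC]
    · simp [hn, hc n hn]
  set C := cco B f u 16 0 with hC
  have h17 : ∀ τ, hco B f u 17 τ = 0 := by
    intro τ
    obtain ⟨R, hR, hR0, hRG⟩ := tl _ _ (hco_phi h u τ) 17
    have cb : ∀ w, ∑ e ∈ Finset.range 17, hco B f u e τ * w ^ e = C * w ^ 16 := fun w => by
      rw [Finset.sum_range_succ, h16, Finset.sum_eq_zero fun e he => by rw [hz e (Finset.mem_range.1 he), zero_mul], zero_add]
    simp only [cb] at hRG
    have key := eq_at0 (P := R) (Q := fun w => - R (-w)) hR (ContinuousAt.neg (ContinuousAt.comp (g := R) (by simpa using hR) (by fun_prop)))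
      (fun w hw => by
        have aa := phi_even h τ (w • liftC u)
        rw [← _root_.neg_smul, hRG, hRG] at aa
        refine mul_left_cancel₀ (pow_ne_zero 17 hw) ?_
        linear_combination -aa)
    simp only [neg_zero, hR0] at key
    exact self_eq_neg.1 key
  have h18S : ∀ τ : ℍ, hco B f u 18 (ModularGroup.S • τ) = (τ:ℂ) ^ 2 * hco B f u 18 τ + 3 * π * Complex.I * (bB B u u : ℤ) * τ * C := by
    intro τ
    have hτ : (τ:ℂ) ≠ 0 := τ.ne_zero
    have cb : ∀ τ w, ∑ e ∈ Finset.range 18, hco B f u e τ * w ^ e = C * w ^ 16 := fun τ w => by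
      rw [Finset.sum_range_succ, Finset.sum_range_succ, h16, h17, Finset.sum_eq_zero fun e he => by rw [hz e (Finset.mem_range.1 he), zero_mul]]; ring
    obtain ⟨R, hR, hR0, hRG⟩ := tl _ _ (hco_phi h u τ) 18
    obtain ⟨R', hR', hR0', hRG'⟩ := tl _ _ (hco_phi h u (ModularGroup.S • τ)) 18
    simp only [cb] at hRG hRG'
    set α : ℂ := 3 * π * Complex.I * (bB B u u : ℤ) / τ with hα
    obtain ⟨X, hX, hX0, hXG⟩ := tl (fun d => (1:ℂ) / d.factorial) cexp (fun w => by
      rw [Complex.exp_eq_exp_ℂ]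
      exact hs_of (NormedSpace.expSeries_div_hasSum_exp (𝔸 := ℂ) w) (fun d => by ring) rfl) 1
    have key := eq_at0 (P := fun w => R' (w / τ)) (Q := fun w => (τ:ℂ) ^ 2 * (cexp (α * w ^ 2) * R w + C * α * X (α * w ^ 2)))
      (ContinuousAt.comp (g := R') (by simpa using hR') (by fun_prop))
      (by
        have : ContinuousAt (fun w => X (α * w ^ 2)) 0 := ContinuousAt.comp (g := X) (by simpa using hX) (by fun_prop)
        exact continuousAt_const.mul (((by fun_prop : ContinuousAt (fun w : ℂ => cexp (α * w ^ 2)) 0).mul hR).add (continuousAt_const.mul this))) (fun w hw => by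
        have aa := phi_S h u τ w
        rw [hRG, hRG', ← hα] at aa
        have ab := hXG (α * w ^ 2)
        simp only [Finset.range_one, Finset.sum_singleton, pow_zero, pow_one, Nat.factorial_zero, Nat.cast_one, div_one, mul_one] at ab
        have bz : (w / τ) ^ 18 ≠ 0 := pow_ne_zero _ (div_ne_zero hw hτ)
        refine mul_left_cancel₀ bz ?_
        have ae : (w / τ) ^ 18 * R' (w / τ) = (τ:ℂ) ^ (-16:ℤ) * cexp (α * w ^ 2) * (C * w ^ 16 + w ^ 18 * R w) - C * (w / τ) ^ 16 := by
          linear_combination aa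
        rw [ae, _root_.zpow_neg, show ((16:ℤ)) = ((16:ℕ):ℤ) from rfl, zpow_natCast, div_pow, div_pow]
        have al : C * cexp (α * w ^ 2) = C + C * (α * w ^ 2 * X (α * w ^ 2)) := by rw [ab]; ring
        field_simp
        linear_combination al)
    simp only [zero_div] at key
    rw [hR0'] at key
    rw [key]
    simp only [ne_eq, OfNat.ofNat_ne_zero, not_false_eq_true, zero_pow, mul_zero, Complex.exp_zero, hX0, hR0]
    rw [hα]
    simp
    field_simp
  set β : ℂ := - (π ^ 2 / 2) * (bB B u u : ℤ) * C with hβ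
  have := sturm_q 2 (fun τ => hco B f u 18 τ - β * EisensteinSeries.E2 τ)
    (fun n => cco B f u 18 n - β * (if n = 0 then 1 else -24 * ArithmeticFunction.sigma 1 n : ℂ)) 0 (fun τ => by
      have aa := (hco_q h u 18 τ).sub ((EisensteinSeries.hasSum_qExpansion_E2 (z := τ)).mul_left β)
      refine hs_of aa (fun n => ?_) rfl
      rw [← qpar_pow, Function.Periodic.qParam]
      simp only [smul_eq_mul, ofReal_one, div_one]
      ring) (fun τ => by
      have hp : (π:ℂ) ≠ 0 := by exact_mod_cast Real.pi_ne_zero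
      rw [h18S, E2S, hβ, show ((2:ℤ)) = ((2:ℕ):ℤ) from rfl, zpow_natCast]
      field_simp
      linear_combination (6 * (τ:ℂ) * π * (bB B u u : ℤ) * C) * Complex.I_sq) (fun n hn => absurd hn (by omega)) (Or.inr rfl)
  have ag := this 0
  simpa [sub_eq_zero] using ag
end taylor
section lap
open MvPolynomial
abbrev PP := MvPolynomial FT ℂ
def lapl (G : MC) : PP →ₗ[ℂ] PP :=
  ∑ i, ∑ j, G i j • ((pderiv i : Derivation ℂ PP PP).toLinearMap ∘ₗ (pderiv j : Derivation ℂ PP PP).toLinearMap)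
theorem lapl_apply (G : MC) (p : PP) :
    lapl G p = ∑ i, ∑ j, C (G i j) * pderiv i (pderiv j p) := by
  simp [lapl, LinearMap.sum_apply, smul_eq_C_mul]
def lin (a : FT → ℂ) : PP := ∑ i, C (a i) * X i
theorem pd_lin (a : FT → ℂ) (i : FT) : pderiv i (lin a) = C (a i) := by
  rw [lin, map_sum, Finset.sum_eq_single i]
  · simp
  · intro j _ hj; simp [pderiv_X_of_ne hj]
  · simp
def quad (M : MC) : PP := ∑ i, X i * lin (M i)
theorem pd_quad (M : MC) (hM : M.IsSymm) (i : FT) : pderiv i (quad M) = 2 * lin (M i) := by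
  rw [quad, map_sum]
  have : ∀ j, pderiv i (X j * lin (M j) : PP) = pderiv i (X j : PP) * lin (M j) + C (M i j) * X j := by
    intro j; rw [Derivation.leibniz, pd_lin, smul_eq_mul, smul_eq_mul, hM.apply j i]; ring
  rw [scg fun j _ => this j, Finset.sum_add_distrib, Finset.sum_eq_single i, two_mul, pderiv_X_self, one_mul]
  · rfl
  · intro j _ hj; rw [pderiv_X_of_ne hj, zero_mul]
  · simp
theorem pd_pow (a : FT → ℂ) (i : FT) (e : ℕ) : pderiv i (lin a ^ e) = C (e * a i) * lin a ^ (e - 1) := by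
  rw [Derivation.leibniz_pow, pd_lin]; simp; ring
theorem pd_pow2 (a : FT → ℂ) (i j : FT) (e : ℕ) :
    pderiv i (pderiv j (lin a ^ e)) = C ((e * (e - 1 : ℕ) : ℂ) * (a i * a j)) * lin a ^ (e - 2) := by
  rw [pd_pow, pderiv_C_mul, pd_pow, ← mul_assoc, ← C_mul, show e - 1 - 1 = e - 2 by omega]
  congr 2; ring
theorem lapl_pow (G : MC) (a : FT → ℂ) (N : ℂ) (hN : ∑ i, ∑ j, G i j * (a i * a j) = N) (e : ℕ) :
    lapl G (lin a ^ e) = C ((e * (e - 1 : ℕ) : ℂ) * N) * lin a ^ (e - 2) := by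
  rw [lapl_apply, ← hN, Finset.mul_sum, map_sum, Finset.sum_mul]
  refine scg fun i _ => ?_
  rw [Finset.mul_sum, map_sum, Finset.sum_mul]
  refine scg fun j _ => ?_
  rw [pd_pow2, ← mul_assoc, ← C_mul]
  congr 2; ring
theorem pd_qpow (M : MC) (hM : M.IsSymm) (a : FT → ℂ) (i j : FT) (e : ℕ) :
    pderiv i (pderiv j (quad M * lin a ^ e)) = C (2 * M j i) * lin a ^ e + C (2 * e : ℂ) * lin a ^ (e - 1) * (C (a i) * lin (M j))
      + C (2 * e : ℂ) * lin a ^ (e - 1) * (C (a j) * lin (M i)) + quad M * (C ((e * (e - 1 : ℕ) : ℂ) * (a i * a j)) * lin a ^ (e - 2)) := by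
  have ab : (2:PP) = C 2 := (map_ofNat C 2).symm
  rw [Derivation.leibniz, map_add, smul_eq_mul, smul_eq_mul, Derivation.leibniz, Derivation.leibniz, pd_pow2, pd_pow, pd_pow, pd_quad M hM,
    pd_quad M hM, ab, pderiv_C_mul, pd_lin]
  simp only [smul_eq_mul, C_mul]
  ring
theorem lapl_qpow (G M : MC) (hM : M.IsSymm) (hGM : ∑ i, ∑ j, G i j * M j i = 24) (a l : FT → ℂ) (N : ℂ)
    (hN : ∑ i, ∑ j, G i j * (a i * a j) = N) (aa : ∀ i, ∑ j, G i j * a j = l i) (ab : ∀ j, ∑ i, G i j * a i = l j)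
    (hl : ∀ k, ∑ i, l i * M i k = a k) (e : ℕ) :
    lapl G (quad M * lin a ^ e) = C (48 + 4 * e : ℂ) * lin a ^ e + C ((e * (e - 1 : ℕ) : ℂ) * N) * (quad M * lin a ^ (e - 2)) := by
  have hL : ∑ i, C (l i) * lin (M i) = lin a := by
    simp only [lin, Finset.mul_sum]
    rw [Finset.sum_comm]
    refine scg fun k _ => ?_
    rw [← hl k, map_sum, Finset.sum_mul]
    exact scg fun i _ => by rw [C_mul, mul_assoc]
  have ah : ∑ i, ∑ j, C (G i j) * (C (2 * M j i) * lin a ^ e) = C 48 * lin a ^ e := by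
    rw [show (48:ℂ) = ∑ i, ∑ j, G i j * M j i + ∑ i, ∑ j, G i j * M j i by rw [hGM]; norm_num, ← Finset.sum_add_distrib, map_sum, Finset.sum_mul]
    refine scg fun i _ => ?_
    rw [← Finset.sum_add_distrib, map_sum, Finset.sum_mul]
    refine scg fun j _ => ?_
    rw [← mul_assoc, ← C_mul]; congr 2; ring
  have aj : ∑ i, ∑ j, C (G i j) * (C (2 * e : ℂ) * lin a ^ (e - 1) * (C (a i) * lin (M j))) = C (2 * e : ℂ) * lin a ^ (e - 1) * lin a := by
    rw [Finset.sum_comm]; nth_rw 3 [← hL]; rw [Finset.mul_sum]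
    refine scg fun j _ => ?_
    rw [← ab j, map_sum, Finset.sum_mul, Finset.mul_sum]
    refine scg fun i _ => ?_
    rw [C_mul (a := G i j)]; ring
  have bc : ∑ i, ∑ j, C (G i j) * (C (2 * e : ℂ) * lin a ^ (e - 1) * (C (a j) * lin (M i))) = C (2 * e : ℂ) * lin a ^ (e - 1) * lin a := by
    nth_rw 3 [← hL]; rw [Finset.mul_sum]
    refine scg fun j _ => ?_
    rw [← aa j, map_sum, Finset.sum_mul, Finset.mul_sum]
    refine scg fun i _ => ?_
    rw [C_mul (a := G j i)]; ring
  have br : ∑ i, ∑ j, C (G i j) * (quad M * (C ((e * (e - 1 : ℕ) : ℂ) * (a i * a j)) * lin a ^ (e - 2))) =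
      quad M * (C ((e * (e - 1 : ℕ) : ℂ) * N) * lin a ^ (e - 2)) := by
    rw [← lapl_pow G a N hN, lapl_apply, Finset.mul_sum]
    refine scg fun i _ => ?_
    rw [Finset.mul_sum]
    refine scg fun j _ => ?_
    rw [pd_pow2]; ring
  have e5 : C (2 * e : ℂ) * lin a ^ (e - 1) * lin a = C (2 * e : ℂ) * lin a ^ e := by
    rcases Nat.eq_zero_or_pos e with h | h
    · subst h; simp
    · rw [mul_assoc, ← pow_succ, Nat.sub_add_cancel h]
  rw [lapl_apply]
  simp only [pd_qpow M hM, mul_add, Finset.sum_add_distrib, ah, aj, bc, br]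
  rw [e5, show (48 + 4 * e : ℂ) = 48 + 2 * e + 2 * e by ring, C_add, C_add]
  ring
variable {B : MZ}
def aB (B : MZ) (x : LV) : FT → ℂ := fun i => ((B.mulVec x) i : ℤ)
theorem ev_lin (hB : IsLeech B) (x u : LV) : eval (liftC u) (lin (aB B x)) = (bB B x u : ℤ) := by
  rw [bB_symm hB, bB_apply, pairZ, lin, map_sum, dotProduct]
  push_cast
  exact scg fun i _ => by simp [aB, liftC]; ring
theorem ev_quad (u : LV) : eval (liftC u) (quad (B.map (Int.cast : ℤ → ℂ))) = (bB B u u : ℤ) := by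
  rw [bB_apply, pairZ, quad, map_sum, dotProduct]
  push_cast
  refine scg fun i _ => ?_
  simp [lin, liftC, Matrix.mulVec, dotProduct]
theorem ev_ext {p q : PP} (h : ∀ u : LV, eval (liftC u) p = eval (liftC u) q) : p = q := by
  refine funext_set (fun _ => Set.range (Int.cast : ℤ → ℂ)) (fun _ => Set.infinite_range_of_injective Int.cast_injective) fun x hx => ?_
  choose u hu using fun i => hx i trivial
  have : x = liftC u := by ext i; exact (hu i).symm
  rw [this]; exact h u
def TT (B : MZ) (S : Finset LV) (g : LV → ℂ) (e m : ℕ) : PP :=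
  ∑ x ∈ S, C (g x * (bB B x x : ℤ) ^ m) * lin (aB B x) ^ e
theorem lapB (hB : IsLeech B) : ∃ D : PP →ₗ[ℂ] PP, ∀ (S : Finset LV) (g : LV → ℂ) (e m : ℕ),
    D (TT B S g e m) = C (e * (e - 1 : ℕ) : ℂ) * TT B S g (e - 2) (m + 1) ∧
    D (quad (B.map (Int.cast : ℤ → ℂ)) * TT B S g e m) = C (48 + 4 * e : ℂ) * TT B S g e m +
      C (e * (e - 1 : ℕ) : ℂ) * (quad (B.map (Int.cast : ℤ → ℂ)) * TT B S g (e - 2) (m + 1)) := by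
  have hu : IsUnit B.det := by rw [hB.2.1]; exact isUnit_one
  have g1 := Matrix.nonsing_inv_mul B hu
  have g2 := Matrix.mul_nonsing_inv B hu
  set G := B⁻¹
  set Gc : MC := G.map (Int.cast : ℤ → ℂ) with hGc
  set M : MC := B.map (Int.cast : ℤ → ℂ) with hMd
  have hM : M.IsSymm := by ext i j; simp [hMd, hB.1.apply]
  have hGM : ∑ i, ∑ j, Gc i j * M j i = 24 := by
    have ag : ∑ i, ∑ j, G i j * B j i = 24 := by
      have := congrArg Matrix.trace g1
      simpa [Matrix.trace, Matrix.mul_apply] using this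
    simp only [hGc, hMd, Matrix.map_apply]; exact_mod_cast ag
  have aa : ∀ x i, ∑ j, Gc i j * aB B x j = liftC x i := by
    intro x i
    have ag : (G.mulVec (B.mulVec x)) i = x i := by rw [Matrix.mulVec_mulVec, g1, Matrix.one_mulVec]
    simp only [hGc, Matrix.map_apply, aB, liftC, ← ag]; simp [Matrix.mulVec, dotProduct]
  have ab : ∀ x j, ∑ i, Gc i j * aB B x i = liftC x j := by
    intro x j
    have ag : (Gᵀ.mulVec (B.mulVec x)) j = x j := by
      rw [Matrix.mulVec_mulVec, show Gᵀ * B = 1 by rw [← hB.1, ← Matrix.transpose_mul, g2, Matrix.transpose_one], Matrix.one_mulVec]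
    simp only [hGc, Matrix.map_apply, aB, liftC, ← ag]; simp [Matrix.mulVec, dotProduct]
  have hl : ∀ x k, ∑ i, liftC x i * M i k = aB B x k := by
    intro x k
    simp only [hMd, Matrix.map_apply, aB, liftC, Matrix.mulVec, dotProduct]
    push_cast
    exact scg fun i _ => by rw [hB.1.apply k i]; ring
  have hN : ∀ x, ∑ i, ∑ j, Gc i j * (aB B x i * aB B x j) = (bB B x x : ℤ) := by
    intro x
    rw [bB_apply, pairZ, dotProduct, Finset.sum_comm]
    push_cast
    refine scg fun j _ => ?_
    rw [show ((x j : ℤ) : ℂ) = liftC x j from rfl, ← ab x j, Finset.sum_mul]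
    exact scg fun i _ => by simp only [aB]; ring
  refine ⟨lapl Gc, fun S g e m => ⟨?_, ?_⟩⟩
  · rw [TT, TT, map_sum, Finset.mul_sum]
    refine scg fun x _ => ?_
    rw [← smul_eq_C_mul, map_smul, lapl_pow Gc _ _ (hN x), smul_eq_C_mul, ← mul_assoc, ← mul_assoc, ← C_mul, ← C_mul]
    congr 2; ring
  · simp only [TT, map_sum, Finset.mul_sum]
    rw [← Finset.sum_add_distrib]
    refine scg fun x _ => ?_
    rw [mul_left_comm, ← smul_eq_C_mul, map_smul, lapl_qpow Gc M hM hGM _ _ _ (hN x) (aa x) (ab x) (hl x), smul_eq_C_mul]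
    simp only [C_mul, pow_succ]
    ring
theorem TT_ev (hB : IsLeech B) (S : Finset LV) (g : LV → ℂ) (e : ℕ) (u : LV) :
    eval (liftC u) (TT B S g e 0) = ∑ x ∈ S, g x * ((bB B x u : ℤ) : ℂ) ^ e := by
  simp [TT, map_sum, ev_lin hB]
theorem TT_0 (S : Finset LV) (g : LV → ℂ) (m : ℕ) :
    TT B S g 0 m = C (∑ x ∈ S, g x * ((bB B x x : ℤ) : ℂ) ^ m) := by
  simp [TT, map_sum]
theorem radial_zero (hB : IsLeech B) (S : Finset LV) (g : LV → ℂ) (j : ℕ)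
    (h : ∀ u : LV, ∑ x ∈ S, g x * ((bB B x u : ℤ) : ℂ) ^ (2 * j) = 0) : ∑ x ∈ S, g x * ((bB B x x : ℤ) : ℂ) ^ j = 0 := by
  obtain ⟨D, hD⟩ := lapB hB
  have key : ∀ i ≤ j, TT B S g (2 * (j - i)) i = 0 := by
    intro i
    induction i with
    | zero => intro _; exact ev_ext fun u => by simpa [TT_ev hB] using h u
    | succ i ih =>
      intro hi
      have aa := (hD S g (2 * (j - i)) i).1
      rw [ih (by omega), map_zero, show 2 * (j - i) - 2 = 2 * (j - (i + 1)) by omega] at aa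
      refine (mul_eq_zero.1 aa.symm).resolve_left ?_
      rw [C_eq_zero]
      have bx : 2 * (j - i) ≠ 0 := by omega
      have a2 : 2 * (j - i) - 1 ≠ 0 := by omega
      exact mul_ne_zero (Nat.cast_ne_zero.2 bx) (Nat.cast_ne_zero.2 a2)
  have := key j le_rfl
  rw [Nat.sub_self, mul_zero, TT_0, C_eq_zero] at this
  exact this
theorem radial_98 (hB : IsLeech B) (S : Finset LV) (g : LV → ℂ)
    (h : ∀ u : LV, ∑ x ∈ S, g x * ((bB B x u : ℤ) : ℂ) ^ 18 = 153 / 4 * (bB B u u : ℤ) * ∑ x ∈ S, g x * ((bB B x u : ℤ) : ℂ) ^ 16) :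
    ∑ x ∈ S, g x * ((bB B x x : ℤ) : ℂ) ^ 9 = 90 * ∑ x ∈ S, g x * ((bB B x x : ℤ) : ℂ) ^ 8 := by
  obtain ⟨D, hD⟩ := lapB hB
  set Q := quad (B.map (Int.cast : ℤ → ℂ)) with hQ
  have ag : TT B S g 18 0 = C (153 / 4) * (Q * TT B S g 16 0) := ev_ext fun u => by
    simp only [map_mul, eval_C, TT_ev hB, hQ, ev_quad, h, mul_assoc]
  have cm : ∀ (c : ℂ) (p : PP), D (C c * p) = C c * D p := fun c p => by rw [← smul_eq_C_mul, map_smul, smul_eq_C_mul]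
  have step : ∀ (α β γ : ℂ) (e i : ℕ), C α * TT B S g (e + 2) (i + 1) = C β * (Q * TT B S g e (i + 1)) + C γ * TT B S g (e + 2) i →
      C (α * ((e + 2) * (e + 1))) * TT B S g e (i + 2) = C (β * (e * (e - 1 : ℕ))) * (Q * TT B S g (e - 2) (i + 2)) +
        C (β * (48 + 4 * e) + γ * ((e + 2) * (e + 1))) * TT B S g e (i + 1) := by
    intro α β γ e i aa
    have ab := congrArg D aa
    rw [map_add, cm, cm, cm, (hD S g (e + 2) (i + 1)).1, (hD S g (e + 2) i).1, (hD S g e (i + 1)).2] at ab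
    simp only [Nat.add_sub_cancel, show e + 2 - 1 = e + 1 by omega, Nat.cast_add, Nat.cast_one, Nat.cast_ofNat] at ab
    simp only [C_mul, C_add] at ab ⊢
    linear_combination ab
  have ap : C (18 * 17) * TT B S g 16 1 = C (153 / 4 * (16 * 15)) * (Q * TT B S g 14 1) + C (153 / 4 * (48 + 4 * 16)) * TT B S g 16 0 := by
    have ab := congrArg D ag
    rw [cm, (hD S g 18 0).1, (hD S g 16 0).2] at ab
    norm_num only at ab
    rw [mul_add, ← mul_assoc, ← mul_assoc, ← C_mul, ← C_mul] at ab
    norm_num only at ab ⊢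
    rw [ab]; ring
  have ar := step _ _ _ 14 0 ap
  norm_num only at ar
  have be := step _ _ _ 12 1 ar
  norm_num only at be
  have s4 := step _ _ _ 10 2 be
  norm_num only at s4
  have s5 := step _ _ _ 8 3 s4
  norm_num only at s5
  have s6 := step _ _ _ 6 4 s5
  norm_num only at s6
  have s7 := step _ _ _ 4 5 s6
  norm_num only at s7
  have s8 := step _ _ _ 2 6 s7
  norm_num only at s8
  have s9 := step _ _ _ 0 7 s8
  norm_num only at s9
  rw [TT_0, TT_0, C_0, zero_mul, zero_add, ← C_mul, ← C_mul] at s9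
  have := C_injective _ _ s9
  linear_combination (1 / 6402373705728000 : ℂ) * this
end lap
section finish
theorem polysum {ι : Type} (S : Finset ι) (g y : ι → ℂ) (m : ℕ) (h : ∀ j < m, ∑ x ∈ S, g x * y x ^ j = 0)
    (p : Polynomial ℂ) (hp : p.natDegree < m) : ∑ x ∈ S, g x * p.eval (y x) = 0 := by
  simp only [Polynomial.eval_eq_sum_range, Finset.mul_sum]
  rw [Finset.sum_comm]
  refine Finset.sum_eq_zero fun j hj => ?_
  have aa := h j (by rw [Finset.mem_range] at hj; omega)
  rw [← mul_zero (p.coeff j), ← aa, Finset.mul_sum]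
  exact scg fun x _ => by ring
theorem prodsum {ι : Type} (S : Finset ι) (g y : ι → ℂ) (m : ℕ) (h : ∀ j < m, ∑ x ∈ S, g x * y x ^ j = 0)
    (V : Finset ℤ) (hV : V.card < m) : ∑ x ∈ S, g x * ∏ v ∈ V, (y x - v) = 0 := by
  have aa := polysum S g y m h (∏ v ∈ V, (Polynomial.X - Polynomial.C (v:ℂ))) (by
    rw [Polynomial.natDegree_prod_of_monic _ _ fun v _ => Polynomial.monic_X_sub_C _]; simpa only [Polynomial.natDegree_X_sub_C, Finset.sum_const, smul_eq_mul, mul_one] using hV)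
  simpa [Polynomial.eval_prod] using aa
def VV : Finset ℤ := {0, 4, 6, 8, 10, 12, 14, 16, 18}
theorem interp {ι : Type} (S : Finset ι) (g : ι → ℂ) (N : ι → ℤ) (hN : ∀ x ∈ S, N x ∈ VV)
    (h : ∀ j < 9, ∑ x ∈ S, g x * (N x : ℂ) ^ j = 0) (n : ℤ) : ∑ x ∈ S with N x = n, g x = 0 := by
  by_cases hn : n ∈ VV
  · have aa := prodsum S g (fun x => (N x : ℂ)) 9 h (VV.erase n) (by rw [Finset.card_erase_of_mem hn]; decide)
    have ab : ∑ x ∈ S, g x * ∏ v ∈ VV.erase n, ((N x : ℂ) - v) = (∑ x ∈ S with N x = n, g x) * ∏ v ∈ VV.erase n, ((n : ℂ) - v) := by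
      rw [Finset.sum_filter, Finset.sum_mul]
      refine scg fun x hx => ?_
      by_cases e : N x = n
      · simp [e]
      · rw [if_neg e, zero_mul, Finset.prod_eq_zero (i := N x) (Finset.mem_erase.2 ⟨e, hN x hx⟩) (sub_self ((N x : ℤ) : ℂ)), mul_zero]
    rw [ab] at aa
    refine (mul_eq_zero.1 aa).resolve_right (Finset.prod_ne_zero_iff.2 fun v hv => ?_)
    rw [sub_ne_zero]
    exact_mod_cast (Finset.ne_of_mem_erase hv).symm
  · rw [Finset.filter_false_of_mem, Finset.sum_empty]
    rintro x hx rfl; exact hn (hN x hx)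
theorem rel88 {ι : Type} (S : Finset ι) (g : ι → ℂ) (N : ι → ℤ) (hN : ∀ x ∈ S, N x ∈ VV)
    (h : ∀ j < 8, ∑ x ∈ S, g x * (N x : ℂ) ^ j = 0) : ∑ x ∈ S, g x * (N x : ℂ) ^ 9 = 88 * ∑ x ∈ S, g x * (N x : ℂ) ^ 8 := by
  have aa : ∑ x ∈ S, g x * ((-3304) * (N x : ℂ) ^ 7 + (68992) * (N x : ℂ) ^ 6 + (-874384) * (N x : ℂ) ^ 5 + (6869632) * (N x : ℂ) ^ 4 + (-32576256) * (N x : ℂ) ^ 3 + (84953088) * (N x : ℂ) ^ 2 + (-92897280) * (N x : ℂ) ^ 1) = 0 := by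
    have := polysum S g (fun x => (N x : ℂ)) 8 h (Polynomial.C (-3304:ℂ) * Polynomial.X ^ 7 + Polynomial.C (68992:ℂ) * Polynomial.X ^ 6 + Polynomial.C (-874384:ℂ) * Polynomial.X ^ 5 + Polynomial.C (6869632:ℂ) * Polynomial.X ^ 4 + Polynomial.C (-32576256:ℂ) * Polynomial.X ^ 3 + Polynomial.C (84953088:ℂ) * Polynomial.X ^ 2 + Polynomial.C (-92897280:ℂ) * Polynomial.X ^ 1) (by
      refine lt_of_le_of_lt (b := 7) ?_ (by norm_num); compute_degree)
    simpa using this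
  rw [← add_zero (88 * _), ← aa, Finset.mul_sum, ← Finset.sum_add_distrib]
  refine scg fun x hx => ?_
  have ab : (N x : ℂ) ^ 9 = 88 * (N x : ℂ) ^ 8 + ((-3304) * (N x : ℂ) ^ 7 + (68992) * (N x : ℂ) ^ 6 + (-874384) * (N x : ℂ) ^ 5 + (6869632) * (N x : ℂ) ^ 4 + (-32576256) * (N x : ℂ) ^ 3 + (84953088) * (N x : ℂ) ^ 2 + (-92897280) * (N x : ℂ) ^ 1) := by
    have := hN x hx
    simp only [VV, Finset.mem_insert, Finset.mem_singleton] at this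
    rcases this with e | e | e | e | e | e | e | e | e <;> rw [e] <;> norm_num
  rw [ab]; ring
variable {B : MZ}
theorem cco_sum (f : ℕ → LV → ℂ) (n : ℕ) (S : Finset LV) (hS : ∀ x, f n x ≠ 0 → x ∈ S) (u : LV) (d : ℕ) :
    cco B f u d n = ((2 * π * Complex.I) ^ d / d.factorial) * ∑ x ∈ S, f n x * ((bB B x u : ℤ) : ℂ) ^ d := by
  rw [cco, tsum_eq_sum (s := S), Finset.mul_sum]
  · refine scg fun x _ => ?_
    push_cast
    rw [show Complex.I * (2 * π * ((bB B x u : ℤ) : ℂ)) = 2 * π * Complex.I * ((bB B x u : ℤ) : ℂ) by ring, mul_pow]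
    ring
  · intro x hx
    rw [not_not.1 (mt (hS x) hx), zero_mul]
theorem main_even (hB : IsLeech B) {k : ℤ} (hk : k < -14) (he : Even k) {φ : ℍ → CV → ℂ} {f : ℕ → LV → ℂ}
    (h : IsJacobiFormWith B k 3 φ f) (av : ℕ) (hn0 : ∀ n < av, ∀ ℓ, f n ℓ = 0) : ∀ ℓ, f av ℓ = 0 := by
  have hk16 : k ≤ -16 := by obtain ⟨r, hr⟩ := he; omega
  have H := leechLL hB
  have ae : ∀ x, f av x ≠ 0 → S3 (bB B) x := by
    intro x hx w
    obtain ⟨r, hr⟩ : ∃ r, bB B w w = 2 * r := ⟨bB B w w / 2, by have := H.even w; omega⟩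
    have aa := extF_shift hB h (-w) (r := r) (by simp; omega) av x
    have ab : extF f ((av:ℤ), x) = f av x := by simp [extF]
    rw [ab] at aa
    rw [← aa, extF] at hx
    simp only [map_neg] at hx
    split_ifs at hx with hc
    · have : av ≤ ((av:ℤ) + -(bB B x w) + 3 * r).toNat := by
        by_contra hlt
        exact hx (hn0 _ (by omega) _)
      omega
    · exact absurd rfl hx
  have hcls : ∀ x, f av x ≠ 0 → bB B x x ∈ VV := by
    intro x hx
    have := H.cls (ae x hx)
    simp only [VV, Finset.mem_insert, Finset.mem_singleton]
    cases this <;> omega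
  set S : Finset LV := VV.biUnion (nrm B hB) with hSd
  have hS : ∀ x, f av x ≠ 0 → x ∈ S := fun x hx => Finset.mem_biUnion.2 ⟨_, hcls x hx, (mem_nrm hB _ _).2 rfl⟩
  have hSV : ∀ x ∈ S, bB B x x ∈ VV := by
    intro x hx
    obtain ⟨n, hn, hx⟩ := Finset.mem_biUnion.1 hx
    rw [(mem_nrm hB _ _).1 hx]; exact hn
  have hc0 : ∀ d : ℕ, (2 * π * Complex.I : ℂ) ^ d / d.factorial ≠ 0 := fun d =>
    div_ne_zero (pow_ne_zero _ (by simp [Real.pi_ne_zero])) (Nat.cast_ne_zero.2 d.factorial_ne_zero)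
  have hz : ∀ d : ℕ, k + d < 12 * av → ∀ u, ∑ x ∈ S, f av x * ((bB B x u : ℤ) : ℂ) ^ d = 0 := by
    intro d hd u
    have aa := (hco_zero h av hn0 u d hd).2 av
    rw [cco_sum f av S hS] at aa
    exact (mul_eq_zero.1 aa).resolve_left (hc0 d)
  have hr8 : ∀ j < 8, ∑ x ∈ S, f av x * ((bB B x x : ℤ) : ℂ) ^ j = 0 := fun j hj =>
    radial_zero hB S (f av) j (hz (2 * j) (by push_cast; omega))
  have hr9 : ∑ x ∈ S, f av x * ((bB B x x : ℤ) : ℂ) ^ 8 = 0 := by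
    by_cases hc : k = -16 ∧ av = 0
    · obtain ⟨rfl, rfl⟩ := hc
      have aa := radial_98 hB S (f 0) (fun u => by
        have aa := hco_18 h u
        rw [cco_sum f 0 S hS, cco_sum f 0 S hS] at aa
        have hp : (π:ℂ) ≠ 0 := by exact_mod_cast Real.pi_ne_zero
        refine mul_left_cancel₀ (hc0 18) (aa.trans ?_)
        have e : (2 * π * Complex.I : ℂ) ^ 18 / (Nat.factorial 18 : ℕ) = (2 * π * Complex.I : ℂ) ^ 16 / (Nat.factorial 16 : ℕ) * (-4 * π ^ 2 / 306) := by
          rw [show (Nat.factorial 18 : ℕ) = 306 * Nat.factorial 16 from rfl, show (2 * π * Complex.I : ℂ) ^ 18 = (2 * π * Complex.I : ℂ) ^ 16 * (4 * π ^ 2 * Complex.I ^ 2) by ring, Complex.I_sq]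
          push_cast
          have : ((Nat.factorial 16 : ℕ) : ℂ) ≠ 0 := Nat.cast_ne_zero.2 (Nat.factorial_ne_zero _)
          field_simp
        rw [e]; ring)
      have ab := rel88 S (f 0) (fun x => bB B x x) hSV hr8
      linear_combination (1 / 2) * ab - (1 / 2) * aa
    · refine radial_zero hB S (f av) 8 (hz 16 ?_)
      obtain ⟨r, hr⟩ := he
      push_cast; omega
  refine H.lat_final (f av) S hS (fun σ hσ x => ?_) ae ?_ ?_
  · have := extF_inv hB h σ hσ av x
    simpa [extF] using this
  · refine interp S (f av) (fun x => bB B x x) hSV fun j hj => ?_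
    rcases Nat.lt_succ_iff_lt_or_eq.1 hj with aa | aa
    · exact hr8 j aa
    · rw [aa]; exact hr9
  · intro v _
    exact prodsum S (f av) (fun x => ((bB B x v : ℤ) : ℂ)) 13 (fun j hj => hz j (by omega) v) _ (by simp)
theorem main_thm (hB : IsLeech B) {k : ℤ} (hk : k < -14) {φ : ℍ → CV → ℂ} {f : ℕ → LV → ℂ}
    (h : IsJacobiFormWith B k 3 φ f) (τ : ℍ) (z : CV) : φ τ z = 0 := by
  rcases Int.even_or_odd k with he | ho
  · have ag : ∀ n, ∀ ℓ, f n ℓ = 0 := fun n => by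
      induction n using Nat.strong_induction_on with
      | _ n ih => exact main_even hB hk he h n ih
    have := h.expansion τ z
    simp only [ag, zero_mul] at this
    exact this.unique hasSum_zero
  · exact phi_odd h ho τ z
end finish
/-- Every Conway invariant weak Jacobi form of index 3 and weight `k < −14` vanishes. -/
theorem weak_jacobi_index_three_minimal_weight
    (B : Matrix (Fin 24) (Fin 24) ℤ) (hB : IsLeech B)
    (k : ℤ) (hk : k < -14)
    (φ : UpperHalfPlane → CV → ℂ) (hφ : IsWeakJacobiForm B k 3 φ) :
    ∀ (τ : UpperHalfPlane) (z : CV), φ τ z = 0 := by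
  obtain ⟨f, hf⟩ := hφ
  exact main_thm hB hk hf

end
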